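/- Let G ⊆ O(Λ) be a finite group of isometries of the Leech lattice such that the coinvariant lattice S_G(Λ) has rank at most 20 and the invariant lattice T_G(Λ) satisfies rk(T_G(Λ)) > l(A_{T_G(Λ)}). Then there exist an integer n ≥ 2, a primitive vector v ∈ L_M with b(v,v) = 2n−2, and a primitive embedding ι : S_G(Λ) → v^⊥ ⊆ L_M such that every element of ι(S_G(Λ)) has divisibility 1 in v^⊥, ι(S_G(Λ)) contains no numerical wall divisors with respect to v, and G extends to a group of isometries of v^⊥ acting as the identity on the orthogonal complement of ι(S_G(Λ)) in v^⊥. -/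

import Mathlib

open Matrix Module

/-- The bilinear form on `ι → ℤ` associated to a Gram matrix. -/
def gramBilin {ι : Type*} [Fintype ι] (G : Matrix ι ι ℤ) :
    (ι → ℤ) →ₗ[ℤ] (ι → ℤ) →ₗ[ℤ] ℤ :=
  LinearMap.mk₂ ℤ (fun x y => x ⬝ᵥ (G *ᵥ y))
    (fun x x' y => add_dotProduct x x' (G *ᵥ y))
    (fun c x y => smul_dotProduct c x (G *ᵥ y))
    (fun x y y' => by show x ⬝ᵥ (G *ᵥ (y + y')) = _; rw [Matrix.mulVec_add, dotProduct_add])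
    (fun c x y => by show x ⬝ᵥ (G *ᵥ (c • y)) = _; rw [Matrix.mulVec_smul, dotProduct_smul])

/-- The invariant sublattice `T_G` of a group of isometries. -/
def invSub {R : Type*} [AddCommGroup R] (G : Subgroup (R ≃ₗ[ℤ] R)) : Submodule ℤ R where
  carrier := {x | ∀ g ∈ G, g x = x}
  add_mem' := by
    intro a b ha hb g hg
    simp only [Set.mem_setOf_eq] at *
    rw [map_add, ha g hg, hb g hg]
  zero_mem' := by intro g hg; exact map_zero _
  smul_mem' := by
    intro c x hx g hg
    simp only [Set.mem_setOf_eq] at hx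
    rw [_root_.map_smul, hx g hg]

/-- The orthogonal complement of a submodule with respect to a bilinear form. -/
def orthSub {M : Type*} [AddCommGroup M] (b : M →ₗ[ℤ] M →ₗ[ℤ] ℤ)
    (T : Submodule ℤ M) : Submodule ℤ M where
  carrier := {x | ∀ y ∈ T, b x y = 0}
  add_mem' := by
    intro a c ha hc y hy
    simp only [Set.mem_setOf_eq] at *
    rw [map_add, LinearMap.add_apply, ha y hy, hc y hy, add_zero]
  zero_mem' := by intro y hy; simp
  smul_mem' := by
    intro k x hx y hy
    simp only [Set.mem_setOf_eq] at hx
    rw [_root_.map_smul, LinearMap.smul_apply, hx y hy, smul_zero]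

/-- The minimal number of generators of a `ℤ`-module. -/
noncomputable def genLength (Q : Type*) [AddCommGroup Q] : ℕ :=
  sInf {k | ∃ f : Fin k → Q, Submodule.span ℤ (Set.range f) = ⊤}

/-- The E8 Cartan matrix (Bourbaki numbering). -/
def E8M : Matrix (Fin 8) (Fin 8) ℤ :=
  !![2,0,-1,0,0,0,0,0;
     0,2,0,-1,0,0,0,0;
     -1,0,2,-1,0,0,0,0;
     0,-1,-1,2,-1,0,0,0;
     0,0,0,-1,2,-1,0,0;
     0,0,0,0,-1,2,-1,0;
     0,0,0,0,0,-1,2,-1;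
     0,0,0,0,0,0,-1,2]

/-- Index type for the Mukai lattice `L_M = U^4 ⊕ E8(-1)^2`. -/
abbrev MukaiIx : Type := (Fin 4 × Fin 2) ⊕ (Fin 2 × Fin 8)

/-- The underlying module of the Mukai lattice. -/
abbrev LM : Type := MukaiIx → ℤ

/-- The Gram matrix of the Mukai lattice `U^4 ⊕ E8(-1)^2`. -/
def GLM : Matrix MukaiIx MukaiIx ℤ :=
  Matrix.of fun p q =>
    match p, q with
    | .inl (i, a), .inl (j, b) => if i = j ∧ a ≠ b then 1 else 0
    | .inr (i, a), .inr (j, b) => if i = j then -(E8M a b) else 0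
    | _, _ => 0

/-- The bilinear form of the Mukai lattice. -/
def bLM : LM →ₗ[ℤ] LM →ₗ[ℤ] ℤ := gramBilin GLM

/-- `D` is a numerical wall divisor with respect to a primitive `v ∈ L_M` with
`b(v,v) = 2n-2`: `D` is a primitive element of `v^⊥` and, `T_D` being the primitive
rank-2 sublattice of `L_M` containing `v` and `D`, there are generators `v, r_D` of
`T_D` with either `r_D² = -2 ∧ 0 ≤ (v,r_D) ≤ v²/2`, or
`0 ≤ r_D²·v² ≤ (v,r_D)² < (v²/2)²`. -/
def IsWallDivisor (v D : LM) : Prop :=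
  bLM v D = 0 ∧ D ≠ 0 ∧
  (∀ (k : ℤ) (w : LM), bLM v w = 0 → D = k • w → IsUnit k) ∧
  ∃ (T : Submodule ℤ LM) (r : LM),
    v ∈ T ∧ D ∈ T ∧ Module.finrank ℤ T = 2 ∧
    (∀ (x : LM) (k : ℤ), k ≠ 0 → k • x ∈ T → x ∈ T) ∧
    T = Submodule.span ℤ {v, r} ∧
    ((bLM r r = -2 ∧ 0 ≤ bLM v r ∧ 2 * bLM v r ≤ bLM v v) ∨
     (0 ≤ bLM r r * bLM v v ∧ bLM r r * bLM v v ≤ (bLM v r) ^ 2 ∧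
       4 * (bLM v r) ^ 2 < (bLM v v) ^ 2))


open Module
namespace WL
open Finset
abbrev Frm (X : Type) [AddCommGroup X] [Module ℚ X] := X →ₗ[ℚ] X →ₗ[ℚ] ℚ
section basic
variable {X Y Z W : Type} [AddCommGroup X] [Module ℚ X] [AddCommGroup Y] [Module ℚ Y]
  [AddCommGroup Z] [Module ℚ Z] [AddCommGroup W] [Module ℚ W]
def Isom (B : Frm X) (B' : Frm Y) : Prop :=
  ∃ e : X ≃ₗ[ℚ] Y, ∀ x y, B' (e x) (e y) = B x y
theorem Isom.refl (B : Frm X) : Isom B B := ⟨LinearEquiv.refl _ _, fun _ _ => rfl⟩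
theorem Isom.symm {B : Frm X} {B' : Frm Y} (h : Isom B B') : Isom B' B := by
  obtain ⟨e, he⟩ := h
  exact ⟨e.symm, fun x y => by rw [← he]; simp⟩
theorem Isom.trans {B : Frm X} {B' : Frm Y} {C : Frm Z} (h : Isom B B') (h' : Isom B' C) :
    Isom B C := by
  obtain ⟨e, he⟩ := h
  obtain ⟨f, hf⟩ := h'
  exact ⟨e.trans f, fun x y => by simp [hf, he]⟩
def diagF {ι : Type} [Fintype ι] (w : ι → ℚ) : Frm (ι → ℚ) :=
  LinearMap.mk₂ ℚ (fun x y => ∑ i, w i * x i * y i)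
    (fun x x' y => by simp only [Pi.add_apply, ← sum_add_distrib]; congr 1; ext; ring)
    (fun c x y => by simp only [Pi.smul_apply, smul_eq_mul, mul_sum]; congr 1; ext; ring)
    (fun x y y' => by simp only [Pi.add_apply, ← sum_add_distrib]; congr 1; ext; ring)
    (fun c x y => by simp only [Pi.smul_apply, smul_eq_mul, mul_sum]; congr 1; ext; ring)
@[simp] theorem diagF_apply {ι : Type} [Fintype ι] (w : ι → ℚ) (x y : ι → ℚ) :
    diagF w x y = ∑ i, w i * x i * y i := rfl
def prodF (B : Frm X) (B' : Frm Y) : Frm (X × Y) :=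
  LinearMap.mk₂ ℚ (fun x y => B x.1 y.1 + B' x.2 y.2)
    (fun x x' y => by simp; ring)
    (fun c x y => by simp; ring)
    (fun x x' y => by simp; ring)
    (fun c x y => by simp; ring)
@[simp] theorem prodF_apply (B : Frm X) (B' : Frm Y) (x y : X × Y) :
    prodF B B' x y = B x.1 y.1 + B' x.2 y.2 := rfl
theorem Isom.prod {B : Frm X} {B' : Frm Y} {C : Frm Z} {C' : Frm W}
    (h : Isom B B') (h' : Isom C C') : Isom (prodF B C) (prodF B' C') := by
  obtain ⟨e, he⟩ := h
  obtain ⟨f, hf⟩ := h'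
  exact ⟨e.prodCongr f, fun x y => by simp [hf, he]⟩
theorem Isom.smul (c : ℚ) {B : Frm X} {B' : Frm Y} (h : Isom B B') : Isom (c • B) (c • B') := by
  obtain ⟨e, he⟩ := h
  exact ⟨e, fun x y => by simp [he]⟩
theorem exists_equiv_of_map_eq {ι κ : Type} [Fintype ι] [Fintype κ] (v : ι → ℚ) (w : κ → ℚ)
    (h : (univ : Finset ι).val.map v = (univ : Finset κ).val.map w) :
    ∃ e : ι ≃ κ, ∀ i, w (e i) = v i := by
  classical
  have key : ∀ c : ℚ, Nonempty ({i // v i = c} ≃ {j // w j = c}) := by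
    intro c
    have := congrArg (Multiset.count c) h
    rw [Multiset.count_map, Multiset.count_map] at this
    refine ⟨Fintype.equivOfCardEq ?_⟩
    rw [Fintype.card_subtype, Fintype.card_subtype]
    simp only [Finset.card_def, Finset.filter_val]
    simpa only [eq_comm] using this
  refine ⟨Equiv.ofFiberEquiv (fun c => (key c).some), fun i => ?_⟩
  exact Equiv.ofFiberEquiv_map _ _
def IsDiag (B : Frm X) (s : Multiset ℚ) : Prop :=
  ∃ (ι : Type) (_ : Fintype ι) (w : ι → ℚ), (univ : Finset ι).val.map w = s ∧ Isom B (diagF w)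
theorem isDiag_diagF {ι : Type} [Fintype ι] (w : ι → ℚ) :
    IsDiag (diagF w) ((univ : Finset ι).val.map w) := ⟨ι, _, w, rfl, Isom.refl _⟩
theorem exists_diag (s : Multiset ℚ) : ∃ n, ∃ w : Fin n → ℚ, (univ : Finset (Fin n)).val.map w = s := by
  obtain ⟨l, rfl⟩ := Quot.exists_rep s
  refine ⟨l.length, l.get, ?_⟩
  simp
theorem IsDiag.iso {B : Frm X} {B' : Frm Y} {s} (h : Isom B B') (h' : IsDiag B' s) : IsDiag B s := by
  obtain ⟨ι, _, w, hw, h2⟩ := h'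
  exact ⟨ι, _, w, hw, h.trans h2⟩
theorem IsDiag.unique {B : Frm X} {B' : Frm Y} {s} (h : IsDiag B s) (h' : IsDiag B' s) : Isom B B' := by
  obtain ⟨ι, _, w, hw, h2⟩ := h
  obtain ⟨ι', _, w', hw', h2'⟩ := h'
  refine h2.trans (Isom.trans ?_ h2'.symm)
  obtain ⟨e, he⟩ := exists_equiv_of_map_eq w w' (hw.trans hw'.symm)
  refine ⟨LinearEquiv.funCongrLeft ℚ ℚ e.symm, fun x y => ?_⟩
  simp only [diagF_apply, LinearEquiv.funCongrLeft_apply, LinearMap.funLeft_apply]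
  rw [← Equiv.sum_comp e]
  simp [he]
theorem IsDiag.prod {B : Frm X} {B' : Frm Y} {s t} (h : IsDiag B s) (h' : IsDiag B' t) :
    IsDiag (prodF B B') (s + t) := by
  obtain ⟨ι, _, w, hw, h2⟩ := h
  obtain ⟨ι', _, w', hw', h2'⟩ := h'
  refine ⟨ι ⊕ ι', inferInstance, Sum.elim w w', ?_, ?_⟩
  · rw [← hw, ← hw', ← Finset.univ_disjSum_univ]
    simp [Finset.disjSum, Multiset.disjSum]
  · refine (h2.prod h2').trans ⟨(LinearEquiv.sumArrowLequivProdArrow ι ι' ℚ ℚ).symm, ?_⟩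
    rintro ⟨x, x'⟩ ⟨y, y'⟩
    simp [Fintype.sum_sum_type]
theorem IsDiag.smul (c : ℚ) {B : Frm X} {s} (h : IsDiag B s) :
    IsDiag (c • B) (s.map (c * ·)) := by
  obtain ⟨ι, _, w, hw, h2⟩ := h
  refine ⟨ι, inferInstance, fun i => c * w i, by rw [← hw]; simp, (h2.smul c).trans ?_⟩
  refine ⟨LinearEquiv.refl _ _, fun x y => ?_⟩
  simp only [diagF_apply, LinearEquiv.refl_apply, LinearMap.smul_apply, smul_eq_mul, mul_sum]
  congr 1; ext; ring
theorem IsDiag.symm {B : Frm X} {s} (h : IsDiag B s) (x y : X) : B x y = B y x := by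
  obtain ⟨ι, _, w, hw, e, he⟩ := h
  rw [← he, ← he]; simp only [diagF_apply]; congr 1; ext; ring
def lineF (a : ℚ) : Frm ℚ := LinearMap.mk₂ ℚ (fun x y => a * x * y)
    (fun x x' y => by ring) (fun c x y => by simp; ring) (fun x x' y => by ring)
    (fun c x y => by simp; ring)
@[simp] theorem lineF_apply (a x y : ℚ) : lineF a x y = a * x * y := rfl
theorem isDiag_line (a : ℚ) : IsDiag (lineF a) {a} := by
  refine ⟨Unit, inferInstance, fun _ => a, by simp, (LinearEquiv.funUnique Unit ℚ ℚ).symm, ?_⟩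
  intro x y; simp
theorem isDiag_subsingleton [Subsingleton X] (B : Frm X) : IsDiag B 0 := by
  refine ⟨Empty, inferInstance, fun _ => 0, by simp, LinearEquiv.ofSubsingleton _ _, ?_⟩
  intro x y
  rw [Subsingleton.elim x 0]; simp
theorem exists_isometry_map (Q : Frm Z) (hs : ∀ x y, Q x y = Q y x) (x y : Z)
    (hxy : Q x x = Q y y) (h0 : Q x x ≠ 0) :
    ∃ σ : Z ≃ₗ[ℚ] Z, (∀ a b, Q (σ a) (σ b) = Q a b) ∧ σ x = y := by
  have refl : ∀ v : Z, Q v v ≠ 0 → ∃ σ : Z ≃ₗ[ℚ] Z, (∀ a b, Q (σ a) (σ b) = Q a b) ∧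
      ∀ a, σ a = a - (2 / Q v v * Q v a) • v := by
    intro v hv
    have h2 : ((2 / Q v v) • Q v) v = 2 := by simp [hv]
    refine ⟨Module.reflection h2, ?_, ?_⟩
    · intro a b
      simp only [Module.reflection_apply, map_sub, LinearMap.sub_apply, map_smul, LinearMap.smul_apply,
        smul_eq_mul]
      rw [hs a v]
      field_simp
      ring
    · intro a; simp [Module.reflection_apply]
  by_cases h1 : Q (x - y) (x - y) = 0
  · have h2 : Q (x + y) (x + y) ≠ 0 := by
      intro h2
      simp only [map_sub, map_add, LinearMap.sub_apply, LinearMap.add_apply] at h1 h2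
      apply h0; linarith
    obtain ⟨σ, hσ, h⟩ := refl _ h2
    refine ⟨σ.trans (LinearEquiv.neg ℚ), fun a b => by simp [hσ], ?_⟩
    simp only [LinearEquiv.trans_apply, LinearEquiv.neg_apply, h]
    have : 2 / Q (x + y) (x + y) * Q (x + y) x = 1 := by
      rw [div_mul_eq_mul_div, div_eq_one_iff_eq h2]
      simp only [map_add, LinearMap.add_apply]
      rw [hs y x]; linarith
    rw [this]; simp
  · obtain ⟨σ, hσ, h⟩ := refl _ h1
    refine ⟨σ, hσ, ?_⟩
    rw [h]
    have : 2 / Q (x - y) (x - y) * Q (x - y) x = 1 := by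
      rw [div_mul_eq_mul_div, div_eq_one_iff_eq h1]
      simp only [map_sub, LinearMap.sub_apply]
      rw [hs y x]; linarith
    rw [this]; simp
theorem witt_cancel (B : Frm X) (B' : Frm Y) (hB : ∀ x y, B x y = B y x)
    (hB' : ∀ x y, B' x y = B' y x) (a : ℚ) (ha : a ≠ 0)
    (h : Isom (prodF (lineF a) B) (prodF (lineF a) B')) : Isom B B' := by
  obtain ⟨e, he⟩ := h
  obtain ⟨σ, hσ, h1⟩ := exists_isometry_map (prodF (lineF a) B')
    (fun x y => by simp [hB' x.2 y.2]; ring) (e (1, 0)) (1, 0) (by rw [he]; simp) (by rw [he]; simpa)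
  set f := e.trans σ with hf
  have hf1 : f (1, 0) = (1, 0) := by simp [hf, h1]
  have hfi : ∀ x y, prodF (lineF a) B' (f x) (f y) = prodF (lineF a) B x y := by
    intro x y; simp only [hf, LinearEquiv.trans_apply, hσ, he]
  have k1 : ∀ x, (f (0, x)).1 = 0 := by
    intro x
    have := hfi (1, 0) (0, x)
    rw [hf1] at this; simpa [ha] using this
  have hg1 : f.symm (1, 0) = (1, 0) := by rw [LinearEquiv.symm_apply_eq, hf1]
  have k2 : ∀ x, (f.symm (0, x)).1 = 0 := by
    intro x
    have := hfi (1, 0) (f.symm (0, x))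
    rw [hf1] at this; simpa [ha, eq_comm] using this
  have k1' : ∀ x, f (0, x) = (0, (f (0, x)).2) := fun x => Prod.ext (k1 x) rfl
  have k2' : ∀ x, f.symm (0, x) = (0, (f.symm (0, x)).2) := fun x => Prod.ext (k2 x) rfl
  refine ⟨LinearEquiv.ofLinearMap (LinearMap.snd ℚ ℚ Y ∘ₗ f.toLinearMap ∘ₗ LinearMap.inr ℚ ℚ X)
    (LinearMap.snd ℚ ℚ X ∘ₗ f.symm.toLinearMap ∘ₗ LinearMap.inr ℚ ℚ Y) ?_ ?_, ?_⟩
  · ext x; simp [← k2']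
  · ext x; simp [← k1']
  · intro x y
    have := hfi (0, x) (0, y)
    simpa [k1] using this
def rel (s t : Multiset ℚ) : Prop :=
  ∃ (n : ℕ) (B : Frm (Fin n → ℚ)), IsDiag B s ∧ IsDiag B t
theorem IsDiag.rel {B : Frm X} {s t} (h : IsDiag B s) (h' : IsDiag B t) : rel s t := by
  obtain ⟨n, w, hw⟩ := exists_diag s
  have := isDiag_diagF w
  rw [hw] at this
  exact ⟨n, diagF w, this, IsDiag.iso (this.unique h) h'⟩
theorem rel.refl (s) : rel s s := by
  obtain ⟨n, w, hw⟩ := exists_diag s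
  have := isDiag_diagF w
  rw [hw] at this
  exact this.rel this
theorem rel.symm {s t} (h : rel s t) : rel t s := by
  obtain ⟨n, B, h1, h2⟩ := h; exact ⟨n, B, h2, h1⟩
theorem rel.trans {s t u} (h : rel s t) (h' : rel t u) : rel s u := by
  obtain ⟨n, B, h1, h2⟩ := h
  obtain ⟨n', B', h1', h2'⟩ := h'
  exact h1.rel (IsDiag.iso (h2.unique h1') h2')
theorem rel.add {s t s' t'} (h : rel s t) (h' : rel s' t') : rel (s + s') (t + t') := by
  obtain ⟨n, B, h1, h2⟩ := h
  obtain ⟨n', B', h1', h2'⟩ := h'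
  exact (h1.prod h1').rel (h2.prod h2')
theorem rel.smul (c : ℚ) {s t} (h : rel s t) : rel (s.map (c * ·)) (t.map (c * ·)) := by
  obtain ⟨n, B, h1, h2⟩ := h
  exact (h1.smul c).rel (h2.smul c)
theorem rel.cancel1 {a : ℚ} (ha : a ≠ 0) {s t} (h : rel ({a} + s) ({a} + t)) : rel s t := by
  obtain ⟨n, w, hw⟩ := exists_diag s
  obtain ⟨m, v, hv⟩ := exists_diag t
  have h1 := isDiag_diagF w
  rw [hw] at h1
  have h2 := isDiag_diagF v
  rw [hv] at h2
  obtain ⟨_, B, h3, h4⟩ := h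
  have h5 := ((isDiag_line a).prod h1).unique h3
  have h6 := h4.unique ((isDiag_line a).prod h2)
  have := witt_cancel _ _ h1.symm h2.symm a ha (h5.trans h6)
  exact h1.rel (IsDiag.iso this h2)
theorem rel.cancel {u s t : Multiset ℚ} (hu : ∀ a ∈ u, a ≠ 0) (h : rel (u + s) (u + t)) : rel s t := by
  induction u using Multiset.induction_on with
  | empty => simpa using h
  | cons a u ih =>
    apply ih (fun b hb => hu b (Multiset.mem_cons_of_mem hb))
    apply rel.cancel1 (hu a (Multiset.mem_cons_self _ _))
    simpa [← Multiset.singleton_add, add_assoc] using h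
end basic
/-! ### The Witt–Grothendieck ring -/
abbrev A0 := MonoidAlgebra ℤ ℚˣ
noncomputable def br0 (s : Multiset ℚˣ) : A0 := (s.map (fun u => MonoidAlgebra.of ℤ ℚˣ u)).sum
theorem br0_add (s t) : br0 (s + t) = br0 s + br0 t := by simp [br0]
theorem br0_inj {s t} (h : br0 s = br0 t) : s = t := by
  classical
  ext u
  have key : ∀ s : Multiset ℚˣ, (br0 s).coeff u = (Multiset.count u s : ℤ) := by
    intro s
    induction s using Multiset.induction_on with
    | empty => simp [br0]
    | cons a s ih =>
      rw [← Multiset.singleton_add, br0_add]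
      rw [show (br0 {a} + br0 s).coeff u = (br0 {a}).coeff u + (br0 s).coeff u from rfl, ih]
      rw [Multiset.count_add, Multiset.count_singleton]
      simp [br0, Finsupp.single_apply, eq_comm]
  have := congrArg (fun z : A0 => z.coeff u) h
  simp only [key] at this
  exact_mod_cast this
def toQ (s : Multiset ℚˣ) : Multiset ℚ := s.map (fun u : ℚˣ => (u : ℚ))
theorem toQ_add (s t) : toQ (s + t) = toQ s + toQ t := by simp [toQ]
theorem toQ_ne (s) : ∀ a ∈ toQ s, a ≠ 0 := by
  intro a ha
  obtain ⟨u, _, rfl⟩ := Multiset.mem_map.1 ha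
  exact Units.ne_zero u
noncomputable def K0 : Ideal A0 where
  carrier := {x | ∃ s t, x = br0 s - br0 t ∧ rel (toQ s) (toQ t)}
  zero_mem' := ⟨0, 0, by simp, rel.refl _⟩
  add_mem' := by
    rintro _ _ ⟨s, t, rfl, h⟩ ⟨s', t', rfl, h'⟩
    refine ⟨s + s', t + t', ?_, ?_⟩
    · rw [br0_add, br0_add]; ring
    · rw [toQ_add, toQ_add]; exact h.add h'
  smul_mem' := by
    intro c x hx
    induction c using MonoidAlgebra.induction_on with
    | of u =>
      obtain ⟨s, t, rfl, h⟩ := hx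
      have : ∀ s, MonoidAlgebra.of ℤ ℚˣ u * br0 s = br0 (s.map (u * ·)) := by
        intro s
        simp only [br0, Multiset.map_map, ← Multiset.sum_map_mul_left, Function.comp_def, map_mul]
      refine ⟨s.map (u * ·), t.map (u * ·), ?_, ?_⟩
      · rw [smul_eq_mul, mul_sub, this, this]
      · simpa [toQ, Multiset.map_map, Function.comp_def] using h.smul u
    | add f g hf hg =>
      obtain ⟨s, t, h1, h⟩ := hf
      obtain ⟨s', t', h1', h'⟩ := hg
      refine ⟨s + s', t + t', ?_, ?_⟩
      · rw [add_smul, h1, h1', br0_add, br0_add]; ring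
      · rw [toQ_add, toQ_add]; exact h.add h'
    | smul r f hf =>
      rw [smul_assoc]
      have hn : ∀ n : ℕ, ∀ y : A0, (∃ s t, y = br0 s - br0 t ∧ rel (toQ s) (toQ t)) →
        (∃ s t, n • y = br0 s - br0 t ∧ rel (toQ s) (toQ t)) := by
        intro n y ⟨s, t, hy, h⟩
        induction n with
        | zero => exact ⟨0, 0, by simp, rel.refl _⟩
        | succ n ih =>
          obtain ⟨s', t', h1', h'⟩ := ih
          refine ⟨s' + s, t' + t, ?_, ?_⟩
          · rw [succ_nsmul, hy, ← hy, h1', hy, br0_add, br0_add]; ring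
          · rw [toQ_add, toQ_add]; exact h'.add h
      obtain ⟨n, rfl | rfl⟩ := r.eq_nat_or_neg
      · rw [natCast_zsmul]; exact hn n _ hf
      · rw [neg_smul, natCast_zsmul]
        obtain ⟨s, t, h1, h⟩ := hn n _ hf
        exact ⟨t, s, by rw [h1]; ring, h.symm⟩
abbrev R := A0 ⧸ K0
noncomputable def brU (u : ℚˣ) : R := Ideal.Quotient.mk K0 (MonoidAlgebra.of ℤ ℚˣ u)
noncomputable def br (a : ℚ) : R := if h : a = 0 then 0 else brU (Units.mk0 a h)
theorem br_unit (u : ℚˣ) : br u = brU u := by simp [br]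
noncomputable def cl (s : Multiset ℚ) : R := (s.map br).sum
theorem cl_add (s t) : cl (s + t) = cl s + cl t := by simp [cl]
theorem cl_single (a) : cl {a} = br a := by simp [cl]
theorem cl_toQ (s) : cl (toQ s) = Ideal.Quotient.mk K0 (br0 s) := by
  simp only [cl, toQ, br0, Multiset.map_map, Function.comp_def, br_unit, map_multiset_sum]; rfl
theorem exists_toQ (s : Multiset ℚ) (h : ∀ a ∈ s, a ≠ 0) : ∃ t, toQ t = s := by
  induction s using Multiset.induction_on with
  | empty => exact ⟨0, rfl⟩
  | cons a s ih =>
    obtain ⟨t, ht⟩ := ih (fun b hb => h b (Multiset.mem_cons_of_mem hb))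
    exact ⟨Units.mk0 a (h a (Multiset.mem_cons_self _ _)) ::ₘ t, by simpa [toQ] using ht⟩
theorem cl_eq_of_rel {s t : Multiset ℚ} (hs : ∀ a ∈ s, a ≠ 0) (ht : ∀ a ∈ t, a ≠ 0)
    (h : rel s t) : cl s = cl t := by
  obtain ⟨s, rfl⟩ := exists_toQ s hs
  obtain ⟨t, rfl⟩ := exists_toQ t ht
  rw [cl_toQ, cl_toQ, Ideal.Quotient.eq]
  exact ⟨s, t, rfl, h⟩
theorem rel_of_cl_eq {s t : Multiset ℚ} (hs : ∀ a ∈ s, a ≠ 0) (ht : ∀ a ∈ t, a ≠ 0)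
    (h : cl s = cl t) : rel s t := by
  obtain ⟨s, rfl⟩ := exists_toQ s hs
  obtain ⟨t, rfl⟩ := exists_toQ t ht
  rw [cl_toQ, cl_toQ, Ideal.Quotient.eq] at h
  obtain ⟨s', t', h1, h2⟩ := h
  have h3 : s + t' = s' + t := by
    apply br0_inj
    rw [br0_add, br0_add]
    linear_combination h1
  have h4 : rel (toQ t' + toQ s) (toQ t' + toQ t) := by
    rw [← toQ_add, ← toQ_add, add_comm, h3, toQ_add, toQ_add]
    exact h2.add (rel.refl _)
  exact h4.cancel (toQ_ne _)
theorem br_zero : br 0 = 0 := by simp [br]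
theorem br_mul (a b : ℚ) : br (a * b) = br a * br b := by
  by_cases ha : a = 0
  · simp [ha, br_zero]
  by_cases hb : b = 0
  · simp [hb, br_zero]
  have : Units.mk0 (a * b) (mul_ne_zero ha hb) = Units.mk0 a ha * Units.mk0 b hb := by ext; simp
  simp only [br, ha, hb, mul_eq_zero, or_self, dite_false, this, brU, map_mul]
theorem br_one : br 1 = 1 := by
  have := br_unit 1
  simp only [Units.val_one] at this
  rw [this, brU, map_one, map_one]
theorem br_sq {a : ℚ} (ha : a ≠ 0) : br (a * a) = 1 := by
  rw [← br_one, ← cl_single, ← cl_single]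
  apply cl_eq_of_rel (by simpa) (by simp)
  apply (isDiag_line (a * a)).rel
  refine IsDiag.iso ⟨LinearEquiv.smulOfNeZero ℚ ℚ a ha, fun x y => ?_⟩ (isDiag_line 1)
  simp; ring
theorem br_mul_self {a : ℚ} (ha : a ≠ 0) : br a * br a = 1 := by rw [← br_mul, br_sq ha]
theorem br_add {a b : ℚ} (ha : a ≠ 0) (hb : b ≠ 0) (hab : a + b ≠ 0) :
    br a + br b = br (a + b) * (1 + br (a * b)) := by
  rw [mul_add, mul_one, ← br_mul]
  simp only [← cl_single, ← cl_add]
  have hne : (a + b) * (a * b) ≠ 0 := mul_ne_zero hab (mul_ne_zero ha hb)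
  apply cl_eq_of_rel
  · simp [ha, hb]
  · simp [ha, hb, hab]
  apply ((isDiag_line a).prod (isDiag_line b)).rel
  refine IsDiag.iso ?_ ((isDiag_line (a+b)).prod (isDiag_line ((a+b)*(a*b))))
  apply Isom.symm
  refine ⟨LinearEquiv.ofLinearMap
    ((LinearMap.fst ℚ ℚ ℚ - b • LinearMap.snd ℚ ℚ ℚ).prod (LinearMap.fst ℚ ℚ ℚ + a • LinearMap.snd ℚ ℚ ℚ))
    (((a / (a+b)) • LinearMap.fst ℚ ℚ ℚ + (b / (a+b)) • LinearMap.snd ℚ ℚ ℚ).prod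
      ((-1/(a+b)) • LinearMap.fst ℚ ℚ ℚ + (1/(a+b)) • LinearMap.snd ℚ ℚ ℚ)) ?_ ?_, ?_⟩
  · apply LinearMap.ext; rintro ⟨x, y⟩
    simp only [LinearMap.comp_apply, LinearMap.prod_apply, Function.prod_apply, LinearMap.sub_apply, LinearMap.add_apply,
      LinearMap.smul_apply, LinearMap.fst_apply, LinearMap.snd_apply, smul_eq_mul, LinearMap.id_apply, Prod.mk.injEq]
    constructor <;> field_simp <;> ring
  · apply LinearMap.ext; rintro ⟨x, y⟩
    simp only [LinearMap.comp_apply, LinearMap.prod_apply, Function.prod_apply, LinearMap.sub_apply, LinearMap.add_apply,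
      LinearMap.smul_apply, LinearMap.fst_apply, LinearMap.snd_apply, smul_eq_mul, LinearMap.id_apply, Prod.mk.injEq]
    constructor <;> field_simp <;> ring
  · rintro ⟨x, y⟩ ⟨x', y'⟩
    simp
    ring
noncomputable def eta : R := br (-1)
theorem br_neg (a : ℚ) : br (-a) = eta * br a := by rw [eta, ← br_mul]; simp
theorem hyp {a : ℚ} (ha : a ≠ 0) : br a + br (-a) = 1 + eta := by
  rw [eta, ← br_one]
  simp only [← cl_single, ← cl_add]
  apply cl_eq_of_rel
  · simp [ha]
  · simp
  apply ((isDiag_line a).prod (isDiag_line (-a))).rel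
  refine IsDiag.iso ?_ ((isDiag_line 1).prod (isDiag_line (-1)))
  refine ⟨LinearEquiv.ofLinearMap
    ((((1+a)/2) • LinearMap.fst ℚ ℚ ℚ + ((1-a)/2) • LinearMap.snd ℚ ℚ ℚ).prod
     (((1-a)/2) • LinearMap.fst ℚ ℚ ℚ + ((1+a)/2) • LinearMap.snd ℚ ℚ ℚ))
    ((((1+1/a)/2) • LinearMap.fst ℚ ℚ ℚ + ((1-1/a)/2) • LinearMap.snd ℚ ℚ ℚ).prod
     (((1-1/a)/2) • LinearMap.fst ℚ ℚ ℚ + ((1+1/a)/2) • LinearMap.snd ℚ ℚ ℚ)) ?_ ?_, ?_⟩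
  · apply LinearMap.ext; rintro ⟨x, y⟩
    simp only [LinearMap.comp_apply, LinearMap.prod_apply, Function.prod_apply, LinearMap.sub_apply, LinearMap.add_apply,
      LinearMap.smul_apply, LinearMap.fst_apply, LinearMap.snd_apply, smul_eq_mul, LinearMap.id_apply, Prod.mk.injEq]
    constructor <;> field_simp <;> ring
  · apply LinearMap.ext; rintro ⟨x, y⟩
    simp only [LinearMap.comp_apply, LinearMap.prod_apply, Function.prod_apply, LinearMap.sub_apply, LinearMap.add_apply,
      LinearMap.smul_apply, LinearMap.fst_apply, LinearMap.snd_apply, smul_eq_mul, LinearMap.id_apply, Prod.mk.injEq]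
    constructor <;> field_simp <;> ring
  · rintro ⟨x, y⟩ ⟨x', y'⟩
    simp
    ring
section HasCl
variable {X Y : Type} [AddCommGroup X] [Module ℚ X] [AddCommGroup Y] [Module ℚ Y]
def HasCl (B : Frm X) (r : R) : Prop := ∃ s, (∀ a ∈ s, a ≠ 0) ∧ IsDiag B s ∧ cl s = r
theorem HasCl.iso {B : Frm X} {B' : Frm Y} {r} (h : Isom B B') (h' : HasCl B' r) : HasCl B r := by
  obtain ⟨s, h1, h2, h3⟩ := h'
  exact ⟨s, h1, h2.iso h, h3⟩
theorem HasCl.isom {B : Frm X} {B' : Frm Y} {r} (h : HasCl B r) (h' : HasCl B' r) : Isom B B' := by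
  obtain ⟨s, h1, h2, h3⟩ := h
  obtain ⟨s', h1', h2', h3'⟩ := h'
  obtain ⟨n, C, h4, h5⟩ := rel_of_cl_eq h1 h1' (h3.trans h3'.symm)
  exact (h2.unique h4).trans (h5.unique h2')
theorem HasCl.unique {B : Frm X} {r r'} (h : HasCl B r) (h' : HasCl B r') : r = r' := by
  obtain ⟨s, h1, h2, h3⟩ := h
  obtain ⟨s', h1', h2', h3'⟩ := h'
  rw [← h3, ← h3']
  exact cl_eq_of_rel h1 h1' (h2.rel h2')
theorem HasCl.prod {B : Frm X} {B' : Frm Y} {r r'} (h : HasCl B r) (h' : HasCl B' r') :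
    HasCl (prodF B B') (r + r') := by
  obtain ⟨s, h1, h2, h3⟩ := h
  obtain ⟨s', h1', h2', h3'⟩ := h'
  refine ⟨s + s', ?_, h2.prod h2', by rw [cl_add, h3, h3']⟩
  intro a ha
  rcases Multiset.mem_add.1 ha with h | h
  exacts [h1 a h, h1' a h]
theorem HasCl.smul {c : ℚ} (hc : c ≠ 0) {B : Frm X} {r} (h : HasCl B r) :
    HasCl (c • B) (br c * r) := by
  obtain ⟨s, h1, h2, h3⟩ := h
  refine ⟨s.map (c * ·), ?_, h2.smul c, ?_⟩
  · intro a ha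
    obtain ⟨b, hb, rfl⟩ := Multiset.mem_map.1 ha
    exact mul_ne_zero hc (h1 b hb)
  · rw [← h3]
    simp only [cl, Multiset.map_map, Function.comp_def, br_mul, Multiset.sum_map_mul_left]
theorem HasCl.diag {ι : Type} [Fintype ι] (w : ι → ℚ) (hw : ∀ i, w i ≠ 0) :
    HasCl (diagF w) (∑ i, br (w i)) := by
  refine ⟨_, ?_, isDiag_diagF w, ?_⟩
  · intro a ha
    obtain ⟨b, hb, rfl⟩ := Multiset.mem_map.1 ha
    exact hw b
  · simp only [cl, Multiset.map_map]; rfl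
theorem HasCl.line {a : ℚ} (ha : a ≠ 0) : HasCl (lineF a) (br a) :=
  ⟨{a}, by simpa, isDiag_line a, cl_single a⟩
theorem exists_orth_basis [FiniteDimensional ℚ X] (B : Frm X) (hs : ∀ x y, B x y = B y x)
    (hn : ∀ x, (∀ y, B x y = 0) → x = 0) :
    ∃ (b : Basis (Fin (finrank ℚ X)) ℚ X), (∀ i j, i ≠ j → B (b i) (b j) = 0) ∧
      (∀ i, B (b i) (b i) ≠ 0) := by
  obtain ⟨b, hb⟩ := LinearMap.BilinForm.exists_orthogonal_basis (B := B) ⟨fun x y => hs x y⟩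
  have h1 : ∀ i j, i ≠ j → B (b i) (b j) = 0 := fun i j hij => hb hij
  refine ⟨b, h1, fun i h0 => b.ne_zero i (hn _ fun y => ?_)⟩
  rw [← b.sum_repr y, map_sum]
  apply Finset.sum_eq_zero
  intro j _
  rw [map_smul]
  by_cases hij : i = j
  · subst hij; simp [h0]
  · simp [h1 i j hij]
theorem isom_diag_of_basis {ι : Type} [Fintype ι] (B : Frm X) (b : Basis ι ℚ X)
    (h : ∀ i j, i ≠ j → B (b i) (b j) = 0) : Isom B (diagF fun i => B (b i) (b i)) := by
  refine ⟨b.equivFun, fun x y => ?_⟩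
  conv_rhs => rw [← b.sum_equivFun x, ← b.sum_equivFun y]
  simp only [map_sum, LinearMap.sum_apply, map_smul, LinearMap.smul_apply, smul_eq_mul, diagF_apply]
  apply Finset.sum_congr rfl
  intro i _
  rw [Finset.sum_eq_single i]
  · ring
  · intro j _ hj; rw [h j i hj]; simp
  · simp
theorem exists_hasCl [FiniteDimensional ℚ X] (B : Frm X) (hs : ∀ x y, B x y = B y x)
    (hn : ∀ x, (∀ y, B x y = 0) → x = 0) : ∃ r, HasCl B r := by
  obtain ⟨b, h1, h2⟩ := exists_orth_basis B hs hn
  exact ⟨_, HasCl.iso (isom_diag_of_basis B b h1) (HasCl.diag _ h2)⟩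
end HasCl
noncomputable def ep (a : ℚ) : R := 1 - br a
theorem ep_mul (a b : ℚ) : ep (a * b) = ep a + ep b - ep a * ep b := by
  simp only [ep, br_mul]; ring
theorem ep_sq {a : ℚ} (ha : a ≠ 0) : ep a * ep a = 2 * ep a := by
  have := br_mul_self ha
  simp only [ep]; linear_combination this
theorem ep_one : ep 1 = 0 := by simp [ep, br_one]
theorem kill (c : R) (n : ℕ) (hn : n ≠ 0) (h : ∀ q : ℕ, q.Prime → q ∣ n → c * ep (q : ℚ) = 0) :
    c * ep (n : ℚ) = 0 := by
  induction n using Nat.recOnMul with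
  | zero => exact absurd rfl hn
  | one => simp [ep_one]
  | prime p hp => exact h p hp dvd_rfl
  | mul a b iha ihb =>
    have ha : a ≠ 0 := by rintro rfl; simp at hn
    have hb : b ≠ 0 := by rintro rfl; simp at hn
    have h1 := iha ha (fun q hq hd => h q hq (hd.mul_right _))
    have h2 := ihb hb (fun q hq hd => h q hq (hd.mul_left _))
    push_cast
    rw [ep_mul]
    linear_combination h1 + h2 - ep b * h1
def Sm (N n : ℕ) : Prop := n ≠ 0 ∧ ∀ q : ℕ, q.Prime → q ∣ n → q < N
theorem Sm.of_lt {N n : ℕ} (h0 : 0 < n) (h : n < N) : Sm N n :=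
  ⟨h0.ne', fun q _ hd => lt_of_le_of_lt (Nat.le_of_dvd h0 hd) h⟩
theorem Sm.mul {N a b : ℕ} (ha : Sm N a) (hb : Sm N b) : Sm N (a * b) :=
  ⟨mul_ne_zero ha.1 hb.1, fun q hq hd => by
    rcases hq.dvd_mul.1 hd with h | h
    exacts [ha.2 q hq h, hb.2 q hq h]⟩
theorem kill3 {N : ℕ} (h : ∀ p q r : ℕ, p.Prime → q.Prime → r.Prime → p < N → q < N → r < N →
    ep p * ep q * ep r = 0) {a b c : ℕ} (ha : Sm N a) (hb : Sm N b) (hc : Sm N c) :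
    ep a * ep b * ep c = 0 := by
  refine kill _ c hc.1 fun r hr hrc => ?_
  rw [show ep a * ep b * ep (r:ℚ) = ep a * ep r * ep b by ring]
  refine kill _ b hb.1 fun q hq hqb => ?_
  rw [show ep a * ep r * ep (q:ℚ) = ep r * ep q * ep a by ring]
  refine kill _ a ha.1 fun p hp hpa => ?_
  exact h r q p hr hq hp (hc.2 r hr hrc) (hb.2 q hq hqb) (ha.2 p hp hpa)
theorem stepZ (p : ℕ) (hp : p.Prime) (ih : ∀ p' q r : ℕ, p'.Prime → q.Prime → r.Prime → p' < p → q < p → r < p →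
    ep p' * ep q * ep r = 0) :
    (∀ v w : ℕ, 0 < v → v < p → 0 < w → w < p → ep v * ep p * ep w = 0) := by
  haveI : Fact p.Prime := ⟨hp⟩
  have hp0 : (p : ℚ) ≠ 0 := by exact_mod_cast hp.ne_zero
  have two : ∀ {a b : ℕ}, Sm p a → Sm p b → 2 * (ep a * ep b) = 0 := by
    intro a b ha hb
    have := kill3 ih ha ha hb
    rw [ep_sq (by exact_mod_cast ha.1)] at this
    linear_combination this
  have hom : ∀ w v v' v'' : ℕ, 0 < w → w < p → 0 < v → v < p → 0 < v' → v' < p → 0 < v'' → v'' < p →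
      (v : ZMod p) = v' * v'' → ep v * ep p * ep w = ep v' * ep p * ep w + ep v'' * ep p * ep w := by
    intro w v v' v'' hw0 hw hv0 hv h0' h' h0'' h'' hz
    have sw := Sm.of_lt hw0 hw
    have sv := Sm.of_lt hv0 hv
    have sv' := Sm.of_lt h0' h'
    have sv'' := Sm.of_lt h0'' h''
    have hmod : v = (v' * v'') % p := by
      have : ((v : ℕ) : ZMod p) = ((v' * v'' : ℕ) : ZMod p) := by push_cast; exact hz
      rw [ZMod.natCast_eq_natCast_iff] at this
      rw [← Nat.mod_eq_of_lt hv]; exact this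
    obtain ⟨t, ht⟩ : ∃ t, v' * v'' = v + p * t := ⟨v' * v'' / p, by rw [hmod]; exact (Nat.mod_add_div _ _).symm⟩
    have htp : t < p := by
      have : p * t < p * p := by
        calc p * t ≤ v' * v'' := by omega
          _ < p * p := Nat.mul_lt_mul'' h' h''
      exact lt_of_mul_lt_mul_left this (Nat.zero_le _)
    have e1 : ep ((v' * v'' : ℕ) : ℚ) = ep v' + ep v'' - ep v' * ep v'' := by push_cast; rw [ep_mul]
    have z1 := kill3 ih sv' sv'' sw
    suffices hu : ep ((v' * v'' : ℕ) : ℚ) * ep p * ep w = ep v * ep p * ep w by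
      rw [← hu, e1]
      linear_combination - ep p * z1
    rcases Nat.eq_zero_or_pos t with rfl | ht0
    · rw [ht]; simp
    have st := Sm.of_lt ht0 htp
    set u := v' * v'' with hu
    have su : Sm p u := sv'.mul sv''
    have hv0' : (v : ℚ) ≠ 0 := by exact_mod_cast sv.1
    have ht0' : (t : ℚ) ≠ 0 := by exact_mod_cast st.1
    have hu0' : (u : ℚ) ≠ 0 := by exact_mod_cast su.1
    have huq : (u : ℚ) = v + p * t := by exact_mod_cast ht
    have key := br_add hv0' (mul_ne_zero hp0 ht0') (by rw [← huq]; exact hu0')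
    rw [← huq, br_mul v, br_mul p] at key
    have f1 : br v = 1 - ep v := by simp [ep]
    have f2 : br u = 1 - ep u := by simp [ep]
    have f3 : br p = 1 - ep p := by simp [ep]
    have f4 : br t = 1 - ep t := by simp [ep]
    rw [f1, f2, f3, f4] at key
    have z2 := kill3 ih sv st sw
    have z3 := kill3 ih su sv sw
    have z4 := kill3 ih su st sw
    have z5 := two su sw
    have z6 := two sv sw
    linear_combination (-ep w) * key - z2 + ep p * z2 + z5 - (1 - ep p - ep t + ep p * ep t) * z3 - z4
      + ep p * z4 - ep p * z6
  have tw : ∀ v w : ℕ, 0 < v → v < p → 0 < w → w < p → 2 * (ep v * ep p * ep w) = 0 := by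
    intro v w h1 h2 h3 h4
    linear_combination ep p * two (Sm.of_lt h1 h2) (Sm.of_lt h3 h4)
  have rep : ∀ x : ZMod p, x ≠ 0 → ∃ n : ℕ, 0 < n ∧ n < p ∧ (n : ZMod p) = x := by
    intro x hx
    refine ⟨x.val, ?_, x.val_lt, by simp⟩
    rw [Nat.pos_iff_ne_zero, Ne, ZMod.val_eq_zero]; exact hx
  have cne : ∀ n : ℕ, 0 < n → n < p → (n : ZMod p) ≠ 0 := by
    intro n h1 h2 h
    rw [ZMod.natCast_eq_zero_iff] at h
    exact absurd (Nat.le_of_dvd h1 h) (by omega)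
  have sq : ∀ v w : ℕ, 0 < v → v < p → 0 < w → w < p → IsSquare (v : ZMod p) →
      ep v * ep p * ep w = 0 := by
    intro v w h1 h2 h3 h4 ⟨x, hx⟩
    have hx0 : x ≠ 0 := by rintro rfl; exact cne v h1 h2 (by simpa using hx)
    obtain ⟨n, hn0, hn, rfl⟩ := rep x hx0
    rw [hom w v n n h3 h4 h1 h2 hn0 hn hn0 hn hx, ← two_mul, tw n w hn0 hn h3 h4]
  have nsq : ∀ v v' w : ℕ, 0 < v → v < p → 0 < v' → v' < p → 0 < w → w < p → ¬ IsSquare (v : ZMod p) →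
      ¬ IsSquare (v' : ZMod p) → ep v * ep p * ep w = - (ep v' * ep p * ep w) := by
    intro v v' w h1 h2 h1' h2' h3 h4 hs hs'
    have hss : IsSquare ((v : ZMod p) * v') := by
      have hp2 : ringChar (ZMod p) ≠ 2 := by
        intro h
        rw [ZMod.ringChar_zmod_n] at h
        subst h
        interval_cases v
        exact hs ⟨1, by simp⟩
      have a1 := quadraticChar_neg_one_iff_not_isSquare.2 hs
      have a2 := quadraticChar_neg_one_iff_not_isSquare.2 hs'
      rw [← quadraticChar_one_iff_isSquare (mul_ne_zero (cne v h1 h2) (cne v' h1' h2')), map_mul, a1, a2]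
      norm_num
    obtain ⟨n, hn0, hn, hne⟩ := rep _ (mul_ne_zero (cne v h1 h2) (cne v' h1' h2'))
    have := hom w n v v' h3 h4 hn0 hn h1 h2 h1' h2' hne
    rw [sq n w hn0 hn h3 h4 (by rw [hne]; exact hss)] at this
    linear_combination -this
  intro v w h1 h2 h3 h4
  by_cases hs : IsSquare (v : ZMod p)
  · exact sq v w h1 h2 h3 h4 hs
  by_cases hs' : IsSquare (w : ZMod p)
  · rw [show ep v * ep p * ep (w:ℚ) = ep w * ep p * ep v by ring]
    exact sq w v h3 h4 h1 h2 hs'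
  classical
  have hex : ∃ n : ℕ, ¬ IsSquare (n : ZMod p) := ⟨v, hs⟩
  set w0 := Nat.find hex with hw0
  have hw0s : ¬ IsSquare (w0 : ZMod p) := Nat.find_spec hex
  have hw0v : w0 ≤ v := Nat.find_min' hex hs
  have hw02 : 2 ≤ w0 := by
    by_contra h
    push Not at h
    apply hw0s
    interval_cases w0 <;> simp
  have hsq : IsSquare ((w0 - 1 : ℕ) : ZMod p) := by
    by_contra h
    exact Nat.find_min hex (m := w0 - 1) (by omega) h
  obtain ⟨s, hs1⟩ : ∃ s, w0 = s + 1 := ⟨w0 - 1, by omega⟩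
  have hss : IsSquare (s : ZMod p) := by rw [hs1] at hsq; simpa using hsq
  have hsp : 0 < s := by omega
  have key := br_add (a := 1) (b := (s : ℚ)) one_ne_zero (by exact_mod_cast hsp.ne') (by positivity)
  rw [show (1 : ℚ) + s = w0 by rw [hs1]; push_cast; ring, one_mul, br_one] at key
  have f1 : br s = 1 - ep s := by simp [ep]
  have f2 : br w0 = 1 - ep w0 := by simp [ep]
  rw [f1, f2] at key
  have z := sq s w0 hsp (by omega) (by omega) (by omega) hss
  have z0 : ep w0 * ep p * ep w0 = 0 := by
    have := ep_sq (a := w0) (by exact_mod_cast (by omega : w0 ≠ 0))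
    linear_combination ep p * this + ep p * key + z
  have q1 := nsq v w0 w h1 h2 (by omega) (by omega) h3 h4 hs hw0s
  have q2 := nsq w w0 w0 h3 h4 (by omega) (by omega) (by omega) (by omega) hs' hw0s
  linear_combination q1 - q2 + z0
theorem primesZ (N : ℕ) : ∀ p q r : ℕ, p.Prime → q.Prime → r.Prime → p < N → q < N → r < N →
    ep p * ep q * ep r = 0 := by
  induction N with
  | zero => intro p q r _ _ _ h; omega
  | succ P ih =>
    by_cases hP : P.Prime
    swap
    · intro p q r hp hq hr h1 h2 h3
      apply ih p q r hp hq hr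
      · rcases Nat.lt_succ_iff_lt_or_eq.1 h1 with h | rfl; exacts [h, absurd hp hP]
      · rcases Nat.lt_succ_iff_lt_or_eq.1 h2 with h | rfl; exacts [h, absurd hq hP]
      · rcases Nat.lt_succ_iff_lt_or_eq.1 h3 with h | rfl; exacts [h, absurd hr hP]
    have st := stepZ P hP ih
    have hP0 : (P : ℚ) ≠ 0 := by exact_mod_cast hP.ne_zero
    have s2 : ∀ w : ℕ, 0 < w → w < P → ep P * ep P * ep w = 0 := by
      intro w h1 h2
      have := st w w h1 h2 h1 h2
      have e1 := ep_sq (a := w) (by exact_mod_cast h1.ne')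
      have e2 := ep_sq hP0
      linear_combination ep w * e2 + this - ep P * e1
    have s3 : ep P * ep P * ep P = 0 := by
      obtain ⟨v, hv⟩ : ∃ v, P = v + 1 := ⟨P - 1, by have := hP.two_le; omega⟩
      have hv0 : 0 < v := by have := hP.two_le; omega
      have key := br_add (a := 1) (b := (v : ℚ)) one_ne_zero (by exact_mod_cast hv0.ne') (by positivity)
      rw [show (1 : ℚ) + v = P by rw [hv]; push_cast; ring, one_mul, br_one] at key
      have f1 : br v = 1 - ep v := by simp [ep]
      have f2 : br P = 1 - ep P := by simp [ep]
      rw [f1, f2] at key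
      have := s2 v hv0 (by omega)
      have e2 := ep_sq hP0
      linear_combination ep P * e2 + ep P * key + this
    intro p q r hp hq hr h1 h2 h3
    rcases Nat.lt_succ_iff_lt_or_eq.1 h1 with h1 | rfl <;>
    rcases Nat.lt_succ_iff_lt_or_eq.1 h2 with h2 | rfl <;>
    rcases Nat.lt_succ_iff_lt_or_eq.1 h3 with h3 | rfl
    · exact ih p q r hp hq hr h1 h2 h3
    · linear_combination st p q hp.pos h1 hq.pos h2
    · exact st p r hp.pos h1 hr.pos h3
    · linear_combination s2 p hp.pos h1
    · linear_combination st q r hq.pos h2 hr.pos h3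
    · linear_combination s2 q hq.pos h2
    · linear_combination s2 r hr.pos h3
    · exact s3
theorem ep_nat {x : ℚ} (hx : 0 < x) : ∃ n : ℕ, n ≠ 0 ∧ ep x = ep n := by
  refine ⟨x.num.toNat * x.den, ?_, ?_⟩
  · have := Rat.num_pos.2 hx
    have := x.den_nz
    simp; omega
  · have h0 : ((x.num.toNat : ℕ) : ℚ) = x.num := by
      have := Rat.num_pos.2 hx
      exact_mod_cast (Int.toNat_of_nonneg this.le)
    have hd : (x.den : ℚ) ≠ 0 := by exact_mod_cast x.den_nz
    have : ((x.num.toNat * x.den : ℕ) : ℚ) = x * (x.den * x.den) := by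
      push_cast
      rw [h0, ← mul_assoc, Rat.mul_den_eq_num]
    rw [this]
    simp only [ep]
    rw [br_mul x, br_sq hd, mul_one]
theorem thmZ {x y z : ℚ} (hx : 0 < x) (hy : 0 < y) (hz : 0 < z) : ep x * ep y * ep z = 0 := by
  obtain ⟨a, ha, h1⟩ := ep_nat hx
  obtain ⟨b, hb, h2⟩ := ep_nat hy
  obtain ⟨c, hc, h3⟩ := ep_nat hz
  rw [h1, h2, h3]
  have hN := primesZ (a + b + c + 1)
  exact kill3 hN (Sm.of_lt (by omega) (by omega)) (Sm.of_lt (by omega) (by omega))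
    (Sm.of_lt (by omega) (by omega))
theorem two_ep {x y : ℚ} (hx : 0 < x) (hy : 0 < y) : 2 * (ep x * ep y) = 0 := by
  linear_combination thmZ hx hx hy - ep y * ep_sq hx.ne'
theorem four_ep {x : ℚ} (hx : 0 < x) : 4 * ep x = 0 := by
  linear_combination two_ep hx hx - 2 * ep_sq hx.ne'
theorem four_br {x : ℚ} (hx : 0 < x) : 4 * br x = 4 := by
  have := four_ep hx
  rw [ep] at this; linear_combination -this
theorem eight {a b c d : ℚ} (ha : 0 < a) (hb : 0 < b) (hc : 0 < c) (hd : 0 < d) :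
    br a + br b + br c + br d + (br (b*c*d) + br (a*c*d) + br (a*b*d) + br (a*b*c)) = 8 := by
  simp only [br_mul]
  have f : ∀ x, br x = 1 - ep x := by intro x; simp [ep]
  rw [f a, f b, f c, f d]
  linear_combination -(four_ep ha + four_ep hb + four_ep hc + four_ep hd)
    + two_ep ha hb + two_ep ha hc + two_ep ha hd + two_ep hb hc + two_ep hb hd + two_ep hc hd
    - thmZ ha hb hc - thmZ ha hb hd - thmZ ha hc hd - thmZ hb hc hd
abbrev ZZ : Subring ℚ := (Int.castRingHom ℚ).range
theorem mem_ZZ {q : ℚ} : q ∈ ZZ ↔ ∃ n : ℤ, (n : ℚ) = q := by simp [ZZ, RingHom.mem_range]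
theorem int_mem_ZZ (n : ℤ) : (n : ℚ) ∈ ZZ := mem_ZZ.2 ⟨n, rfl⟩
theorem zsmul_ZZ {q : ℚ} (n : ℤ) (h : q ∈ ZZ) : n • q ∈ ZZ := ZZ.zsmul_mem h n
section lat
variable {X Y Z : Type} [AddCommGroup X] [Module ℚ X] [AddCommGroup Y] [Module ℚ Y]
  [AddCommGroup Z] [Module ℚ Z]
def dual (B : Frm X) (L : Submodule ℤ X) : Submodule ℤ X where
  carrier := {x | ∀ y ∈ L, B x y ∈ ZZ}
  add_mem' := by
    intro a b ha hb y hy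
    rw [map_add, LinearMap.add_apply]
    exact add_mem (ha y hy) (hb y hy)
  zero_mem' := by intro y _; simp
  smul_mem' := by
    intro c x hx y hy
    rw [map_zsmul, LinearMap.smul_apply]
    exact zsmul_ZZ c (hx y hy)
theorem mem_dual {B : Frm X} {L : Submodule ℤ X} {x} : x ∈ dual B L ↔ ∀ y ∈ L, B x y ∈ ZZ := Iff.rfl
structure SD (B : Frm X) (L : Submodule ℤ X) : Prop where
  symm : ∀ x y, B x y = B y x
  fg : L.FG
  mem_iff : ∀ x, x ∈ L ↔ ∀ y ∈ L, B x y ∈ ZZ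
structure EU (B : Frm X) (L : Submodule ℤ X) : Prop extends SD B L where
  even : ∀ x ∈ L, ∃ n : ℤ, B x x = 2 * n
theorem SD.int {B : Frm X} {L} (h : SD B L) {x y} (hx : x ∈ L) (hy : y ∈ L) : B x y ∈ ZZ :=
  (h.mem_iff x).1 hx y hy
theorem no_div {L : Submodule ℤ X} (hL : L.FG) {x : X} (h : ∀ n : ℕ, n ≠ 0 → (n : ℚ)⁻¹ • x ∈ L) :
    x = 0 := by
  haveI : Module.Finite ℤ L := Module.Finite.iff_fg.2 hL
  haveI : Module.IsTorsionFree ℤ X := .trans_faithfulSMul ℤ ℚ X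
  haveI : Module.Free ℤ L := inferInstance
  have hx : x ∈ L := by simpa using h 1 one_ne_zero
  let b := Module.Free.chooseBasis ℤ L
  by_contra hne
  have : b.repr ⟨x, hx⟩ ≠ 0 := by
    intro h0
    apply hne
    have := b.repr.map_eq_zero_iff.1 h0
    simpa using this
  obtain ⟨i, hi⟩ := Finsupp.ne_iff.1 this
  set c := b.repr ⟨x, hx⟩ i with hc
  simp only [Finsupp.coe_zero, Pi.zero_apply] at hi
  have hy := h (c.natAbs + 1) (by omega)
  have e : (⟨x, hx⟩ : L) = (c.natAbs + 1) • ⟨_, hy⟩ := by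
    apply Subtype.ext
    show x = (c.natAbs + 1) • (((c.natAbs + 1 : ℕ) : ℚ)⁻¹ • x)
    rw [← Nat.cast_smul_eq_nsmul ℚ, smul_smul, mul_inv_cancel₀ (by positivity), one_smul]
  have h2 : c = (c.natAbs + 1 : ℕ) * b.repr ⟨_, hy⟩ i := by
    conv_lhs => rw [hc, e]
    rw [map_nsmul]; simp
  have h3 : ((c.natAbs + 1 : ℕ) : ℤ) ∣ c := ⟨_, h2⟩
  have h4 := Int.natAbs_dvd_natAbs.2 h3
  rw [Int.natAbs_natCast] at h4
  exact absurd (Nat.le_of_dvd (Int.natAbs_pos.2 hi) h4) (by omega)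
theorem exists_repr [FiniteDimensional ℚ X] (B : Frm X) (hn : ∀ x, (∀ y, B x y = 0) → x = 0)
    (f : X →ₗ[ℚ] ℚ) : ∃ x, ∀ y, B x y = f y := by
  have inj : Function.Injective B := by
    rw [← LinearMap.ker_eq_bot, LinearMap.ker_eq_bot']
    intro x hx
    exact hn x (fun y => by rw [hx]; rfl)
  have sur : Function.Surjective B := by
    rw [← LinearMap.injective_iff_surjective_of_finrank_eq_finrank]
    · exact inj
    · exact (Subspace.dual_finrank_eq).symm
  obtain ⟨x, hx⟩ := sur f
  exact ⟨x, fun y => by rw [hx]⟩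
theorem SD.mem_of_zero {B : Frm X} {L} (h : SD B L) {x : X} (hx : ∀ y ∈ L, B x y = 0) : x = 0 := by
  apply no_div h.fg
  intro n _
  rw [h.mem_iff]
  intro y hy
  simp [hx y hy]
theorem SD.nondeg {B : Frm X} {L} (h : SD B L) (x : X) (hx : ∀ y, B x y = 0) : x = 0 :=
  h.mem_of_zero (fun y _ => hx y)
theorem SD.span {B : Frm X} {L} (h : SD B L) : Submodule.span ℚ (L : Set X) = ⊤ := by
  set V := Submodule.span ℚ (L : Set X) with hV
  haveI : FiniteDimensional ℚ V := by
    obtain ⟨s, hs⟩ := h.fg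
    have : V = Submodule.span ℚ (s : Set X) := by
      rw [hV, ← hs]
      exact Submodule.span_span_of_tower ℤ ℚ (s : Set X)
    rw [this]
    exact FiniteDimensional.span_finset ℚ s
  let BV : Frm V := B.compl₁₂ V.subtype V.subtype
  rw [eq_top_iff]
  intro x _
  obtain ⟨v, hv⟩ := exists_repr BV (fun x hx => by
    apply Subtype.ext
    apply h.mem_of_zero
    intro y hy
    exact hx ⟨y, Submodule.subset_span hy⟩) ((B x) ∘ₗ V.subtype)
  have : x - v = 0 := by
    apply h.mem_of_zero
    intro y hy
    have := hv ⟨y, Submodule.subset_span hy⟩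
    simp only [BV, LinearMap.compl₁₂_apply, Submodule.subtype_apply, LinearMap.comp_apply] at this
    rw [map_sub, LinearMap.sub_apply, this, sub_self]
  rw [sub_eq_zero] at this
  rw [this]; exact v.2
theorem exists_basis {E : Submodule ℤ X} (h1 : E.FG) (h2 : Submodule.span ℚ (E : Set X) = ⊤) :
    ∃ n, ∃ b : Basis (Fin n) ℚ X, ∀ x, x ∈ E ↔ ∀ i, b.repr x i ∈ ZZ := by
  haveI : Submodule.IsLattice ℚ E := ⟨h1, h2⟩
  haveI : Module.Finite ℤ E := Module.Finite.iff_fg.2 h1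
  haveI : Module.Free ℤ E := inferInstance
  let b0 := Module.finBasis ℤ E
  refine ⟨_, b0.extendOfIsLattice ℚ, fun x => ⟨fun hx i => ?_, fun hx => ?_⟩⟩
  · have : x = ∑ j, ((b0.repr ⟨x, hx⟩ j : ℤ) : ℚ) • b0.extendOfIsLattice ℚ j := by
      have e := congrArg Subtype.val (b0.sum_repr ⟨x, hx⟩)
      simp only [Submodule.coe_sum, Submodule.coe_smul] at e
      simpa [Int.cast_smul_eq_zsmul] using e.symm
    rw [this, Basis.repr_sum_self]
    exact int_mem_ZZ _
  · rw [← (b0.extendOfIsLattice ℚ).sum_repr x]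
    apply Submodule.sum_mem
    intro i _
    obtain ⟨n, hn⟩ := mem_ZZ.1 (hx i)
    rw [← hn, Int.cast_smul_eq_zsmul]
    apply Submodule.smul_mem
    simp
theorem SD.finite {B : Frm X} {L} (h : SD B L) : FiniteDimensional ℚ X := by
  obtain ⟨n, b, _⟩ := exists_basis h.fg h.span
  exact b.finiteDimensional_of_finite
theorem exists_dual_basis [FiniteDimensional ℚ X] (B : Frm X) (hn : ∀ x, (∀ y, B x y = 0) → x = 0) {n}
    (b : Basis (Fin n) ℚ X) : ∃ c : Fin n → X, ∀ i x, B (c i) x = b.repr x i := by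
  have : ∀ i, ∃ c, ∀ x, B c x = b.repr x i := by
    intro i
    obtain ⟨c, hc⟩ := exists_repr B hn (b.coord i)
    exact ⟨c, fun x => by rw [hc]; rfl⟩
  choose c hc using this
  exact ⟨c, hc⟩
theorem dual_dual {B : Frm X} {L E : Submodule ℤ X} (h : SD B L) (hE : E.FG) (hLE : L ≤ E) {x : X}
    (hx : ∀ z ∈ dual B E, B x z ∈ ZZ) : x ∈ E := by
  have hs : Submodule.span ℚ (E : Set X) = ⊤ := by
    rw [eq_top_iff, ← h.span]; exact Submodule.span_mono hLE
  obtain ⟨n, b, hb⟩ := exists_basis hE hs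
  haveI := h.finite
  obtain ⟨c, hc⟩ := exists_dual_basis B h.nondeg b
  rw [hb]
  intro i
  rw [← hc, h.symm]
  apply hx
  intro y hy
  rw [hc]
  exact (hb y).1 hy i
theorem SD.transfer {B : Frm X} {L D : Submodule ℤ X} (h : SD B L) (hD : D.FG)
    (hint : ∀ x ∈ D, ∀ y ∈ D, B x y ∈ ZZ) : SD B ((L ⊓ dual B D) ⊔ D) := by
  haveI : Module.Finite ℤ L := Module.Finite.iff_fg.2 h.fg
  refine ⟨h.symm, ?_, ?_⟩
  · apply Submodule.FG.sup _ hD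
    have : IsNoetherian ℤ L := inferInstance
    exact Submodule.FG.of_le h.fg inf_le_left
  · intro x
    constructor
    · intro hx y hy
      obtain ⟨l, hl, d, hd, rfl⟩ := Submodule.mem_sup.1 hx
      obtain ⟨l', hl', d', hd', rfl⟩ := Submodule.mem_sup.1 hy
      simp only [map_add, LinearMap.add_apply]
      refine add_mem (add_mem (h.int hl.1 hl'.1) ?_) (add_mem (hl.2 d' hd') (hint d hd d' hd'))
      rw [h.symm]; exact hl'.2 d hd
    · intro hx
      have h1 : x ∈ L ⊔ D := by
        apply dual_dual h (h.fg.sup hD) le_sup_left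
        intro z hz
        apply hx
        apply Submodule.mem_sup_left
        refine ⟨(h.mem_iff z).2 fun y hy => hz y (Submodule.mem_sup_left hy),
          fun y hy => hz y (Submodule.mem_sup_right hy)⟩
      obtain ⟨l, hl, d, hd, rfl⟩ := Submodule.mem_sup.1 h1
      refine Submodule.add_mem_sup ⟨hl, fun y hy => ?_⟩ hd
      have := sub_mem (hx y (Submodule.mem_sup_right hy)) (hint d hd y hy)
      simpa using this
theorem EU.transfer {B : Frm X} {L D : Submodule ℤ X} (h : EU B L) (hD : D.FG)
    (hint : ∀ x ∈ D, ∀ y ∈ D, B x y ∈ ZZ) (he : ∀ x ∈ D, ∃ n : ℤ, B x x = 2 * n) :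
    EU B ((L ⊓ dual B D) ⊔ D) := by
  refine ⟨h.toSD.transfer hD hint, ?_⟩
  intro x hx
  obtain ⟨l, hl, d, hd, rfl⟩ := Submodule.mem_sup.1 hx
  obtain ⟨n, hn⟩ := h.even l hl.1
  obtain ⟨m, hm⟩ := he d hd
  obtain ⟨k, hk⟩ := mem_ZZ.1 (hl.2 d hd)
  refine ⟨n + m + k, ?_⟩
  simp only [map_add, LinearMap.add_apply]
  rw [h.symm d l, hn, hm, ← hk]; push_cast; ring
theorem SD.repr {B : Frm X} {L : Submodule ℤ X} (h : SD B L) (f : L →ₗ[ℤ] ℤ) :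
    ∃ l ∈ L, ∀ m : L, B l m = f m := by
  obtain ⟨n, b, hb⟩ := exists_basis h.fg h.span
  haveI := h.finite
  have hbL : ∀ i, b i ∈ L := by
    intro i; rw [hb]; intro j
    rw [b.repr_self, Finsupp.single_apply]
    split_ifs
    exacts [one_mem _, zero_mem _]
  obtain ⟨l, hl⟩ := exists_repr B h.nondeg (b.constr ℚ fun i => ((f ⟨b i, hbL i⟩ : ℤ) : ℚ))
  have key : ∀ m : L, B l m = f m := by
    rintro ⟨m, hm⟩
    choose c hc using fun i => mem_ZZ.1 ((hb m).1 hm i)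
    have e : (⟨m, hm⟩ : L) = ∑ i, c i • ⟨b i, hbL i⟩ := by
      apply Subtype.ext
      simp only [Submodule.coe_sum, Submodule.coe_smul]
      conv_lhs => rw [← b.sum_repr m]
      simp [← hc, Int.cast_smul_eq_zsmul]
    rw [hl, e, map_sum]
    simp only [Submodule.coe_sum, Submodule.coe_smul, map_sum, map_zsmul, Basis.constr_basis]
    push_cast
    simp
  refine ⟨l, ?_, key⟩
  rw [h.mem_iff]
  intro y hy
  rw [key ⟨y, hy⟩]; exact int_mem_ZZ _
theorem SD.prod {B : Frm X} {B' : Frm Y} {L L'} (h : SD B L) (h' : SD B' L') :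
    SD (prodF B B') (L.prod L') := by
  refine ⟨fun x y => by simp [h.symm x.1, h'.symm x.2], h.fg.prod h'.fg, fun x => ⟨?_, ?_⟩⟩
  · rintro ⟨h1, h2⟩ y ⟨h3, h4⟩
    exact add_mem (h.int h1 h3) (h'.int h2 h4)
  · intro hx
    refine ⟨(h.mem_iff _).2 fun y hy => ?_, (h'.mem_iff _).2 fun y hy => ?_⟩
    · simpa using hx (y, 0) ⟨hy, L'.zero_mem⟩
    · simpa using hx (0, y) ⟨L.zero_mem, hy⟩
theorem EU.prod {B : Frm X} {B' : Frm Y} {L L'} (h : EU B L) (h' : EU B' L') :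
    EU (prodF B B') (L.prod L') := by
  refine ⟨h.toSD.prod h'.toSD, ?_⟩
  rintro x ⟨h1, h2⟩
  obtain ⟨n, hn⟩ := h.even _ h1
  obtain ⟨m, hm⟩ := h'.even _ h2
  exact ⟨n + m, by simp [hn, hm]; ring⟩
def LatIso (B : Frm X) (L : Submodule ℤ X) (B' : Frm Y) (L' : Submodule ℤ Y) : Prop :=
  ∃ e : X ≃ₗ[ℚ] Y, (∀ x y, B' (e x) (e y) = B x y) ∧ ∀ x, x ∈ L ↔ e x ∈ L'
theorem LatIso.refl (B : Frm X) (L) : LatIso B L B L := ⟨LinearEquiv.refl _ _, fun _ _ => rfl, fun _ => Iff.rfl⟩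
theorem LatIso.symm {B : Frm X} {L} {B' : Frm Y} {L'} (h : LatIso B L B' L') : LatIso B' L' B L := by
  obtain ⟨e, he, hl⟩ := h
  exact ⟨e.symm, fun x y => by rw [← he]; simp, fun x => by rw [hl]; simp⟩
theorem LatIso.trans {B : Frm X} {L} {B' : Frm Y} {L'} {C : Frm Z} {M} (h : LatIso B L B' L')
    (h' : LatIso B' L' C M) : LatIso B L C M := by
  obtain ⟨e, he, hl⟩ := h
  obtain ⟨f, hf, hm⟩ := h'
  exact ⟨e.trans f, fun x y => by simp [hf, he], fun x => by rw [hl, hm]; rfl⟩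
theorem LatIso.isom {B : Frm X} {L} {B' : Frm Y} {L'} (h : LatIso B L B' L') : Isom B B' := by
  obtain ⟨e, he, hl⟩ := h
  exact ⟨e, he⟩
theorem LatIso.sd {B : Frm X} {L} {B' : Frm Y} {L'} (h : LatIso B L B' L') (hL : SD B L) : SD B' L' := by
  obtain ⟨e, he, hl⟩ := h
  have hl' : ∀ y, y ∈ L' ↔ e.symm y ∈ L := fun y => by rw [hl]; simp
  have he' : ∀ x y, B' x y = B (e.symm x) (e.symm y) := fun x y => by rw [← he]; simp
  refine ⟨fun x y => by rw [he', he', hL.symm], ?_, ?_⟩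
  · have : L' = L.map (e.toLinearMap.restrictScalars ℤ) := by
      ext y
      rw [hl', Submodule.mem_map]
      constructor
      · intro h; exact ⟨_, h, by simp⟩
      · rintro ⟨x, hx, rfl⟩; simpa using hx
    rw [this]; exact hL.fg.map _
  · intro x
    rw [hl', hL.mem_iff]
    constructor
    · intro h y hy
      rw [he']; exact h _ ((hl' y).1 hy)
    · intro h y hy
      have := h (e y) ((hl y).1 hy)
      rw [he'] at this; simpa using this
theorem LatIso.eu {B : Frm X} {L} {B' : Frm Y} {L'} (h : LatIso B L B' L') (hL : EU B L) : EU B' L' := by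
  refine ⟨h.sd hL.toSD, ?_⟩
  obtain ⟨e, he, hl⟩ := h
  intro x hx
  obtain ⟨n, hn⟩ := hL.even (e.symm x) (by rw [hl]; simpa using hx)
  exact ⟨n, by rw [← hn, ← he]; simp⟩
theorem Isom.lat {B : Frm X} {B' : Frm Y} (h : Isom B B') (L' : Submodule ℤ Y) :
    ∃ L, LatIso B L B' L' := by
  obtain ⟨e, he⟩ := h
  exact ⟨L'.comap (e.toLinearMap.restrictScalars ℤ), e, he, fun x => Iff.rfl⟩
theorem LatIso.prod {W : Type} [AddCommGroup W] [Module ℚ W] {B : Frm X} {L} {B' : Frm Y} {L'} {C : Frm Z} {M} {C' : Frm W} {M'}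
    (h : LatIso B L B' L') (h' : LatIso C M C' M') :
    LatIso (prodF B C) (L.prod M) (prodF B' C') (L'.prod M') := by
  obtain ⟨e, he, hl⟩ := h
  obtain ⟨f, hf, hm⟩ := h'
  exact ⟨e.prodCongr f, fun x y => by simp [he, hf], fun x => by simp [hl, hm]⟩
end lat
def SmZ (N : ℕ) (a : ℤ) : Prop := Sm N a.natAbs
theorem SmZ.ne {N a} (h : SmZ N a) : a ≠ 0 := Int.natAbs_ne_zero.1 h.1
theorem SmZ.neq {N a} (h : SmZ N a) : (a : ℚ) ≠ 0 := by exact_mod_cast h.ne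
theorem SmZ.mul {N a b} (ha : SmZ N a) (hb : SmZ N b) : SmZ N (a * b) := by
  unfold SmZ; rw [Int.natAbs_mul]; exact Sm.mul ha hb
theorem SmZ.neg {N a} (ha : SmZ N a) : SmZ N (-a) := by
  unfold SmZ; rw [Int.natAbs_neg]; exact ha
theorem SmZ.of_lt {N : ℕ} {a : ℤ} (h0 : 0 < a) (h : a < N) : SmZ N a :=
  Sm.of_lt (by omega) (by omega)
theorem SmZ.one {N} : SmZ N 1 := ⟨by simp, fun q hq h => absurd (Nat.dvd_one.1 (by simpa using h)) hq.ne_one⟩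
theorem SmZ.neg_one {N} : SmZ N (-1) := SmZ.one.neg
theorem SmZ.mono {N M a} (h : N ≤ M) (ha : SmZ N a) : SmZ M a := ⟨ha.1, fun q hq hd => (ha.2 q hq hd).trans_le h⟩
theorem SmZ.prod {N} {ι : Type} (s : Finset ι) (v : ι → ℤ) (h : ∀ i, SmZ N (v i)) : SmZ N (∏ i ∈ s, v i) :=
  Finset.prod_induction v (SmZ N) (fun _ _ => SmZ.mul) SmZ.one (fun i _ => h i)
theorem SmZ.ndvd {p : ℕ} (hp : p.Prime) {a} (h : SmZ p a) : ¬ (p : ℤ) ∣ a := by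
  intro hd
  exact lt_irrefl p (h.2 p hp (Int.natCast_dvd.1 hd))
theorem SmZ.zmod {p : ℕ} (hp : p.Prime) {a} (h : SmZ p a) : (a : ZMod p) ≠ 0 := by
  rw [Ne, ZMod.intCast_zmod_eq_zero_iff_dvd a p]; exact h.ndvd hp
noncomputable def Rp (N : ℕ) : AddSubgroup R := AddSubgroup.closure {r | ∃ a : ℤ, SmZ N a ∧ r = br a}
theorem br_mem {N} {a : ℤ} (h : SmZ N a) : br a ∈ Rp N := AddSubgroup.subset_closure ⟨a, h, rfl⟩
theorem one_mem_Rp {N} : (1 : R) ∈ Rp N := by rw [← br_one]; simpa using br_mem (SmZ.one (N := N))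
theorem eta_mem_Rp {N} : eta ∈ Rp N := by simpa [eta] using br_mem (SmZ.neg_one (N := N))
theorem br_mul_mem {N} {a : ℤ} (h : SmZ N a) {r} (hr : r ∈ Rp N) : br a * r ∈ Rp N := by
  induction hr using AddSubgroup.closure_induction with
  | mem x hx =>
    obtain ⟨b, hb, rfl⟩ := hx
    rw [← br_mul]; exact_mod_cast br_mem (h.mul hb)
  | zero => simp
  | add x y _ _ hx hy => rw [mul_add]; exact add_mem hx hy
  | neg x _ hx => rw [show br (a : ℚ) * -x = -(br (a : ℚ) * x) by ring]; exact neg_mem hx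
section
variable {p : ℕ} (hp : p.Prime)
noncomputable abbrev qm (p : ℕ) : R →+ R ⧸ Rp p := QuotientAddGroup.mk' (Rp p)
theorem qm_eq {a b : R} (h : a - b ∈ Rp p) : qm p a = qm p b := by
  rw [← sub_eq_zero, ← map_sub]; exact (QuotientAddGroup.eq_zero_iff _).2 h
theorem qm_zero {a : R} (h : a ∈ Rp p) : qm p a = 0 := (QuotientAddGroup.eq_zero_iff _).2 h
theorem qm_iff {a b : R} : qm p a = qm p b ↔ a - b ∈ Rp p := by
  rw [← sub_eq_zero, ← map_sub]; exact (QuotientAddGroup.eq_zero_iff _)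
theorem qm_mul {c : ℤ} (h : SmZ p c) {a b : R} (hab : qm p a = qm p b) : qm p (br c * a) = qm p (br c * b) := by
  rw [qm_iff] at *
  rw [← mul_sub]; exact br_mul_mem h hab
noncomputable abbrev qb (p : ℕ) (a : ℤ) : R ⧸ Rp p := qm p (br (p * a))
include hp
theorem qb_step {u v t : ℤ} (hu : SmZ p u) (hv : SmZ p v) (ht : SmZ p t) (h : u = v + p * t) :
    qb p u = qb p v := by
  have hp0 : (p : ℚ) ≠ 0 := by exact_mod_cast hp.ne_zero
  have e : (p * u + -(p * p * t) : ℚ) = p * v := by rw [h]; push_cast; ring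
  have := br_add (a := p * u) (b := -(p * p * t)) (mul_ne_zero hp0 hu.neq)
    (neg_ne_zero.2 (mul_ne_zero (mul_ne_zero hp0 hp0) ht.neq)) (by rw [e]; exact mul_ne_zero hp0 hv.neq)
  rw [e] at this
  apply qm_eq
  have e1 : br (-(p * p * t)) = br ((-t : ℤ) : ℚ) := by
    have : (-(p * p * t) : ℚ) = (p * p) * (-t : ℤ) := by push_cast; ring
    rw [this, br_mul, br_sq hp0, one_mul]
  have e2 : br (p * v) * br (p * u * -(p * p * t)) = br ((-(u * v * t) : ℤ) : ℚ) := by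
    rw [← br_mul]
    have : (p * v * (p * u * -(p * p * t)) : ℚ) = ((p * p) * (p * p)) * (-(u * v * t) : ℤ) := by
      push_cast; ring
    rw [this, br_mul, br_sq (mul_ne_zero hp0 hp0), one_mul]
  have : br (p * u) - br (p * v) = br ((-(u * v * t) : ℤ) : ℚ) - br ((-t : ℤ) : ℚ) := by
    rw [← e1, ← e2]; linear_combination this
  rw [this]
  exact sub_mem (br_mem ((hu.mul hv).mul ht).neg) (br_mem ht.neg)
theorem qb_mul {c : ℤ} (h : SmZ p c) {a b : ℤ} (hab : qb p a = qb p b) : qb p (c * a) = qb p (c * b) := by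
  have := qm_mul h hab
  rw [← br_mul, ← br_mul] at this
  unfold qb
  push_cast
  rw [mul_left_comm, this, mul_left_comm]
theorem qb_red_nat (n : ℕ) (hn : Sm p n) : ∃ r : ℤ, 0 < r ∧ r < p ∧ (p : ℤ) ∣ n - r ∧ qb p n = qb p r := by
  induction n using Nat.recOnMul with
  | zero => exact absurd rfl hn.1
  | one => exact ⟨1, one_pos, by exact_mod_cast hp.one_lt, by simp, by simp⟩
  | prime q hq =>
    have hqp : q < p := hn.2 q hq dvd_rfl
    exact ⟨q, by exact_mod_cast hq.pos, by exact_mod_cast hqp, by simp, rfl⟩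
  | mul a b iha ihb =>
    have ha : Sm p a := ⟨fun h => hn.1 (by simp [h]), fun q hq hd => hn.2 q hq (hd.mul_right b)⟩
    have hb : Sm p b := ⟨fun h => hn.1 (by simp [h]), fun q hq hd => hn.2 q hq (hd.mul_left a)⟩
    obtain ⟨r, r0, rp, hr, er⟩ := iha ha
    obtain ⟨s, s0, sp, hs, es⟩ := ihb hb
    have hr' := SmZ.of_lt r0 rp
    have hs' := SmZ.of_lt s0 sp
    have e1 : qb p ((a * b : ℕ) : ℤ) = qb p (r * s) := by
      rw [← qb_mul hp hr' es, mul_comm r, ← qb_mul hp (c := b) hb er, mul_comm]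
      push_cast; rfl
    have hpp : (0 : ℤ) < p := by exact_mod_cast hp.pos
    have hnd : (r * s) % p ≠ 0 := fun h => (hr'.mul hs').ndvd hp (Int.dvd_of_emod_eq_zero h)
    have h1 := Int.emod_nonneg (r * s) hpp.ne'
    have h2 := Int.emod_lt_of_pos (r * s) hpp
    have h3 := Int.emod_add_mul_ediv (r * s) p
    refine ⟨(r * s) % p, by omega, h2, ?_, ?_⟩
    · have : ((a * b : ℕ) : ℤ) - r * s % p = (a - r) * b + r * (b - s) + p * (r * s / p) := by
        push_cast; linear_combination -h3
      rw [this]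
      exact dvd_add (dvd_add (hr.mul_right _) (hs.mul_left _)) (dvd_mul_right _ _)
    · rw [e1]
      by_cases h0 : r * s / p = 0
      · rw [h0] at h3; simp at h3; rw [← h3]; simp
      · have h4 : 0 ≤ r * s / p := Int.ediv_nonneg (by positivity) hpp.le
        have h5 : r * s / p < p := by
          apply Int.ediv_lt_of_lt_mul hpp
          nlinarith
        exact qb_step hp (hr'.mul hs') (SmZ.of_lt (by omega) h2) (SmZ.of_lt (by omega) h5) h3.symm
theorem qb_red (a : ℤ) (ha : SmZ p a) : ∃ r : ℤ, 0 < r ∧ r < p ∧ (p : ℤ) ∣ a - r ∧ qb p a = qb p r := by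
  obtain ⟨r, r0, rp, hr, er⟩ := qb_red_nat hp a.natAbs ha
  rcases Int.natAbs_eq a with h | h
  · rw [← h] at hr er; exact ⟨r, r0, rp, hr, er⟩
  · refine ⟨p - r, by omega, by omega, ?_, ?_⟩
    · have : a - (p - r) = -((a.natAbs : ℤ) - r) - p := by omega
      rw [this]
      exact dvd_sub (hr.neg_right) dvd_rfl
    · have h1 := qb_mul hp SmZ.neg_one er
      have : a = -1 * (a.natAbs : ℤ) := by omega
      rw [this, h1]
      symm
      exact qb_step hp (t := 1) (SmZ.of_lt (by omega) (by omega)) (SmZ.neg_one.mul (SmZ.of_lt r0 rp)) SmZ.one (by ring)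
theorem qb_congr {a b : ℤ} (ha : SmZ p a) (hb : SmZ p b) (h : (p : ℤ) ∣ a - b) : qb p a = qb p b := by
  obtain ⟨r, r0, rp, hr, er⟩ := qb_red hp a ha
  obtain ⟨s, s0, sp, hs, es⟩ := qb_red hp b hb
  have : (p : ℤ) ∣ r - s := by
    have : r - s = (a - b) - (a - r) + (b - s) := by ring
    rw [this]; exact dvd_add (dvd_sub h hr) hs
  have h0 : r - s = 0 := by
    apply Int.eq_zero_of_abs_lt_dvd this
    rw [abs_lt]; constructor <;> omega
  rw [er, es, show r = s by omega]
theorem qb_sq {b x : ℤ} (hx : x ≠ 0) : qb p (b * (x * x)) = qb p b := by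
  unfold qb
  push_cast
  rw [← mul_assoc, br_mul, br_sq (by exact_mod_cast hx), mul_one]
theorem zlift (x : ZMod p) (hx : x ≠ 0) : ∃ a : ℤ, 0 < a ∧ a < p ∧ (a : ZMod p) = x := by
  haveI : NeZero p := ⟨hp.ne_zero⟩
  refine ⟨x.val, ?_, ?_, by simp⟩
  · have : x.val ≠ 0 := by rwa [Ne, ZMod.val_eq_zero]
    omega
  · exact_mod_cast ZMod.val_lt x
theorem qb_congr_sq {a b : ℤ} (ha : SmZ p a) (hb : SmZ p b) (x : ZMod p) (hx : x ≠ 0)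
    (h : (a : ZMod p) = b * (x * x)) : qb p a = qb p b := by
  obtain ⟨y, y0, yp, rfl⟩ := zlift hp x hx
  have hy := SmZ.of_lt y0 yp
  rw [← qb_sq hp (b := b) y0.ne']
  apply qb_congr hp ha (hb.mul (hy.mul hy))
  rw [← ZMod.intCast_zmod_eq_zero_iff_dvd]
  push_cast; rw [h]; ring
theorem qb_add {v w : ℤ} (hv : SmZ p v) (hw : SmZ p w) : qb p v + qb p w = qb p 1 + qb p (v * w) := by
  haveI : Fact p.Prime := ⟨hp⟩
  rcases hp.eq_two_or_odd with h2 | h2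
  · have : ∀ a, SmZ p a → qb p a = qb p 1 := by
      intro a ha
      apply qb_congr hp ha SmZ.one
      have := ha.ndvd hp
      rw [h2] at this ⊢
      push_cast at *
      omega
    rw [this v hv, this w hw, this _ (hv.mul hw)]
  · have hv' := hv.zmod hp
    have hw' := hw.zmod hp
    have hvw := hv.mul hw
    obtain ⟨x, y, hxy⟩ := FiniteField.exists_root_sum_quadratic (R := ZMod p)
      (f := Polynomial.C (v : ZMod p) * Polynomial.X ^ 2) (g := Polynomial.C (w : ZMod p) * Polynomial.X ^ 2 - 1)
      (Polynomial.degree_C_mul_X_pow 2 hv') (by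
        rw [Polynomial.degree_sub_eq_left_of_degree_lt, Polynomial.degree_C_mul_X_pow 2 hw']
        · rfl
        rw [Polynomial.degree_C_mul_X_pow 2 hw']; simp) (by rw [ZMod.card]; omega)
    simp at hxy
    have hxy : v * (x * x) + w * (y * y) = 1 := by linear_combination hxy
    by_cases hx : x = 0
    · subst hx
      have hy : y ≠ 0 := by rintro rfl; simp at hxy
      rw [qb_congr_sq hp hw SmZ.one y⁻¹ (inv_ne_zero hy) (by field_simp; push_cast; linear_combination hxy),
        qb_congr_sq hp hvw hv y⁻¹ (inv_ne_zero hy) (by field_simp; push_cast; linear_combination v * hxy), add_comm]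
    by_cases hy : y = 0
    · subst hy
      rw [qb_congr_sq hp hv SmZ.one x⁻¹ (inv_ne_zero hx) (by field_simp; push_cast; linear_combination hxy),
        qb_congr_sq hp hvw hw x⁻¹ (inv_ne_zero hx) (by field_simp; push_cast; linear_combination w * hxy)]
    obtain ⟨a, a0, ap, ea⟩ := zlift hp (v * (x * x)) (by simp [hx, hv'])
    obtain ⟨b, b0, bp, eb⟩ := zlift hp (w * (y * y)) (by simp [hy, hw'])
    have ha := SmZ.of_lt a0 ap
    have hb := SmZ.of_lt b0 bp
    have hab : a + b = p + 1 := by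
      have : (p : ℤ) ∣ a + b - 1 := by
        rw [← ZMod.intCast_zmod_eq_zero_iff_dvd]; push_cast; rw [ea, eb, hxy]; ring
      obtain ⟨k, hk⟩ := this
      have h1 : 0 < k := by by_contra h; nlinarith
      have h2 : k < 2 := by by_contra h; nlinarith
      have : k = 1 := by omega
      subst this; omega
    have hp1 : SmZ p (p + 1) := by
      have h3 := hp.two_le
      have : (p + 1 : ℤ) = 2 * ((p + 1) / 2) := by omega
      rw [this]
      exact (SmZ.of_lt (by omega) (by omega)).mul (SmZ.of_lt (by omega) (by omega))
    rw [← qb_congr_sq hp ha hv x hx ea, ← qb_congr_sq hp hb hw y hy eb,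
      ← qb_congr hp hp1 SmZ.one (by simp), ← qb_congr_sq hp (hp1.mul (ha.mul hb)) hvw (x * y) (mul_ne_zero hx hy)
        (by push_cast; rw [ea, eb]; simp; ring)]
    have hp0 : (p : ℚ) ≠ 0 := by exact_mod_cast hp.ne_zero
    have e : (p * a + p * b : ℚ) = p * (p + 1 : ℤ) := by
      rw [← hab]; push_cast; ring
    have := br_add (a := p * a) (b := p * b) (mul_ne_zero hp0 ha.neq) (mul_ne_zero hp0 hb.neq)
      (by rw [e]; exact mul_ne_zero hp0 hp1.neq)
    unfold qb
    rw [← map_add, this, e, mul_add, mul_one, ← br_mul, map_add]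
    congr 2
    have : (p * ((p + 1 : ℤ) : ℚ) * (p * a * (p * b)) : ℚ) = (p * p) * (p * ((p + 1) * (a * b) : ℤ)) := by push_cast; ring
    rw [this, br_mul, br_sq hp0, one_mul]
theorem qb_sum {J : Type} (s : Finset J) (v : J → ℤ) (hv : ∀ j, SmZ p (v j)) :
    (∑ j ∈ s, qb p (v j)) + qb p 1 = s.card • qb p 1 + qb p (∏ j ∈ s, v j) := by
  classical
  induction s using Finset.induction_on with
  | empty => simp
  | insert a s ha ih =>
    rw [sum_insert ha, prod_insert ha, card_insert_of_notMem ha, add_assoc, ih, succ_nsmul, add_assoc,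
      ← qb_add hp (hv a) (SmZ.prod s v hv)]
    abel
theorem qb_final {J : Type} [Fintype J] (v : J → ℤ) (hv : ∀ j, SmZ p (v j)) (k : ℕ) (hk : Fintype.card J = 2 * k)
    (x : ZMod p) (hx : x ≠ 0) (h : ((∏ j, v j : ℤ) : ZMod p) = (-1) ^ k * (x * x)) :
    (∑ j, br (p * v j)) ∈ Rp p := by
  have hp0 : (p : ℚ) ≠ 0 := by exact_mod_cast hp.ne_zero
  have h4 : 4 • qb p 1 = 0 := by
    rw [← map_nsmul]
    apply qm_zero
    have := four_br (x := p * (1 : ℤ)) (by have := hp.pos; push_cast; positivity)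
    rw [nsmul_eq_mul]; push_cast at *; rw [this]
    have := nsmul_mem (one_mem_Rp (N := p)) 4
    simpa using this
  have hm : qb p (-1) = - qb p 1 := by
    rw [eq_neg_iff_add_eq_zero, ← map_add]
    apply qm_zero
    have := hyp (a := p) hp0
    push_cast
    rw [mul_neg, mul_one, add_comm, this]
    exact add_mem one_mem_Rp eta_mem_Rp
  have hs := qb_sum hp univ v hv
  rw [card_univ, hk] at hs
  have hsm : SmZ p ((-1) ^ k) := by
    rcases neg_one_pow_eq_or ℤ k with h | h <;> rw [h]
    exacts [SmZ.one, SmZ.neg_one]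
  rw [qb_congr_sq hp (SmZ.prod univ v hv) hsm x hx (by rw [h]; push_cast; rfl)] at hs
  have hsum : qm p (∑ j, br (p * v j)) = ∑ j, qb p (v j) := map_sum _ _ _
  have key : qm p (∑ j, br (p * v j)) = 0 := by
    rw [hsum]
    rcases Nat.even_or_odd' k with ⟨c, rfl | rfl⟩
    · rw [show (-1 : ℤ) ^ (2 * c) = 1 by simp, add_left_inj] at hs
      rw [hs, show 2 * (2 * c) = c * 4 by ring, mul_nsmul', h4, smul_zero]
    · rw [show (-1 : ℤ) ^ (2 * c + 1) = -1 by simp [pow_succ], hm,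
        show 2 * (2 * c + 1) = c * 4 + 2 by ring, add_nsmul, mul_nsmul', h4, smul_zero, zero_add] at hs
      have : (∑ j, qb p (v j)) = 2 • qb p 1 + - qb p 1 - qb p 1 := by rw [← hs]; abel
      rw [this]; abel
  exact (QuotientAddGroup.eq_zero_iff _).1 key
end
theorem det_block {K : Type} [Field K] (k : ℕ) (A D : Matrix (Fin k) (Fin k) K) :
    (Matrix.fromBlocks 0 A A.transpose D).det = (-1) ^ k * (A.det * A.det) := by
  set J : Matrix (Fin k ⊕ Fin k) (Fin k ⊕ Fin k) K := Matrix.fromBlocks 0 1 (-1) 0 with hJ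
  set E : Matrix (Fin k ⊕ Fin k) (Fin k ⊕ Fin k) K := Matrix.fromBlocks 1 1 0 1 with hE
  have hEd : E.det = 1 := by rw [hE, Matrix.det_fromBlocks_zero₂₁]; simp
  have hJd : J.det = 1 := by
    have h1 : E * J * E = Matrix.fromBlocks (-1) 0 (-1) (-1) := by
      rw [hE, hJ, Matrix.fromBlocks_multiply, Matrix.fromBlocks_multiply]
      simp
    have h2 := congrArg Matrix.det h1
    rw [Matrix.det_mul, Matrix.det_mul, hEd, Matrix.det_fromBlocks_zero₁₂, Matrix.det_neg, Matrix.det_one] at h2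
    simp only [one_mul, mul_one] at h2
    rw [h2, ← mul_pow]; simp
  have h1 : Matrix.fromBlocks 0 A A.transpose D * J = Matrix.fromBlocks (-A) 0 (-D) A.transpose := by
    rw [hJ, Matrix.fromBlocks_multiply]; simp
  have h2 := congrArg Matrix.det h1
  rw [Matrix.det_mul, hJd, mul_one, Matrix.det_fromBlocks_zero₁₂, Matrix.det_neg, Matrix.det_transpose] at h2
  rw [h2]; simp; ring
theorem selfdual_det {K : Type} [Field K] {J : Type} [Fintype J] (d : J → K) (hd : ∀ j, d j ≠ 0)
    (H : Submodule K (J → K)) (hH : ∀ h, h ∈ H ↔ ∀ h' ∈ H, ∑ j, h j * h' j / d j = 0) :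
    ∃ k : ℕ, ∃ x : K, Fintype.card J = 2 * k ∧ x ≠ 0 ∧ ∏ j, d j = (-1) ^ k * (x * x) := by
  classical
  let B : LinearMap.BilinForm K (J → K) := LinearMap.mk₂ K (fun h h' => ∑ j, h j * h' j / d j)
    (fun x x' y => by simp only [Pi.add_apply, ← sum_add_distrib]; congr 1; ext; ring)
    (fun c x y => by simp only [Pi.smul_apply, smul_eq_mul, mul_sum]; congr 1; ext; ring)
    (fun x x' y => by simp only [Pi.add_apply, ← sum_add_distrib]; congr 1; ext; ring)
    (fun c x y => by simp only [Pi.smul_apply, smul_eq_mul, mul_sum]; congr 1; ext; ring)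
  have hB : ∀ x y, B x y = ∑ j, x j * y j / d j := fun x y => rfl
  have hsym : ∀ x y, B x y = B y x := by
    intro x y; rw [hB, hB]; congr 1; ext; ring
  have hker : B.ker = ⊥ := by
    rw [LinearMap.ker_eq_bot']
    intro x hx
    ext j
    have := congrFun (congrArg DFunLike.coe hx) (Pi.single j 1)
    rw [hB, Finset.sum_eq_single j (by intro i _ hi; simp [hi]) (by simp)] at this
    simpa [hd j] using this
  have horth : B.orthogonal H = H := by
    ext x
    rw [hH x]
    rw [LinearMap.BilinForm.mem_orthogonal_iff]
    constructor
    · intro h y hy; exact (hsym x y).trans (h y hy)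
    · intro h y hy; exact (hsym y x).trans (h y hy)
  have hdim := LinearMap.BilinForm.finrank_add_finrank_orthogonal' (B := B) H
  rw [horth, hker, inf_bot_eq, finrank_bot, add_zero, Module.finrank_fintype_fun_eq_card] at hdim
  obtain ⟨H', hc⟩ := H.exists_isCompl
  have hdim' := Submodule.finrank_add_eq_of_isCompl hc
  rw [Module.finrank_fintype_fun_eq_card] at hdim'
  set k := finrank K H with hk
  let b1 : Basis (Fin k) K H := finBasis K H
  let b2 : Basis (Fin k) K H' := finBasisOfFinrankEq K H' (by omega)
  let b : Basis (Fin k ⊕ Fin k) K (J → K) := (b1.prod b2).map (Submodule.prodEquivOfIsCompl H H' hc)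
  have hb1 : ∀ i, b (Sum.inl i) ∈ H := by
    intro i; simp [b, Submodule.coe_prodEquivOfIsCompl']
  obtain ⟨e⟩ : Nonempty (Fin k ⊕ Fin k ≃ J) := by
    rw [← Fintype.card_eq]; simp; omega
  let P : Matrix (Fin k ⊕ Fin k) (Fin k ⊕ Fin k) K := fun i j => b i (e j)
  have hP : P.det ≠ 0 := by
    have : LinearIndependent K P.row := by
      have := b.linearIndependent.map' (LinearMap.funLeft K K e) (LinearMap.ker_eq_bot.2 (LinearMap.funLeft_injective_of_surjective _ _ _ e.surjective))
      exact this
    rw [Matrix.linearIndependent_rows_iff_isUnit, Matrix.isUnit_iff_isUnit_det] at this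
    exact this.ne_zero
  have hG : ∀ i j, (P * Matrix.diagonal (fun j => (d (e j))⁻¹) * P.transpose) i j = B (b i) (b j) := by
    intro i j
    rw [Matrix.mul_apply, hB, ← e.sum_comp]
    refine Finset.sum_congr rfl fun l _ => ?_
    rw [Matrix.mul_diagonal, Matrix.transpose_apply]; show b i (e l) * _ * b j (e l) = _; ring
  let A : Matrix (Fin k) (Fin k) K := fun i j => B (b (Sum.inl i)) (b (Sum.inr j))
  let D : Matrix (Fin k) (Fin k) K := fun i j => B (b (Sum.inr i)) (b (Sum.inr j))
  have hblk : P * Matrix.diagonal (fun j => (d (e j))⁻¹) * P.transpose = Matrix.fromBlocks 0 A A.transpose D := by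
    ext i j
    rw [hG]
    rcases i with i | i <;> rcases j with j | j
    · exact (hH _).1 (hb1 i) _ (hb1 j)
    · rfl
    · exact hsym _ _
    · rfl
  have hdet := congrArg Matrix.det hblk
  rw [det_block, Matrix.det_mul, Matrix.det_mul, Matrix.det_diagonal, Matrix.det_transpose,
    Finset.prod_inv_distrib, e.prod_comp d] at hdet
  have hpd : ∏ j, d j ≠ 0 := prod_ne_zero_iff.2 fun j _ => hd j
  have hA : A.det ≠ 0 := by
    intro h
    rw [h] at hdet
    simp [hP, hpd] at hdet
  refine ⟨k, P.det / A.det, by omega, div_ne_zero hP hA, ?_⟩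
  have hs : ((-1 : K) ^ k) * (-1) ^ k = 1 := by rw [← mul_pow]; simp
  have h3 : P.det * P.det = (-1) ^ k * (A.det * A.det) * ∏ j, d j := by
    rw [← hdet]; field_simp
  field_simp
  linear_combination (-(-1)^k) * h3 - (∏ j, d j) * A.det ^ 2 * hs
theorem int_vec_fg (κ : Type) [Fintype κ] : ∃ D : Submodule ℤ (κ → ℚ), D.FG ∧ ∀ x, x ∈ D ↔ ∀ i, x i ∈ ZZ := by
  classical
  refine ⟨LinearMap.range (((Int.castAddHom ℚ).toIntLinearMap).compLeft κ), ?_, ?_⟩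
  · rw [LinearMap.range_eq_map]; exact Submodule.FG.map _ (Module.Finite.fg_top)
  · intro x
    rw [LinearMap.mem_range]
    constructor
    · rintro ⟨y, rfl⟩ i; exact int_mem_ZZ (y i)
    · intro h
      choose y hy using fun i => mem_ZZ.1 (h i)
      exact ⟨y, funext hy⟩
theorem stepA {p : ℕ} (hp : p.Prime) {I J : Type} [Fintype I] [Fintype J] (u : I → ℤ) (v : J → ℤ)
    (hu : ∀ i, SmZ p (u i)) (hv : ∀ j, SmZ p (v j))
    {L : Submodule ℤ (I ⊕ J → ℚ)}
    (hL : SD (diagF (Sum.elim (fun i => (u i : ℚ)) (fun j => (p : ℚ) * v j))) L) :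
    ∃ k : ℕ, ∃ x : ZMod p, Fintype.card J = 2 * k ∧ x ≠ 0 ∧ ((∏ j, v j : ℤ) : ZMod p) = (-1) ^ k * (x * x) := by
  classical
  haveI : Fact p.Prime := ⟨hp⟩
  have hp0 : (p : ℚ) ≠ 0 := by exact_mod_cast hp.ne_zero
  set B := diagF (Sum.elim (fun i => (u i : ℚ)) (fun j => (p : ℚ) * v j)) with hB
  obtain ⟨D, hD, hDm⟩ := int_vec_fg (I ⊕ J)
  have h1 := hL.transfer hD (by
    intro x hx y hy
    rw [hDm] at hx hy
    rw [hB, diagF_apply]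
    refine sum_mem fun i _ => mul_mem (mul_mem ?_ (hx i)) (hy i)
    rcases i with i | j
    · exact int_mem_ZZ _
    · exact_mod_cast int_mem_ZZ (p * v j))
  set L1 := (L ⊓ dual B D) ⊔ D with hL1
  have hBv : ∀ x y, B x y = ∑ i, u i * x (Sum.inl i) * y (Sum.inl i) + ∑ j, p * v j * x (Sum.inr j) * y (Sum.inr j) := by
    intro x y; simp [hB]
  have hsing : ∀ x ∈ L1, ∀ i, B x (Pi.single i 1) ∈ ZZ := by
    intro x hx i
    apply h1.int hx
    apply Submodule.mem_sup_right
    rw [hDm]; intro j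
    rw [Pi.single_apply]; split_ifs
    exacts [one_mem _, zero_mem _]
  have cI : ∀ x ∈ L1, ∃ a : I → ℤ, ∀ i, (a i : ℚ) = u i * x (Sum.inl i) := by
    intro x hx
    have : ∀ i, ∃ a : ℤ, (a : ℚ) = u i * x (Sum.inl i) := by
      intro i
      have := hsing x hx (Sum.inl i)
      rw [hBv] at this
      simpa [Pi.single_apply] using mem_ZZ.1 this
    choose a ha using this
    exact ⟨a, ha⟩
  have cJ : ∀ x ∈ L1, ∃ a : J → ℤ, ∀ j, (a j : ℚ) = p * v j * x (Sum.inr j) := by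
    intro x hx
    have : ∀ j, ∃ a : ℤ, (a : ℚ) = p * v j * x (Sum.inr j) := by
      intro i
      have := hsing x hx (Sum.inr i)
      rw [hBv] at this
      simpa [Pi.single_apply] using mem_ZZ.1 this
    choose a ha using this
    exact ⟨a, ha⟩
  set W : ℤ := (∏ i, u i) * ∏ j, v j with hW
  have hWs : SmZ p W := (SmZ.prod _ u hu).mul (SmZ.prod _ v hv)
  have hWu : ∀ i, ∃ t : ℤ, W = u i * t := fun i => (dvd_prod_of_mem u (mem_univ i)).mul_right _
  have hWv : ∀ j, ∃ t : ℤ, W = v j * t := fun j => (dvd_prod_of_mem v (mem_univ j)).mul_left _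
  choose tu htu using hWu
  choose tv htv using hWv
  have hWz := hWs.zmod hp
  let H0 : AddSubgroup (J → ZMod p) :=
    { carrier := {h | ∃ x ∈ L1, ∃ c : J → ℤ, (∀ j, (c j : ℚ) = p * v j * x (Sum.inr j)) ∧ ∀ j, h j = c j}
      add_mem' := by
        rintro h h' ⟨x, hx, c, hc, e⟩ ⟨x', hx', c', hc', e'⟩
        refine ⟨x + x', add_mem hx hx', c + c', fun j => ?_, fun j => ?_⟩
        · simp [hc, hc']; ring
        · simp [e, e']
      zero_mem' := ⟨0, zero_mem _, 0, by simp, by simp⟩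
      neg_mem' := by
        rintro h ⟨x, hx, c, hc, e⟩
        exact ⟨-x, neg_mem hx, -c, by simp [hc], by simp [e]⟩ }
  let H : Submodule (ZMod p) (J → ZMod p) := AddSubgroup.toZModSubmodule p H0
  have hHmem : ∀ h, h ∈ H ↔ ∃ x ∈ L1, ∃ c : J → ℤ, (∀ j, (c j : ℚ) = p * v j * x (Sum.inr j)) ∧ ∀ j, h j = c j :=
    fun h => Iff.rfl
  have hvz : ∀ j, (v j : ZMod p) ≠ 0 := fun j => (hv j).zmod hp
  have htvz : ∀ j (a b : ZMod p), a * b / (v j : ZMod p) = (W : ZMod p)⁻¹ * (tv j * (a * b)) := by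
    intro j a b
    rw [div_eq_iff (hvz j), inv_mul_eq_div, div_mul_eq_mul_div, eq_div_iff hWz]
    conv_lhs => rw [htv j]
    push_cast; ring
  have hsum : ∀ (a b : J → ZMod p), ∑ j, a j * b j / (v j : ZMod p) = 0 ↔ ∑ j, tv j * (a j * b j) = 0 := by
    intro a b
    simp only [htvz, ← mul_sum, mul_eq_zero, inv_eq_zero, hWz, false_or]
  have main : ∀ h, h ∈ H ↔ ∀ h' ∈ H, ∑ j, h j * h' j / ((v j : ℤ) : ZMod p) = 0 := by
    intro h
    constructor
    · intro hh h' hh'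
      obtain ⟨x, hx, c, hc, e⟩ := (hHmem h).1 hh
      obtain ⟨x', hx', c', hc', e'⟩ := (hHmem h').1 hh'
      obtain ⟨a, ha⟩ := cI x hx
      obtain ⟨a', ha'⟩ := cI x' hx'
      obtain ⟨N, hN⟩ := mem_ZZ.1 (h1.int hx hx')
      rw [hsum]
      have key : ∑ j, tv j * (c j * c' j) = p * (W * N - ∑ i, tu i * (a i * a' i)) := by
        have : ((∑ j, tv j * (c j * c' j) : ℤ) : ℚ) = (p * (W * N - ∑ i, tu i * (a i * a' i)) : ℤ) := by
          push_cast
          rw [hN, hBv, mul_add, add_comm, add_sub_assoc, mul_add, mul_sum, mul_sum, mul_sum, ← sub_eq_zero,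
            ← sub_sub, ← sum_sub_distrib]
          have e1 : ∀ j, tv j * (c j * c' j : ℚ) - p * (W * (p * v j * x (Sum.inr j) * x' (Sum.inr j))) = 0 := by
            intro j
            have := htv j
            have : (W : ℚ) = v j * tv j := by exact_mod_cast this
            rw [this, hc, hc']; ring
          have e2 : ∀ i, (W : ℚ) * (u i * x (Sum.inl i) * x' (Sum.inl i)) = tu i * (a i * a' i) := by
            intro i
            have := htu i
            have : (W : ℚ) = u i * tu i := by exact_mod_cast this
            rw [this, ha, ha']; ring
          simp [e1, e2]
        exact_mod_cast this
      have := congrArg (Int.cast : ℤ → ZMod p) key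
      push_cast at this
      simp only [e, e']
      rw [this]; simp
    · intro hh
      choose c hc using fun j => ZMod.intCast_surjective (n := p) (h j)
      have hy : (Sum.elim (fun _ => 0) (fun j => (W : ℚ) * c j / (p * v j)) : I ⊕ J → ℚ) ∈ L1 := by
        rw [h1.mem_iff]
        intro x hx
        obtain ⟨c', hc'⟩ := cJ x hx
        have h2 := hh (fun j => c' j) ((hHmem _).2 ⟨x, hx, c', hc', fun j => rfl⟩)
        rw [hsum] at h2
        simp only [← hc] at h2
        have h3 : (p : ℤ) ∣ ∑ j, tv j * (c j * c' j) := by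
          rw [← ZMod.intCast_zmod_eq_zero_iff_dvd]; push_cast; exact h2
        obtain ⟨N, hN⟩ := h3
        rw [mem_ZZ]
        refine ⟨N, ?_⟩
        have hN' : (p : ℚ) * N = ∑ j, (tv j : ℚ) * ((c j : ℚ) * (c' j : ℚ)) := by exact_mod_cast hN.symm
        rw [← mul_right_inj' hp0, hN', hBv]
        simp only [Sum.elim_inl, Sum.elim_inr, mul_zero, zero_mul, sum_const_zero, zero_add, mul_sum]
        refine Finset.sum_congr rfl fun j _ => ?_
        have hv0 := (hv j).neq
        have h4 : (W : ℚ) = v j * tv j := by exact_mod_cast htv j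
        rw [hc', h4]; field_simp
      have h5 : (W : ZMod p) • h ∈ H := by
        rw [hHmem]
        refine ⟨_, hy, fun j => W * c j, fun j => ?_, fun j => ?_⟩
        · have hv0 := (hv j).neq
          simp; field_simp
        · simp [hc]
      have := H.smul_mem (W : ZMod p)⁻¹ h5
      rwa [smul_smul, inv_mul_cancel₀ hWz, one_smul] at this
  obtain ⟨k, x, h2, h3, h4⟩ := selfdual_det _ hvz H main
  exact ⟨k, x, h2, h3, by push_cast; exact h4⟩
theorem br_pow_red {p : ℕ} (hp : p.Prime) (a : ℤ) (ha : SmZ (p + 1) a) :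
    ∃ u : ℤ, SmZ p u ∧ (br a = br u ∨ br a = br (p * u)) := by
  have hp0 : (p : ℚ) ≠ 0 := by exact_mod_cast hp.ne_zero
  obtain ⟨e, m, hm, hn⟩ := Nat.exists_eq_pow_mul_and_not_dvd ha.1 p hp.ne_one
  have hm0 : m ≠ 0 := by rintro rfl; simp at hm
  have hsm : Sm p m := ⟨hm0, fun q hq hd => by
    have h1 := ha.2 q hq (by rw [hn]; exact hd.mul_left _)
    have h2 : q ≠ p := by rintro rfl; exact hm hd
    omega⟩
  obtain ⟨u, hu, hau⟩ : ∃ u : ℤ, SmZ p u ∧ a = p ^ e * u := by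
    rcases Int.natAbs_eq a with h | h
    · exact ⟨m, hsm, by rw [h, hn]; push_cast; ring⟩
    · exact ⟨-m, SmZ.neg (a := (m : ℤ)) hsm, by rw [h, hn]; push_cast; ring⟩
  refine ⟨u, hu, ?_⟩
  rcases Nat.even_or_odd' e with ⟨c, rfl | rfl⟩
  · left
    have : (a : ℚ) = (p ^ c * p ^ c) * u := by rw [hau]; push_cast; ring
    rw [this, br_mul, br_sq (pow_ne_zero _ hp0), one_mul]
  · right
    have : (a : ℚ) = (p ^ c * p ^ c) * (p * u) := by rw [hau]; push_cast; ring
    rw [this, br_mul, br_sq (pow_ne_zero _ hp0), one_mul]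
theorem Rp_form {p : ℕ} (hp : p.Prime) {r : R} (hr : r ∈ Rp (p + 1)) :
    ∃ (I J : Type) (_ : Fintype I) (_ : Fintype J) (u : I → ℤ) (v : J → ℤ) (k : ℕ),
      (∀ i, SmZ p (u i)) ∧ (∀ j, SmZ p (v j)) ∧
      r + k * (1 + eta) = ∑ i, br (u i) + ∑ j, br (p * v j) := by
  have hp0 : (p : ℚ) ≠ 0 := by exact_mod_cast hp.ne_zero
  induction hr using AddSubgroup.closure_induction with
  | mem x hx =>
    obtain ⟨a, ha, rfl⟩ := hx
    obtain ⟨u, hu, h | h⟩ := br_pow_red hp a ha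
    · exact ⟨Unit, Empty, inferInstance, inferInstance, fun _ => u, fun _ => 0, 0, fun _ => hu, by simp, by simp [h]⟩
    · exact ⟨Empty, Unit, inferInstance, inferInstance, fun _ => 0, fun _ => u, 0, by simp, fun _ => hu, by simp [h]⟩
  | zero => exact ⟨Empty, Empty, inferInstance, inferInstance, fun _ => 0, fun _ => 0, 0, by simp, by simp, by simp⟩
  | add x y _ _ hx hy =>
    obtain ⟨I, J, _, _, u, v, k, hu, hv, h⟩ := hx
    obtain ⟨I', J', _, _, u', v', k', hu', hv', h'⟩ := hy
    refine ⟨I ⊕ I', J ⊕ J', inferInstance, inferInstance, Sum.elim u u', Sum.elim v v', k + k', ?_, ?_, ?_⟩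
    · rintro (i | i); exacts [hu i, hu' i]
    · rintro (i | i); exacts [hv i, hv' i]
    · simp only [Fintype.sum_sum_type, Sum.elim_inl, Sum.elim_inr]
      push_cast
      linear_combination h + h'
  | neg x _ hx =>
    obtain ⟨I, J, _, _, u, v, k, hu, hv, h⟩ := hx
    have e1 : ∀ i, br ((-u i : ℤ) : ℚ) = (1 + eta) - br (u i) := by
      intro i; rw [← hyp (hu i).neq]; push_cast; ring
    have e2 : ∀ j, br (p * (-v j : ℤ)) = (1 + eta) - br (p * v j) := by
      intro j; rw [← hyp (mul_ne_zero hp0 (hv j).neq)]; push_cast; rw [mul_neg]; ring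
    refine ⟨I ⊕ Fin k ⊕ Fin k, J, inferInstance, inferInstance, Sum.elim (fun i => - u i) (Sum.elim (fun _ => 1) (fun _ => -1)), fun j => - v j, Fintype.card I + Fintype.card J + 0 + 0, ?_, fun j => (hv j).neg, ?_⟩
    · rintro (i | i | i); exacts [(hu i).neg, SmZ.one, SmZ.neg_one]
    · simp only [Fintype.sum_sum_type, Sum.elim_inl, Sum.elim_inr, e1, e2, sum_sub_distrib, sum_const, card_univ, nsmul_eq_mul, Fintype.card_fin]
      push_cast
      rw [br_one, show br (-1) = eta from rfl]
      linear_combination -h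
theorem sd_one (κ : Type) [Fintype κ] (w : κ → ℚ) (hw : ∀ i, w i = 1 ∨ w i = -1) : ∃ L, SD (diagF w) L := by
  classical
  obtain ⟨D, hD, hm⟩ := int_vec_fg κ
  refine ⟨D, fun x y => by simp only [diagF_apply]; congr 1; ext; ring, hD, fun x => ?_⟩
  rw [hm]
  constructor
  · intro hx y hy
    rw [hm] at hy
    rw [diagF_apply]
    refine sum_mem fun i _ => mul_mem (mul_mem ?_ (hx i)) (hy i)
    rcases hw i with h | h <;> rw [h]
    exacts [one_mem _, neg_mem (one_mem _)]
  · intro hx i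
    have := hx (Pi.single i 1) (by
      rw [hm]; intro j
      rw [Pi.single_apply]; split_ifs
      exacts [one_mem _, zero_mem _])
    have t : w i * x i ∈ ZZ := by simpa only [diagF_apply, Pi.single_apply, mul_ite, mul_one, mul_zero, sum_ite_eq', mem_univ, if_true] using this
    rcases hw i with h | h <;> rw [h] at t
    · rwa [one_mul] at t
    · rw [neg_one_mul] at t
      rw [← neg_neg (x i)]
      exact neg_mem t
theorem r2_step {p : ℕ} (hp : p.Prime) {X : Type} [AddCommGroup X] [Module ℚ X] {B : Frm X} {L : Submodule ℤ X}
    (hL : SD B L) {r : R} (hr : HasCl B r) (hrp : r ∈ Rp (p + 1)) : r ∈ Rp p := by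
  have hp0 : (p : ℚ) ≠ 0 := by exact_mod_cast hp.ne_zero
  obtain ⟨I, J, _, _, u, v, k, hu, hv, h⟩ := Rp_form hp hrp
  have hw : ∀ i : Fin k ⊕ Fin k, (Sum.elim (fun _ => (1 : ℚ)) (fun _ => -1) i = 1 ∨ Sum.elim (fun _ => (1 : ℚ)) (fun _ => -1) i = -1) := by
    rintro (i | i) <;> simp
  obtain ⟨L', hL'⟩ := sd_one (Fin k ⊕ Fin k) (Sum.elim (fun _ => 1) (fun _ => -1)) hw
  have hc' := HasCl.diag (Sum.elim (fun _ : Fin k => (1 : ℚ)) (fun _ : Fin k => -1)) (by rintro (i | i) <;> simp)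
  have h2 := hr.prod hc'
  have hd := HasCl.diag (Sum.elim (fun i => (u i : ℚ)) (fun j => (p : ℚ) * v j)) (by
    rintro (i | j)
    exacts [(hu i).neq, mul_ne_zero hp0 (hv j).neq])
  have e : r + ∑ i : Fin k ⊕ Fin k, br (Sum.elim (fun _ : Fin k => (1 : ℚ)) (fun _ : Fin k => -1) i) =
      ∑ i, br (Sum.elim (fun i => (u i : ℚ)) (fun j => (p : ℚ) * v j) i) := by
    simp only [Fintype.sum_sum_type, Sum.elim_inl, Sum.elim_inr, sum_const, card_univ, nsmul_eq_mul, Fintype.card_fin]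
    rw [br_one, show br (-1) = eta from rfl, ← h]; ring
  rw [e] at h2
  obtain ⟨M, hM⟩ := (hd.isom h2).lat (L.prod L')
  obtain ⟨m, x, h3, h4, h5⟩ := stepA hp u v hu hv (hM.symm.sd (hL.prod hL'))
  have h6 := qb_final hp v hv m h3 x h4 h5
  have : r = ∑ i, br (u i) + ∑ j, br (p * v j) - k • (1 + eta) := by
    rw [← h, nsmul_eq_mul]; ring
  rw [this]
  refine sub_mem (add_mem (sum_mem fun i _ => br_mem (hu i)) h6) (nsmul_mem (add_mem one_mem_Rp eta_mem_Rp) _)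
theorem Rp_nonprime {N : ℕ} (hN : ¬ N.Prime) : Rp (N + 1) ≤ Rp N := by
  unfold Rp
  apply AddSubgroup.closure_mono
  rintro r ⟨a, ha, rfl⟩
  refine ⟨a, ⟨ha.1, fun q hq hd => ?_⟩, rfl⟩
  have := ha.2 q hq hd
  have : q ≠ N := by rintro rfl; exact hN hq
  omega
theorem Rp_zero {r : R} (hr : r ∈ Rp 0) : ∃ i j : ℤ, r = i + j * eta := by
  induction hr using AddSubgroup.closure_induction with
  | mem x hx =>
    obtain ⟨a, ha, rfl⟩ := hx
    have h1 : a.natAbs = 1 := by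
      by_contra h
      obtain ⟨q, hq, hd⟩ := Nat.exists_prime_and_dvd h
      exact absurd (ha.2 q hq hd) (by omega)
    rcases Int.natAbs_eq a with h | h <;> rw [h1] at h <;> rw [h]
    · exact ⟨1, 0, by simp [br_one]⟩
    · exact ⟨0, 1, by simp [eta]⟩
  | zero => exact ⟨0, 0, by simp⟩
  | add x y _ _ hx hy =>
    obtain ⟨i, j, rfl⟩ := hx
    obtain ⟨i', j', rfl⟩ := hy
    exact ⟨i + i', j + j', by push_cast; ring⟩
  | neg x _ hx =>
    obtain ⟨i, j, rfl⟩ := hx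
    exact ⟨-i, -j, by push_cast; ring⟩
theorem br_rat {a : ℚ} (ha : a ≠ 0) : ∃ n : ℤ, n ≠ 0 ∧ br a = br n := by
  refine ⟨a.num * a.den, mul_ne_zero (Rat.num_ne_zero.2 ha) (by exact_mod_cast a.den_nz), ?_⟩
  have hd : (a.den : ℚ) ≠ 0 := by exact_mod_cast a.den_nz
  have : ((a.num * a.den : ℤ) : ℚ) = a * (a.den * a.den) := by
    push_cast
    nth_rw 3 [← Rat.num_div_den a]
    field_simp
  rw [this, br_mul, br_sq hd, mul_one]
theorem R2 {X : Type} [AddCommGroup X] [Module ℚ X] {B : Frm X} {L : Submodule ℤ X}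
    (hL : SD B L) {r : R} (hr : HasCl B r) : ∃ i j : ℤ, r = i + j * eta := by
  have h1 : ∃ N, r ∈ Rp N := by
    obtain ⟨s, hs, _, rfl⟩ := hr
    clear * - hs
    induction s using Multiset.induction_on with
    | empty => exact ⟨0, by simp [cl]⟩
    | cons a s ih =>
      obtain ⟨N, hN⟩ := ih (fun a ha => hs a (Multiset.mem_cons_of_mem ha))
      obtain ⟨n, hn, e⟩ := br_rat (hs a (Multiset.mem_cons_self a s))
      refine ⟨N + n.natAbs + 1, ?_⟩
      rw [show cl (a ::ₘ s) = br a + cl s by simp [cl], e]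
      refine add_mem (br_mem ⟨by simpa using hn, fun q hq hd => ?_⟩) ?_
      · have := Nat.le_of_dvd (by omega) hd
        omega
      · refine AddSubgroup.closure_mono ?_ hN
        rintro r ⟨a, ha, rfl⟩
        exact ⟨a, ha.mono (by omega), rfl⟩
  obtain ⟨N, hN⟩ := h1
  have h2 : r ∈ Rp 0 := by
    induction N with
    | zero => exact hN
    | succ N ih =>
      apply ih
      by_cases hp : N.Prime
      · exact r2_step hp hL hr hN
      · exact Rp_nonprime hp hN
  exact Rp_zero h2
theorem isom_finrank {X Y : Type} [AddCommGroup X] [Module ℚ X] [AddCommGroup Y] [Module ℚ Y] {B : Frm X} {C : Frm Y}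
    (h : Isom B C) : finrank ℚ X = finrank ℚ Y := by
  obtain ⟨e, _⟩ := h; exact e.finrank_eq
theorem posdef_cl {X : Type} [AddCommGroup X] [Module ℚ X] {B : Frm X} {L : Submodule ℤ X}
    (hL : SD B L) (hpos : ∀ x, x ≠ 0 → 0 < B x x) : HasCl B (finrank ℚ X : ℕ) := by
  haveI := hL.finite
  obtain ⟨r, hr⟩ := exists_hasCl B hL.symm hL.nondeg
  obtain ⟨i, j, h⟩ := R2 hL hr
  obtain ⟨a, b, c, d, hij⟩ : ∃ a b c d : ℕ, i = a - c ∧ j = b - d ∧ (b = 0 ∨ d = 0) := by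
    refine ⟨i.toNat, j.toNat, (-i).toNat, (-j).toNat, by omega, by omega, by omega⟩
  have one : ∀ n : ℕ, HasCl (diagF fun _ : Fin n => (1 : ℚ)) (n : R) := by
    intro n; have := HasCl.diag (fun _ : Fin n => (1 : ℚ)) (by simp); simpa [br_one] using this
  have mone : ∀ n : ℕ, HasCl (diagF fun _ : Fin n => (-1 : ℚ)) (n * eta) := by
    intro n; have := HasCl.diag (fun _ : Fin n => (-1 : ℚ)) (by simp)
    simpa [show br (-1) = eta from rfl] using this
  have h1 := (hr.prod (one c)).prod (mone d)
  have h2 := (one a).prod (mone b)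
  have e : r + c + d * eta = a + b * eta := by
    rw [h, hij.1, hij.2.1]; push_cast; ring
  rw [e] at h1
  obtain ⟨f, hf⟩ := h1.isom h2
  have hfr := f.finrank_eq
  simp at hfr
  have sq1 : ∀ n (x : Fin n → ℚ), 0 ≤ diagF (fun _ => (1 : ℚ)) x x := by
    intro n x; rw [diagF_apply]; exact sum_nonneg fun i _ => by nlinarith [mul_self_nonneg (x i)]
  have sqm : ∀ n (x : Fin n → ℚ), x ≠ 0 → diagF (fun _ => (-1 : ℚ)) x x < 0 := by
    intro n x hx
    obtain ⟨i, hi⟩ := Function.ne_iff.1 hx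
    rw [diagF_apply]
    apply sum_neg' (fun i _ => by nlinarith [mul_self_nonneg (x i)]) 
    exact ⟨i, mem_univ i, by have hi' : x i ≠ 0 := hi; have := mul_self_pos.2 hi'; linarith⟩
  have sqp : ∀ n (x : Fin n → ℚ), x ≠ 0 → 0 < diagF (fun _ => (1 : ℚ)) x x := by
    intro n x hx
    obtain ⟨i, hi⟩ := Function.ne_iff.1 hx
    rw [diagF_apply]
    apply sum_pos' (fun i _ => by nlinarith [mul_self_nonneg (x i)]) 
    exact ⟨i, mem_univ i, by have hi' : x i ≠ 0 := hi; have := mul_self_pos.2 hi'; linarith⟩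
  have hposB : ∀ x, 0 ≤ B x x := fun x => by
    by_cases hx : x = 0
    · simp [hx]
    · exact (hpos x hx).le
  have hb : b = 0 := by
    by_contra hb
    have hd : d = 0 := by tauto
    subst hd
    let y : Fin b → ℚ := fun _ => 1
    have hy : y ≠ 0 := fun h => by have := congrFun h ⟨0, by omega⟩; simp [y] at this
    have := hf (f.symm (0, y)) (f.symm (0, y))
    simp only [LinearEquiv.apply_symm_apply, prodF_apply] at this
    have h3 := sqm b y hy
    set z := f.symm (0, y)
    have h4 := hposB z.1.1
    have h5 := sq1 c z.1.2
    have h6 : z.2 = 0 := Subsingleton.elim _ _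
    rw [h6] at this
    simp only [map_zero, LinearMap.zero_apply] at this
    linarith
  have hd : d = 0 := by
    by_contra hd
    subst hb
    let y : Fin d → ℚ := fun _ => 1
    have hy : y ≠ 0 := fun h => by have := congrFun h ⟨0, by omega⟩; simp [y] at this
    have := hf ((0, 0), y) ((0, 0), y)
    simp only [prodF_apply] at this
    have h3 := sqm d y hy
    set z := f ((0, 0), y)
    have h5 := sq1 a z.1
    have h6 : z.2 = 0 := Subsingleton.elim _ _
    rw [h6] at this
    simp only [map_zero, LinearMap.zero_apply] at this
    linarith
  subst hb hd
  have : r = (finrank ℚ X : ℕ) := by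
    have h7 : (finrank ℚ X : R) + c = a := by
      have : finrank ℚ X + c = a := by omega
      rw [← this]; push_cast; rfl
    simp at e
    linear_combination e - h7
  rw [← this]; exact hr
section
variable {Y : Type} [AddCommGroup Y] [Module ℚ Y]
theorem red_exists {C : Frm Y} {F : Submodule ℤ Y} (hF : SD C F) (p : ℕ) [Fact p.Prime] :
    ∃ ρ : Y → (Fin (finrank ℚ Y) → ZMod p), (∀ x ∈ F, ∀ y ∈ F, ρ (x + y) = ρ x + ρ y) ∧
      (∀ x ∈ F, ∀ m : ℤ, ρ (m • x) = (m : ZMod p) • ρ x) ∧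
      (∀ t, ∃ x ∈ F, ρ x = t) ∧ (∀ x ∈ F, ρ x = 0 → ∃ f ∈ F, x = (p : ℤ) • f) ∧
      ∃ β : LinearMap.BilinForm (ZMod p) (Fin (finrank ℚ Y) → ZMod p), β.Nondegenerate ∧
        ∀ x ∈ F, ∀ y ∈ F, ∀ m : ℤ, C x y = m → β (ρ x) (ρ y) = m := by
  haveI := hF.finite
  obtain ⟨n, b, hb⟩ := exists_basis hF.fg hF.span
  have hn : n = finrank ℚ Y := by simpa using (finrank_eq_card_basis b).symm
  subst hn
  obtain ⟨c, hc⟩ := exists_dual_basis C hF.nondeg b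
  have hcF : ∀ i, c i ∈ F := fun i => by
    rw [hF.mem_iff]; intro y hy; rw [hc]; exact (hb y).1 hy i
  have hbF : ∀ i, b i ∈ F := by
    intro i; rw [hb]; intro j
    rw [b.repr_self, Finsupp.single_apply]
    split_ifs
    exacts [one_mem _, zero_mem _]
  set ρ : Y → (Fin (finrank ℚ Y) → ZMod p) := fun x i => ((b.repr x i).num : ZMod p) with hρ
  have key : ∀ (a : Fin (finrank ℚ Y) → ℤ) x, (∀ i, b.repr x i = a i) → ρ x = fun i => (a i : ZMod p) := by
    intro a x h; funext i; simp [hρ, h]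
  have coo : ∀ x ∈ F, ∃ a : Fin (finrank ℚ Y) → ℤ, ∀ i, b.repr x i = a i := by
    intro x hx
    choose a ha using fun i => mem_ZZ.1 ((hb x).1 hx i)
    exact ⟨a, fun i => (ha i).symm⟩
  have sur : ∀ t, ∃ x ∈ F, ρ x = t := by
    intro t
    choose a ha using fun i => ZMod.intCast_surjective (t i)
    have e : ∀ i, b.repr (∑ j, (a j : ℚ) • b j) i = a i := fun i => by rw [Basis.repr_sum_self]
    refine ⟨∑ j, (a j : ℚ) • b j, (hb _).2 fun i => by rw [e]; exact int_mem_ZZ _, ?_⟩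
    rw [key a _ e]; funext i; exact ha i
  choose M hM using fun i j => mem_ZZ.1 (hF.int (hbF i) (hbF j))
  have hβ : ∀ x ∈ F, ∀ y ∈ F, ∀ m : ℤ, C x y = m →
      Matrix.toBilin' (Matrix.of fun i j => (M i j : ZMod p)) (ρ x) (ρ y) = m := by
    intro x hx y hy m hm
    obtain ⟨a, ha⟩ := coo x hx
    obtain ⟨a', ha'⟩ := coo y hy
    have : m = ∑ i, ∑ j, a i * M i j * a' j := by
      have : (m : ℚ) = ∑ i, ∑ j, a i * M i j * a' j := by
        rw [← hm]
        conv_lhs => rw [← b.sum_repr x, ← b.sum_repr y]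
        simp only [map_sum, LinearMap.sum_apply, map_smul, LinearMap.smul_apply, smul_eq_mul, ha, ha', ← hM]
        push_cast
        rw [sum_comm]
        simp only [mul_sum]
        refine sum_congr rfl fun i _ => sum_congr rfl fun j _ => by ring
      exact_mod_cast this
    rw [key a x ha, key a' y ha', Matrix.toBilin'_apply, this]
    push_cast
    rfl
  have hs : ∀ x y, Matrix.toBilin' (Matrix.of fun i j => (M i j : ZMod p)) x y =
      Matrix.toBilin' (Matrix.of fun i j => (M i j : ZMod p)) y x := by
    intro x y
    obtain ⟨x, hx, rfl⟩ := sur x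
    obtain ⟨y, hy, rfl⟩ := sur y
    obtain ⟨m, hm⟩ := mem_ZZ.1 (hF.int hx hy)
    rw [hβ x hx y hy m hm.symm, hβ y hy x hx m (by rw [hF.symm, hm])]
  have hnd : ∀ x, (∀ y, Matrix.toBilin' (Matrix.of fun i j => (M i j : ZMod p)) y x = 0) → x = 0 := by
    intro x h
    obtain ⟨x, hx, rfl⟩ := sur x
    obtain ⟨a, ha⟩ := coo x hx
    funext i
    have := hβ (c i) (hcF i) x hx (a i) (by rw [hc, ha])
    rw [h] at this
    rw [key a x ha]; exact this.symm
  refine ⟨ρ, ?_, ?_, sur, ?_, _, ⟨?_, ?_⟩, hβ⟩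
  · intro x hx y hy
    obtain ⟨a, ha⟩ := coo x hx
    obtain ⟨a', ha'⟩ := coo y hy
    rw [key a x ha, key a' y ha', key (a + a') (x + y) (fun i => by simp [ha, ha'])]
    funext i; simp
  · intro x hx m
    obtain ⟨a, ha⟩ := coo x hx
    rw [key a x ha, key (fun i => m * a i) (m • x) (fun i => by
      rw [← Int.cast_smul_eq_zsmul ℚ, map_smul]; simp [ha])]
    funext i; simp
  · intro x hx h
    obtain ⟨a, ha⟩ := coo x hx
    rw [key a x ha] at h
    have : ∀ i, (p : ℤ) ∣ a i := fun i => (ZMod.intCast_zmod_eq_zero_iff_dvd _ p).1 (congrFun h i) 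
    choose d hd using this
    have e : ∀ i, b.repr (∑ j, (d j : ℚ) • b j) i = d i := fun i => by rw [Basis.repr_sum_self]
    refine ⟨∑ j, (d j : ℚ) • b j, (hb _).2 fun i => by rw [e]; exact int_mem_ZZ _, ?_⟩
    apply b.repr.injective
    ext i
    rw [← Int.cast_smul_eq_zsmul ℚ, map_smul, Finsupp.smul_apply, e, ha, hd]; simp
  · intro x h; exact hnd x (fun y => by rw [hs]; exact h y)
  · intro x h; exact hnd x h
theorem inter_span (F : Submodule ℤ Y) (hF : F.FG) (V : Submodule ℚ Y) [FiniteDimensional ℚ V] :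
    ∃ m, m ≤ finrank ℚ V ∧ ∃ w : Fin m → Y, (∀ i, w i ∈ F ∧ w i ∈ V) ∧
      ∀ x ∈ F, x ∈ V → ∃ a : Fin m → ℤ, x = ∑ i, a i • w i := by
  haveI : Module.IsTorsionFree ℤ Y := .trans_faithfulSMul ℤ ℚ Y
  set W := F ⊓ V.restrictScalars ℤ
  haveI : Module.Finite ℤ W := Module.Finite.iff_fg.2 (Submodule.FG.of_le hF inf_le_left)
  let b := Module.finBasis ℤ W
  refine ⟨_, ?_, fun i => (b i : Y), fun i => ⟨(b i).2.1, (b i).2.2⟩, fun x h1 h2 => ⟨b.repr ⟨x, h1, h2⟩, ?_⟩⟩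
  · have h1 : LinearIndependent ℤ (fun i => (b i : Y)) := by
      have := b.linearIndependent.map' W.subtype (by simp)
      exact this
    have h2 := (LinearIndependent.iff_fractionRing ℤ ℚ).1 h1
    have h3 : LinearIndependent ℚ (fun i => (⟨(b i : Y), (b i).2.2⟩ : V)) := by
      apply LinearIndependent.of_comp V.subtype
      exact h2
    simpa using h3.fintype_card_le_finrank
  · have := congrArg Subtype.val (b.sum_repr ⟨x, h1, h2⟩)
    simp only [Submodule.coe_sum, Submodule.coe_smul] at this
    exact this.symm
theorem shrink_b {C : Frm Y} {F Z : Submodule ℤ Y} (hF : SD C F) (p : ℕ) [Fact p.Prime] (V : Submodule ℚ Y)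
    (hV : 2 * finrank ℚ V ≤ finrank ℚ Y) (hZF : Z ≤ F)
    (hZ : ∀ x ∈ Z, ∀ y ∈ Z, ∃ m : ℤ, C x y = (p * m : ℤ)) (w0 : Y) (h1 : w0 ∈ Z) (h2 : w0 ∈ V)
    (h3 : ¬ ∃ f ∈ F, w0 = (p : ℤ) • f) : ∃ ξ ∈ F, ξ ∉ Z ⊔ (F ⊓ V.restrictScalars ℤ) := by
  haveI := hF.finite
  by_contra hcon
  push Not at hcon
  obtain ⟨ρ, radd, rsm, rsur, rker, β, hβ, hβC⟩ := red_exists hF p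
  let red : ∀ Z : Submodule ℤ Y, Z ≤ F → Submodule (ZMod p) (Fin (finrank ℚ Y) → ZMod p) := fun Z hZ =>
    { carrier := {t | ∃ z ∈ Z, ρ z = t}
      add_mem' := by
        rintro _ _ ⟨a, ha, rfl⟩ ⟨b, hb, rfl⟩
        exact ⟨a + b, add_mem ha hb, radd a (hZ ha) b (hZ hb)⟩
      zero_mem' := ⟨0, zero_mem _, by simpa using rsm 0 (zero_mem _) 0⟩
      smul_mem' := by
        rintro c _ ⟨a, ha, rfl⟩
        obtain ⟨m, rfl⟩ := ZMod.intCast_surjective c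
        exact ⟨m • a, Z.smul_mem m ha, rsm a (hZ ha) m⟩ }
  set Zb := red Z hZF
  set Wb := red (F ⊓ V.restrictScalars ℤ) inf_le_left
  have hsup : Zb ⊔ Wb = ⊤ := by
    rw [eq_top_iff]
    intro t _
    obtain ⟨x, hx, rfl⟩ := rsur t
    obtain ⟨z, hz, w, hw, rfl⟩ := Submodule.mem_sup.1 (hcon x hx)
    rw [radd z (hZF hz) w hw.1]
    exact Submodule.add_mem_sup ⟨z, hz, rfl⟩ ⟨w, hw, rfl⟩
  have hWb : finrank (ZMod p) Wb ≤ finrank ℚ V := by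
    obtain ⟨m, hm, w, hw, hspan⟩ := inter_span F hF.fg V
    have : Wb ≤ Submodule.span (ZMod p) (Set.range fun i => ρ (w i)) := by
      rintro _ ⟨x, hx, rfl⟩
      obtain ⟨a, rfl⟩ := hspan x hx.1 hx.2
      have : ∀ s : Finset (Fin m), ρ (∑ i ∈ s, a i • w i) ∈ Submodule.span (ZMod p) (Set.range fun i => ρ (w i)) := by
        intro s
        induction s using Finset.induction_on with
        | empty =>
          have : ρ 0 = 0 := by simpa using rsm 0 (zero_mem _) 0
          simp [this]
        | insert i s hi ih =>
          rw [sum_insert hi, radd _ (F.smul_mem _ (hw i).1) _ (sum_mem fun i _ => F.smul_mem _ (hw i).1), rsm _ (hw i).1]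
          exact add_mem (Submodule.smul_mem _ _ (Submodule.subset_span ⟨i, rfl⟩)) ih
      exact this _
    refine (Submodule.finrank_mono this).trans ((finrank_range_le_card _).trans ?_)
    simpa using hm
  have hZb : 2 * finrank (ZMod p) Zb ≤ finrank ℚ Y := by
    have h := LinearMap.BilinForm.finrank_orthogonal hβ Zb
    have hle : Zb ≤ β.orthogonal Zb := by
      rintro _ ⟨x, hx, rfl⟩ _ ⟨y, hy, rfl⟩
      obtain ⟨m, hm⟩ := hZ y hy x hx
      show β (ρ y) (ρ x) = 0
      rw [hβC y (hZF hy) x (hZF hx) _ hm]; simp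
    have := Submodule.finrank_mono hle
    rw [h] at this
    have h5 : finrank (ZMod p) (Fin (finrank ℚ Y) → ZMod p) = finrank ℚ Y := by simp
    have h6 := Submodule.finrank_le Zb
    omega
  have h4 := Submodule.finrank_sup_add_finrank_inf_eq Zb Wb
  rw [hsup, finrank_top] at h4
  have h5 : finrank (ZMod p) (Fin (finrank ℚ Y) → ZMod p) = finrank ℚ Y := by simp
  have h6 : 0 < finrank (ZMod p) (Zb ⊓ Wb : Submodule _ _) := by
    rw [Nat.pos_iff_ne_zero]
    intro h0
    rw [Submodule.finrank_eq_zero] at h0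
    have : ρ w0 ∈ Zb ⊓ Wb := ⟨⟨w0, h1, rfl⟩, ⟨w0, ⟨hZF h1, h2⟩, rfl⟩⟩
    rw [h0, Submodule.mem_bot] at this
    exact h3 (rker w0 (hZF h1) this)
  omega
theorem shrink_c {C : Frm Y} {F Z : Submodule ℤ Y} (hF : EU C F) (p : ℕ) [Fact p.Prime] (V : Submodule ℚ Y)
    (hV : 2 * finrank ℚ V ≤ finrank ℚ Y) (hZF : Z ≤ F) (hpF : ∀ f ∈ F, (p : ℤ) • f ∈ Z)
    (hZ : EU ((p : ℚ)⁻¹ • C) Z) (w0 : Y) (h1 : w0 ∈ Z) (h2 : w0 ∈ V)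
    (h3 : ¬ ∃ f ∈ F, w0 = (p : ℤ) • f) : ∃ Z', EU ((p : ℚ)⁻¹ • C) Z' ∧ Z' ≤ F ∧ (∀ f ∈ F, (p : ℤ) • f ∈ Z') ∧
      (∀ x ∈ Z', x ∈ V → x ∈ Z) ∧ w0 ∉ Z' := by
  have hp : p.Prime := Fact.out
  have hp0 : (p : ℚ) ≠ 0 := by exact_mod_cast hp.ne_zero
  have hint : ∀ x ∈ Z, ∀ y ∈ Z, ∃ m : ℤ, C x y = (p * m : ℤ) := by
    intro x hx y hy
    obtain ⟨m, hm⟩ := mem_ZZ.1 (hZ.int hx hy)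
    refine ⟨m, ?_⟩
    push_cast; rw [hm]
    simp only [LinearMap.smul_apply, smul_eq_mul]; field_simp
  obtain ⟨ξ1, hξ1, hξ1'⟩ := shrink_b hF.toSD p V hV hZF hint w0 h1 h2 h3
  obtain ⟨ξ2, hξ2, u2, hu2, hnd2⟩ : ∃ ξ ∈ F, ∃ u : ℤ, C ξ w0 = u ∧ ¬ (p : ℤ) ∣ u := by
    by_contra hcon
    push Not at hcon
    apply h3
    refine ⟨(p : ℚ)⁻¹ • w0, (hF.mem_iff _).2 fun y hy => ?_, ?_⟩
    · obtain ⟨u, hu⟩ := mem_ZZ.1 (hF.int hy (hZF h1))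
      obtain ⟨d, rfl⟩ := hcon y hy u hu.symm
      rw [mem_ZZ]
      refine ⟨d, ?_⟩
      rw [map_smul, LinearMap.smul_apply, hF.symm, ← hu, smul_eq_mul]
      push_cast; field_simp
    · rw [← Int.cast_smul_eq_zsmul ℚ, smul_smul]
      push_cast
      rw [mul_inv_cancel₀ hp0, one_smul]
  obtain ⟨u1, hu1⟩ := mem_ZZ.1 (hF.int hξ1 (hZF h1))
  obtain ⟨ξ, hξ, hξ', u, hu, hnd⟩ : ∃ ξ ∈ F, ξ ∉ Z ⊔ (F ⊓ V.restrictScalars ℤ) ∧ ∃ u : ℤ, C ξ w0 = u ∧ ¬ (p : ℤ) ∣ u := by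
    by_cases c1 : (p : ℤ) ∣ u1
    · by_cases c2 : ξ2 ∈ Z ⊔ (F ⊓ V.restrictScalars ℤ)
      · refine ⟨ξ1 + ξ2, add_mem hξ1 hξ2, fun h => hξ1' ?_, u1 + u2, by simp [← hu1, hu2], ?_⟩
        · have := sub_mem h c2; simpa using this
        · rwa [Int.dvd_add_right c1]
      · exact ⟨ξ2, hξ2, c2, u2, hu2, hnd2⟩
    · exact ⟨ξ1, hξ1, hξ1', u1, hu1.symm, c1⟩
  obtain ⟨m, hm⟩ := hF.even ξ hξ
  obtain ⟨q, hq⟩ := hZ.even w0 h1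
  have hq' : C w0 w0 = 2 * p * q := by
    rw [LinearMap.smul_apply, LinearMap.smul_apply, smul_eq_mul] at hq
    field_simp at hq; linarith
  obtain ⟨k, d, hkd⟩ : ∃ k d : ℤ, m + k * u = p * d := by
    have hco : IsCoprime (p : ℤ) u := (Nat.prime_iff_prime_int.1 hp).coprime_iff_not_dvd.2 hnd
    obtain ⟨s, t, hst⟩ := hco
    exact ⟨-m * t, m * s, by linear_combination (-m) * hst⟩
  set x := ξ + k • w0 with hx
  have hxF : x ∈ F := add_mem hξ (F.smul_mem _ (hZF h1))
  have hxZW : x ∉ Z ⊔ (F ⊓ V.restrictScalars ℤ) := fun h => hξ' (by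
    have := sub_mem h (Submodule.mem_sup_left (Z.smul_mem k h1)); simpa [hx] using this)
  have hxx : C x x = 2 * p * (d + k ^ 2 * q) := by
    have : (m : ℚ) + k * u = p * d := by exact_mod_cast hkd
    simp only [hx, map_add, LinearMap.add_apply, map_zsmul, LinearMap.smul_apply, hm, hu, hq', hF.symm w0 ξ, zsmul_eq_mul]
    linear_combination 2 * this
  have hxw : C x w0 = (u + 2 * p * k * q : ℤ) := by
    simp only [hx, map_add, LinearMap.add_apply, map_zsmul, LinearMap.smul_apply, hu, hq', zsmul_eq_mul]
    push_cast; ring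
  have hxw' : ¬ (p : ℤ) ∣ u + 2 * p * k * q := by
    rw [Int.dvd_add_left ⟨2 * k * q, by ring⟩]; exact hnd
  have hsq : ∀ a b : ℤ, ((p : ℚ)⁻¹ • C) (a • x) (b • x) = 2 * (a * b * (d + k ^ 2 * q) : ℤ) := by
    intro a b
    simp only [map_zsmul, LinearMap.smul_apply, zsmul_eq_mul, smul_eq_mul, hxx]
    push_cast; field_simp
  have pZ : ∀ a : ℤ, a • x ∈ Z ⊔ (F ⊓ V.restrictScalars ℤ) → (p : ℤ) ∣ a := by
    intro a ha
    by_contra hn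
    have hco : IsCoprime (p : ℤ) a := (Nat.prime_iff_prime_int.1 hp).coprime_iff_not_dvd.2 hn
    obtain ⟨s, t, hst⟩ := hco
    apply hxZW
    have : x = s • ((p : ℤ) • x) + t • (a • x) := by
      rw [smul_smul, smul_smul, ← add_smul, hst, one_smul]
    rw [this]
    exact add_mem (Submodule.smul_mem _ _ (Submodule.mem_sup_left (hpF x hxF))) (Submodule.smul_mem _ _ ha)
  set Z' := (Z ⊓ dual ((p : ℚ)⁻¹ • C) (Submodule.span ℤ {x})) ⊔ Submodule.span ℤ {x} with hZ'
  have hZ'V : ∀ y ∈ Z', y ∈ V → ∃ z ∈ Z, ∃ a : ℤ, y = z + ((p : ℤ) * a) • x ∧ ((p : ℚ)⁻¹ • C) z x ∈ ZZ := by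
    intro y hy hyV
    obtain ⟨z, hz, t, ht, rfl⟩ := Submodule.mem_sup.1 hy
    obtain ⟨a, rfl⟩ := Submodule.mem_span_singleton.1 ht
    have : a • x ∈ Z ⊔ (F ⊓ V.restrictScalars ℤ) := by
      have : a • x = -z + (z + a • x) := by abel
      rw [this]
      exact Submodule.add_mem_sup (neg_mem hz.1) ⟨add_mem (hZF hz.1) (F.smul_mem _ hxF), hyV⟩
    obtain ⟨e, rfl⟩ := pZ a this
    exact ⟨z, hz.1, e, rfl, hz.2 x (Submodule.mem_span_singleton_self x)⟩
  refine ⟨Z', hZ.transfer (Submodule.fg_span_singleton x) ?_ ?_, ?_, ?_, ?_, ?_⟩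
  · intro y hy z hz
    obtain ⟨a, rfl⟩ := Submodule.mem_span_singleton.1 hy
    obtain ⟨b, rfl⟩ := Submodule.mem_span_singleton.1 hz
    rw [hsq, mem_ZZ]; exact ⟨2 * (a * b * (d + k ^ 2 * q)), by push_cast; ring⟩
  · intro y hy
    obtain ⟨a, rfl⟩ := Submodule.mem_span_singleton.1 hy
    exact ⟨_, hsq a a⟩
  · refine sup_le (inf_le_left.trans hZF) ?_
    rw [Submodule.span_singleton_le_iff_mem]; exact hxF
  · intro f hf
    refine Submodule.mem_sup_left ⟨hpF f hf, ?_⟩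
    intro y hy
    obtain ⟨a, rfl⟩ := Submodule.mem_span_singleton.1 hy
    obtain ⟨c, hc⟩ := mem_ZZ.1 (hF.int hf hxF)
    rw [mem_ZZ]
    refine ⟨a * c, ?_⟩
    simp only [map_zsmul, LinearMap.smul_apply, zsmul_eq_mul, smul_eq_mul, ← hc]
    push_cast; field_simp
  · intro y hy hyV
    obtain ⟨z, hz, a, rfl, _⟩ := hZ'V y hy hyV
    rw [mul_smul]
    exact add_mem hz (hpF _ (F.smul_mem _ hxF))
  · intro hw
    obtain ⟨z, hz, a, e, hzx⟩ := hZ'V w0 hw h2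
    apply hxw'
    obtain ⟨c, hc⟩ := mem_ZZ.1 hzx
    have hc' : C z x = p * c := by
      rw [hc, LinearMap.smul_apply, LinearMap.smul_apply, smul_eq_mul]; field_simp
    refine ⟨c + a * (2 * p * (d + k ^ 2 * q)), ?_⟩
    have : C x w0 = p * (c + a * (2 * p * (d + k ^ 2 * q))) := by
      conv_lhs => rw [e]
      rw [map_add, map_zsmul, hF.symm x z, hc', hxx, zsmul_eq_mul]
      push_cast; ring
    rw [hxw] at this
    exact_mod_cast this
end
def gramQ {ι : Type} [Fintype ι] (G : Matrix ι ι ℤ) : Frm (ι → ℚ) :=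
  LinearMap.mk₂ ℚ (fun x y => ∑ i, ∑ j, (G i j : ℚ) * x i * y j)
    (fun x x' y => by simp only [← sum_add_distrib]; exact sum_congr rfl fun i _ => sum_congr rfl fun j _ => by simp; ring)
    (fun c x y => by simp only [smul_eq_mul, mul_sum]; exact sum_congr rfl fun i _ => sum_congr rfl fun j _ => by simp; ring)
    (fun x y y' => by simp only [← sum_add_distrib]; exact sum_congr rfl fun i _ => sum_congr rfl fun j _ => by simp; ring)
    (fun c x y => by simp only [smul_eq_mul, mul_sum]; exact sum_congr rfl fun i _ => sum_congr rfl fun j _ => by simp; ring)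
theorem gramQ_apply {ι : Type} [Fintype ι] (G : Matrix ι ι ℤ) (x y : ι → ℚ) :
    gramQ G x y = ∑ i, ∑ j, (G i j : ℚ) * x i * y j := rfl
def intL (ι : Type) : Submodule ℤ (ι → ℚ) where
  carrier := {x | ∀ i, x i ∈ ZZ}
  add_mem' := fun ha hb i => add_mem (ha i) (hb i)
  zero_mem' := fun _ => zero_mem _
  smul_mem' := fun c _ hx i => zsmul_ZZ c (hx i)
theorem mem_intL {ι : Type} {x : ι → ℚ} : x ∈ intL ι ↔ ∀ i, x i ∈ ZZ := Iff.rfl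
theorem intL_fg (ι : Type) [Fintype ι] : (intL ι).FG := by
  obtain ⟨D, h1, h2⟩ := int_vec_fg ι
  have : intL ι = D := by ext x; rw [h2]; rfl
  rw [this]; exact h1
theorem mem_intL' {ι : Type} {x : ι → ℚ} : x ∈ intL ι ↔ ∃ a : ι → ℤ, x = fun i => (a i : ℚ) := by
  constructor
  · intro h
    choose a ha using fun i => mem_ZZ.1 (h i)
    exact ⟨a, funext fun i => (ha i).symm⟩
  · rintro ⟨a, rfl⟩ i; exact int_mem_ZZ _
theorem gram_sd {ι : Type} [Fintype ι] [DecidableEq ι] (G H : Matrix ι ι ℤ) (hs : ∀ i j, G i j = G j i) (hGH : G * H = 1) :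
    SD (gramQ G) (intL ι) := by
  have hsy : ∀ x y, gramQ G x y = gramQ G y x := by
    intro x y
    rw [gramQ_apply, gramQ_apply, sum_comm]
    exact sum_congr rfl fun i _ => sum_congr rfl fun j _ => by rw [hs]; ring
  refine ⟨hsy, intL_fg ι, fun x => ⟨?_, ?_⟩⟩
  · intro hx y hy
    rw [gramQ_apply]
    exact sum_mem fun i _ => sum_mem fun j _ => mul_mem (mul_mem (int_mem_ZZ _) (hx i)) (hy j)
  · intro hx k
    have := hx (fun j => (H j k : ℚ)) (fun j => int_mem_ZZ _)
    have e : gramQ G x (fun j => (H j k : ℚ)) = x k := by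
      rw [gramQ_apply]
      have : ∀ i, ∑ j, (G i j : ℚ) * x i * (H j k : ℚ) = if i = k then x i else 0 := by
        intro i
        have h1 : (((G * H) i k : ℤ) : ℚ) = ∑ j, (G i j : ℚ) * H j k := by
          rw [Matrix.mul_apply]; push_cast; rfl
        rw [hGH, Matrix.one_apply] at h1
        have : ∑ j, (G i j : ℚ) * x i * (H j k : ℚ) = x i * ∑ j, (G i j : ℚ) * H j k := by
          rw [mul_sum]; exact sum_congr rfl fun j _ => by ring
        rw [this, ← h1]; split_ifs <;> simp
      simp [this]
    rwa [e] at this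
theorem even_sum {ι : Type} [Fintype ι] [DecidableEq ι] (G : Matrix ι ι ℤ) (hs : ∀ i j, G i j = G j i) (he : ∀ i, Even (G i i))
    (a : ι → ℤ) : Even (∑ i, ∑ j, G i j * a i * a j) := by
  rw [← ZMod.intCast_eq_zero_iff_even]
  push_cast
  rw [← Finset.sum_product']
  apply Finset.sum_involution (fun p _ => (p.2, p.1))
  · rintro ⟨i, j⟩ _
    simp only
    rw [hs j i]
    have : (2 : ZMod 2) = 0 := rfl
    linear_combination (G i j * a i * a j : ZMod 2) * this
  · rintro ⟨i, j⟩ _ h1 h2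
    simp only [Prod.mk.injEq] at h2
    apply h1
    obtain ⟨rfl, _⟩ := h2
    rw [(ZMod.intCast_eq_zero_iff_even).2 (he _)]; simp
  · intro _ _; exact mem_univ _
  · intro _ _; rfl
theorem gram_eu {ι : Type} [Fintype ι] [DecidableEq ι] (G H : Matrix ι ι ℤ) (hs : ∀ i j, G i j = G j i) (hGH : G * H = 1)
    (he : ∀ i, Even (G i i)) : EU (gramQ G) (intL ι) := by
  refine ⟨gram_sd G H hs hGH, fun x hx => ?_⟩
  obtain ⟨a, rfl⟩ := mem_intL'.1 hx
  obtain ⟨n, hn⟩ := even_sum G hs he a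
  refine ⟨n, ?_⟩
  rw [gramQ_apply]
  have : ((∑ i, ∑ j, G i j * a i * a j : ℤ) : ℚ) = 2 * n := by rw [hn]; push_cast; ring
  rw [← this]; push_cast; rfl
def E8I : Matrix (Fin 8) (Fin 8) ℤ :=
  !![4, 5, 7, 10, 8, 6, 4, 2;
5, 8, 10, 15, 12, 9, 6, 3;
7, 10, 14, 20, 16, 12, 8, 4;
10, 15, 20, 30, 24, 18, 12, 6;
8, 12, 16, 24, 20, 15, 10, 5;
6, 9, 12, 18, 15, 12, 8, 4;
4, 6, 8, 12, 10, 8, 6, 3;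
2, 3, 4, 6, 5, 4, 3, 2]
theorem e8_inv : E8M * E8I = 1 := by decide +kernel
theorem e8_symm (i j : Fin 8) : E8M i j = E8M j i := by
  have h : E8M.transpose = E8M := by decide +kernel
  exact congrFun (congrFun h j) i
theorem e8_eu : EU (gramQ E8M) (intL (Fin 8)) :=
  gram_eu E8M E8I e8_symm e8_inv (by decide +kernel)
theorem e8_pos (x : Fin 8 → ℚ) (hx : x ≠ 0) : 0 < gramQ E8M x x := by
  have e : gramQ E8M x x = 2 * (x 0 - 1/2 * x 2)^2 + 2 * (x 1 - 1/2 * x 3)^2 + 3/2 * (x 2 - 2/3 * x 3)^2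
      + 5/6 * (x 3 - 6/5 * x 4)^2 + 4/5 * (x 4 - 5/4 * x 5)^2 + 3/4 * (x 5 - 4/3 * x 6)^2 + 2/3 * (x 6 - 3/2 * x 7)^2
      + 1/2 * (x 7)^2 := by
    rw [gramQ_apply]
    simp [Fin.sum_univ_eight, E8M]
    ring
  have h0 := sq_nonneg (x 0 - 1/2 * x 2)
  have h1 := sq_nonneg (x 1 - 1/2 * x 3)
  have h2 := sq_nonneg (x 2 - 2/3 * x 3)
  have h3 := sq_nonneg (x 3 - 6/5 * x 4)
  have h4 := sq_nonneg (x 4 - 5/4 * x 5)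
  have h5 := sq_nonneg (x 5 - 4/3 * x 6)
  have h6 := sq_nonneg (x 6 - 3/2 * x 7)
  have h7 := sq_nonneg (x 7)
  by_contra hcon
  rw [e] at hcon
  apply hx
  have g7 : x 7 = 0 := pow_eq_zero_iff two_ne_zero |>.1 (by linarith)
  have g6 : x 6 - 3/2 * x 7 = 0 := pow_eq_zero_iff two_ne_zero |>.1 (by linarith)
  have g5 : x 5 - 4/3 * x 6 = 0 := pow_eq_zero_iff two_ne_zero |>.1 (by linarith)
  have g4 : x 4 - 5/4 * x 5 = 0 := pow_eq_zero_iff two_ne_zero |>.1 (by linarith)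
  have g3 : x 3 - 6/5 * x 4 = 0 := pow_eq_zero_iff two_ne_zero |>.1 (by linarith)
  have g2 : x 2 - 2/3 * x 3 = 0 := pow_eq_zero_iff two_ne_zero |>.1 (by linarith)
  have g1 : x 1 - 1/2 * x 3 = 0 := pow_eq_zero_iff two_ne_zero |>.1 (by linarith)
  have g0 : x 0 - 1/2 * x 2 = 0 := pow_eq_zero_iff two_ne_zero |>.1 (by linarith)
  funext i
  fin_cases i <;> simp <;> linarith
theorem e8_cl : HasCl (gramQ E8M) 8 := by
  have := posdef_cl e8_eu.toSD e8_pos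
  simpa using this
section
variable {Y : Type} [AddCommGroup Y] [Module ℚ Y]
theorem exists_eu8 {C : Frm Y} (h : HasCl C 8) : ∃ L, EU C L := by
  obtain ⟨L, hL⟩ := (h.isom e8_cl).lat (intL (Fin 8))
  exact ⟨L, hL.symm.eu e8_eu⟩
theorem cl8_smul {C : Frm Y} (h : HasCl C 8) (c : ℚ) (hc : 0 < c) : HasCl (c • C) 8 := by
  have := h.smul hc.ne'
  rwa [show br c * 8 = 8 by linear_combination 2 * four_br hc] at this
theorem shrink_d {C : Frm Y} (hC : HasCl C 8) {F : Submodule ℤ Y} (hF : EU C F) (p : ℕ) [Fact p.Prime] (V : Submodule ℚ Y)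
    (hV : 2 * finrank ℚ V ≤ finrank ℚ Y) : ∃ Z, EU ((p : ℚ)⁻¹ • C) Z ∧ ∀ x ∈ Z, x ∈ V → ∃ f ∈ F, x = (p : ℤ) • f := by
  have hp : p.Prime := Fact.out
  have hp0 : (p : ℚ) ≠ 0 := by exact_mod_cast hp.ne_zero
  obtain ⟨Z0, hZ0⟩ := exists_eu8 (cl8_smul hC (p : ℚ)⁻¹ (by have := hp.pos; positivity))
  obtain ⟨ρ, radd, rsm, -, rker, -⟩ := red_exists hF.toSD p
  have init : ∃ Z, EU ((p : ℚ)⁻¹ • C) Z ∧ Z ≤ F ∧ ∀ f ∈ F, (p : ℤ) • f ∈ Z := by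
    let D : Submodule ℤ Y := F.map (LinearMap.lsmul ℤ Y (p : ℤ))
    have hD : ∀ x, x ∈ D ↔ ∃ f ∈ F, (p : ℤ) • f = x := fun x => Submodule.mem_map
    refine ⟨_, hZ0.transfer (D := D) (hF.fg.map _) ?_ ?_, ?_, ?_⟩
    · intro x hx y hy
      obtain ⟨f, hf, rfl⟩ := (hD _).1 hx
      obtain ⟨g, hg, rfl⟩ := (hD _).1 hy
      obtain ⟨c, hc⟩ := mem_ZZ.1 (hF.int hf hg)
      rw [mem_ZZ]
      refine ⟨p * c, ?_⟩
      simp only [map_zsmul, LinearMap.smul_apply, zsmul_eq_mul, smul_eq_mul, ← hc]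
      push_cast; field_simp
    · intro x hx
      obtain ⟨f, hf, rfl⟩ := (hD _).1 hx
      obtain ⟨c, hc⟩ := hF.even f hf
      refine ⟨p * c, ?_⟩
      simp only [map_zsmul, LinearMap.smul_apply, zsmul_eq_mul, smul_eq_mul, hc]
      push_cast; field_simp
    · refine sup_le ?_ ?_
      · rintro x ⟨_, hx⟩
        rw [hF.mem_iff]
        intro f hf
        have := hx ((p : ℤ) • f) ((hD _).2 ⟨f, hf, rfl⟩)
        rw [map_zsmul, LinearMap.smul_apply, LinearMap.smul_apply, zsmul_eq_mul, smul_eq_mul] at this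
        push_cast at this
        rwa [mul_inv_cancel_left₀ hp0] at this
      · intro x hx
        obtain ⟨f, hf, rfl⟩ := (hD _).1 hx
        exact F.smul_mem _ hf
    · intro f hf
      exact Submodule.mem_sup_right ((hD _).2 ⟨f, hf, rfl⟩)
  have step : ∀ n : ℕ, ∀ Z, EU ((p : ℚ)⁻¹ • C) Z → Z ≤ F → (∀ f ∈ F, (p : ℤ) • f ∈ Z) →
      Set.ncard (ρ '' {x | x ∈ Z ∧ x ∈ V}) ≤ n → ∃ Z, EU ((p : ℚ)⁻¹ • C) Z ∧ ∀ x ∈ Z, x ∈ V → ∃ f ∈ F, x = (p : ℤ) • f := by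
    intro n
    induction n with
    | zero =>
      intro Z hZ hZF hp hn
      exfalso
      have : (ρ '' {x | x ∈ Z ∧ x ∈ V}) = ∅ := by
        rw [← Set.ncard_eq_zero (Set.toFinite _)]; omega
      have h0 : ρ 0 ∈ (ρ '' {x | x ∈ Z ∧ x ∈ V}) := ⟨0, ⟨zero_mem _, zero_mem _⟩, rfl⟩
      rw [this] at h0; exact h0
    | succ n ih =>
      intro Z hZ hZF hpZ hn
      by_cases hall : ∀ x ∈ Z, x ∈ V → ∃ f ∈ F, x = (p : ℤ) • f
      · exact ⟨Z, hZ, hall⟩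
      · push Not at hall
        obtain ⟨w0, h1, h2, h3⟩ := hall
        obtain ⟨Z', hZ', hZ'F, hpZ', hsub, hw0⟩ := shrink_c hF p V hV hZF hpZ hZ w0 h1 h2 (by push Not; exact h3)
        apply ih Z' hZ' hZ'F hpZ'
        have : ρ '' {x | x ∈ Z' ∧ x ∈ V} ⊂ ρ '' {x | x ∈ Z ∧ x ∈ V} := by
          refine ⟨?_, fun hss => ?_⟩
          · rintro _ ⟨x, ⟨hx, hxV⟩, rfl⟩
            exact ⟨x, ⟨hsub x hx hxV, hxV⟩, rfl⟩
          · obtain ⟨x, ⟨hx, hxV⟩, hxw⟩ := hss ⟨w0, ⟨h1, h2⟩, rfl⟩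
            have e : ρ (w0 + (-1 : ℤ) • x) = 0 := by
              rw [radd _ (hZF h1) _ (F.smul_mem _ (hZ'F hx)), rsm _ (hZ'F hx), hxw]; simp
            obtain ⟨f, hf, hf'⟩ := rker _ (add_mem (hZF h1) (F.smul_mem _ (hZ'F hx))) e
            apply hw0
            have : w0 = (p : ℤ) • f + x := by rw [← hf']; simp
            rw [this]
            exact add_mem (hpZ' f hf) hx
        have := Set.ncard_lt_ncard this (Set.toFinite _)
        omega
  obtain ⟨Z, h1, h2, h3⟩ := init
  exact step _ Z h1 h2 h3 le_rfl
theorem shrink_e {C : Frm Y} (hC : HasCl C 8) {F : Submodule ℤ Y} (hF : EU C F) (p : ℕ) (hp : p.Prime) (V : Submodule ℚ Y)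
    (hV : 2 * finrank ℚ V ≤ finrank ℚ Y) : ∃ F', EU C F' ∧ ∀ x ∈ F', x ∈ V → ∃ f ∈ F, x = (p : ℤ) • f := by
  haveI : Fact p.Prime := ⟨hp⟩
  have hp0 : (p : ℚ) ≠ 0 := by exact_mod_cast hp.ne_zero
  obtain ⟨Z, hZ, h1⟩ := shrink_d hC hF p V hV
  obtain ⟨Z2, hZ2, h2⟩ := shrink_d (cl8_smul hC (p : ℚ)⁻¹ (by have := hp.pos; positivity)) hZ p V hV
  let e : Y ≃ₗ[ℚ] Y := LinearEquiv.smulOfNeZero ℚ Y (p : ℚ)⁻¹ (by positivity)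
  have he : ∀ x, e x = (p : ℚ)⁻¹ • x := fun x => rfl
  have hiso : LatIso ((p : ℚ)⁻¹ • (p : ℚ)⁻¹ • C) Z2 C (Z2.comap (e.symm.toLinearMap.restrictScalars ℤ)) := by
    refine ⟨e, fun x y => ?_, fun x => ?_⟩
    · simp only [he, map_smul, LinearMap.smul_apply, smul_eq_mul]
    · simp
  refine ⟨_, hiso.eu hZ2, fun x hx hxV => ?_⟩
  have hx' : (p : ℤ) • x ∈ Z2 := by
    have hx2 : e.symm x ∈ Z2 := hx
    have : e.symm x = (p : ℤ) • x := by
      apply e.injective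
      rw [e.apply_symm_apply, he, ← Int.cast_smul_eq_zsmul ℚ, smul_smul]
      push_cast
      rw [inv_mul_cancel₀ hp0, one_smul]
    rwa [this] at hx2
  haveI : Module.IsTorsionFree ℤ Y := .trans_faithfulSMul ℤ ℚ Y
  have hpz : (p : ℤ) ≠ 0 := by exact_mod_cast hp.ne_zero
  obtain ⟨f, hf, hff⟩ := h2 _ hx' ((V.restrictScalars ℤ).smul_mem _ hxV)
  have : x = f := smul_right_injective Y hpz hff
  rw [this] at hxV ⊢
  exact h1 f hf hxV
theorem shrink {C : Frm Y} (hC : HasCl C 8) {F : Submodule ℤ Y} (hF : EU C F) (V : Submodule ℚ Y)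
    (hV : 2 * finrank ℚ V ≤ finrank ℚ Y) (k : ℕ) (hk : k ≠ 0) :
    ∃ F', EU C F' ∧ ∀ x ∈ F', x ∈ V → ∃ f ∈ F, x = (k : ℤ) • f := by
  haveI : Module.IsTorsionFree ℤ Y := .trans_faithfulSMul ℤ ℚ Y
  induction k using induction_on_primes generalizing F with
  | zero => exact absurd rfl hk
  | one => exact ⟨F, hF, fun x hx _ => ⟨x, hx, by simp⟩⟩
  | prime_mul p a hp ih =>
    have ha : a ≠ 0 := by rintro rfl; simp at hk
    obtain ⟨F1, hF1, h1⟩ := ih hF ha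
    obtain ⟨F2, hF2, h2⟩ := shrink_e hC hF1 p hp V hV
    refine ⟨F2, hF2, fun x hx hxV => ?_⟩
    obtain ⟨f, hf, rfl⟩ := h2 x hx hxV
    have hfV : f ∈ V := by
      have hp0 : (p : ℚ) ≠ 0 := by exact_mod_cast hp.ne_zero
      have := V.smul_mem (p : ℚ)⁻¹ hxV
      rwa [← Int.cast_smul_eq_zsmul ℚ, smul_smul, Int.cast_natCast, inv_mul_cancel₀ hp0, one_smul] at this
    obtain ⟨g, hg, rfl⟩ := h1 f hf hfV
    exact ⟨g, hg, by rw [smul_smul]; push_cast; rfl⟩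
end
theorem extend_fun {L : Type*} [AddCommGroup L] [Module.Finite ℤ L] (K : Submodule ℤ L)
    (hsat : ∀ k : ℤ, k ≠ 0 → ∀ x, k • x ∈ K → x ∈ K) (f : K →ₗ[ℤ] ℤ) : ∃ g : L →ₗ[ℤ] ℤ, ∀ x : K, g x = f x := by
  haveI : Module.IsTorsionFree ℤ (L ⧸ K) := by
    refine ⟨fun k hk => ?_⟩
    have hk0 : k ≠ 0 := hk.ne_zero
    have : Function.Injective (LinearMap.lsmul ℤ (L ⧸ K) k) := by
      rw [← LinearMap.ker_eq_bot, LinearMap.ker_eq_bot']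
      intro q hq
      obtain ⟨x, rfl⟩ := K.mkQ_surjective q
      rw [LinearMap.lsmul_apply, ← map_smul, Submodule.mkQ_apply, Submodule.Quotient.mk_eq_zero] at hq
      rw [Submodule.mkQ_apply, Submodule.Quotient.mk_eq_zero]
      exact hsat k hk0 x hq
    exact this
  haveI : Module.Free ℤ (L ⧸ K) := inferInstance
  obtain ⟨s, hs⟩ := Module.projective_lifting_property K.mkQ LinearMap.id K.mkQ_surjective
  have hmem : ∀ x, x - s (K.mkQ x) ∈ K := by
    intro x
    have := LinearMap.congr_fun hs (K.mkQ x)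
    rw [LinearMap.comp_apply, LinearMap.id_apply] at this
    rw [← Submodule.Quotient.mk_eq_zero, ← Submodule.mkQ_apply, map_sub, this, sub_self]
  refine ⟨f ∘ₗ LinearMap.codRestrict K (LinearMap.id - s ∘ₗ K.mkQ) hmem, fun x => ?_⟩
  rw [LinearMap.comp_apply]
  congr 1
  apply Subtype.ext
  have : K.mkQ (x : L) = 0 := by simp
  rw [LinearMap.codRestrict_apply, LinearMap.sub_apply, LinearMap.comp_apply, this]; simp
section
variable {X Y : Type} [AddCommGroup X] [Module ℚ X] [AddCommGroup Y] [Module ℚ Y]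
theorem SD.scale {C : Frm Y} {L : Submodule ℤ Y} (h : SD C L) (x : Y) : ∃ m : ℕ, m ≠ 0 ∧ m • x ∈ L := by
  have hx : x ∈ Submodule.span ℚ (L : Set Y) := by rw [h.span]; trivial
  induction hx using Submodule.span_induction with
  | mem x hx => exact ⟨1, one_ne_zero, by simpa using hx⟩
  | zero => exact ⟨1, one_ne_zero, by simp⟩
  | add x y _ _ hx hy =>
    obtain ⟨m, hm, h1⟩ := hx
    obtain ⟨n, hn, h2⟩ := hy
    refine ⟨m * n, mul_ne_zero hm hn, ?_⟩
    rw [smul_add]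
    refine add_mem ?_ ?_
    · rw [mul_comm, mul_smul]; exact L.smul_of_tower_mem n h1
    · rw [mul_smul]; exact L.smul_of_tower_mem m h2
  | smul a x _ hx =>
    obtain ⟨m, hm, h1⟩ := hx
    refine ⟨a.den * m, mul_ne_zero a.den_nz hm, ?_⟩
    have : (a.den * m) • a • x = a.num • (m • x) := by
      rw [← Nat.cast_smul_eq_nsmul ℚ, ← Nat.cast_smul_eq_nsmul ℚ, ← Int.cast_smul_eq_zsmul ℚ, smul_smul, smul_smul]
      congr 1
      push_cast
      nth_rw 2 [← Rat.num_div_den a]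
      have : (a.den : ℚ) ≠ 0 := by exact_mod_cast a.den_nz
      field_simp
    rw [this]
    exact L.smul_mem _ h1
theorem EU.reduce {C : Frm Y} {B : Frm X} {L : Submodule ℤ Y} (h : EU C L) (P : Submodule ℚ Y) (π : Y →ₗ[ℚ] X)
    (hiso : ∀ x ∈ P, ∀ y ∈ P, B (π x) (π y) = C x y) (hsur : ∀ x, ∃ y ∈ P, π y = x)
    (hP : ∀ y, (∀ x ∈ P, C y x = 0) → y ∈ P ∧ π y = 0) :
    EU B ((L ⊓ P.restrictScalars ℤ).map (π.restrictScalars ℤ)) := by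
  have hm : ∀ x, x ∈ (L ⊓ P.restrictScalars ℤ).map (π.restrictScalars ℤ) ↔ ∃ l ∈ L, l ∈ P ∧ π l = x := by
    intro x
    rw [Submodule.mem_map]
    constructor
    · rintro ⟨l, ⟨h1, h2⟩, h3⟩; exact ⟨l, h1, h2, h3⟩
    · rintro ⟨l, h1, h2, h3⟩; exact ⟨l, ⟨h1, h2⟩, h3⟩
  refine ⟨⟨?_, ?_, ?_⟩, ?_⟩
  · intro x y
    obtain ⟨x, hx, rfl⟩ := hsur x
    obtain ⟨y, hy, rfl⟩ := hsur y
    rw [hiso x hx y hy, hiso y hy x hx, h.symm]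
  · exact (Submodule.FG.of_le h.fg inf_le_left).map _
  · intro x
    constructor
    · intro hx y hy
      obtain ⟨l, h1, h2, rfl⟩ := (hm x).1 hx
      obtain ⟨l', h1', h2', rfl⟩ := (hm y).1 hy
      rw [hiso l h2 l' h2']
      exact h.int h1 h1'
    · intro hx
      obtain ⟨y, hy, rfl⟩ := hsur x
      have hyl : ∀ l ∈ L, l ∈ P → C y l ∈ ZZ := by
        intro l h1 h2
        rw [← hiso y hy l h2]
        exact hx _ ((hm _).2 ⟨l, h1, h2, rfl⟩)
      haveI : Module.Finite ℤ L := Module.Finite.iff_fg.2 h.fg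
      let K : Submodule ℤ L := (P.restrictScalars ℤ).comap L.subtype
      have hK : ∀ l : L, l ∈ K ↔ (l : Y) ∈ P := fun l => Iff.rfl
      choose f hf using fun l : K => mem_ZZ.1 (hyl l.1 l.1.2 l.2)
      obtain ⟨g, hg⟩ := extend_fun K (fun k hk x hx => by
          rw [hK] at hx ⊢
          have hk' : (k : ℚ) ≠ 0 := by exact_mod_cast hk
          have := P.smul_mem (k : ℚ)⁻¹ hx
          rwa [Submodule.coe_smul, ← Int.cast_smul_eq_zsmul ℚ, smul_smul, inv_mul_cancel₀ hk', one_smul] at this)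
        { toFun := f
          map_add' := fun a b => by
            have : ((f (a + b) : ℤ) : ℚ) = f a + f b := by simp [hf]
            exact_mod_cast this
          map_smul' := fun c a => by
            have : ((f (c • a) : ℤ) : ℚ) = c * f a := by simp [hf]
            simpa using (by exact_mod_cast this : f (c • a) = c * f a) }
      obtain ⟨l0, hl0, hl⟩ := h.repr g
      have h0 : ∀ x ∈ P, C (y - l0) x = 0 := by
        intro x hxP
        obtain ⟨m, hm0, hmx⟩ := h.scale x
        have h1 := hl ⟨m • x, hmx⟩
        have hmP : m • x ∈ P := P.smul_of_tower_mem m hxP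
        have h2 := hg ⟨⟨m • x, hmx⟩, hmP⟩
        rw [h2] at h1
        have h3 := hf ⟨⟨m • x, hmx⟩, hmP⟩
        have h4 : C l0 (m • x) = C y (m • x) := by rw [← h3]; exact h1
        have h5 : C (y - l0) (m • x) = 0 := by rw [map_sub, LinearMap.sub_apply, h4, sub_self]
        rw [map_nsmul, nsmul_eq_mul] at h5
        have hm' : (m : ℚ) ≠ 0 := by exact_mod_cast hm0
        simpa [hm'] using h5
      obtain ⟨h1, h2⟩ := hP _ h0
      rw [hm]
      refine ⟨l0, hl0, ?_, ?_⟩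
      · have := P.sub_mem hy h1; simpa using this
      · rw [map_sub, sub_eq_zero] at h2; exact h2.symm
  · intro x hx
    obtain ⟨l, h1, h2, rfl⟩ := (hm x).1 hx
    rw [hiso l h2 l h2]
    exact h.even l h1
def uF : Frm (ℚ × ℚ) := LinearMap.mk₂ ℚ (fun x y => x.1 * y.2 + x.2 * y.1)
  (fun x x' y => by simp; ring) (fun c x y => by simp; ring) (fun x y y' => by simp; ring) (fun c x y => by simp; ring)
@[simp] theorem uF_apply (x y : ℚ × ℚ) : uF x y = x.1 * y.2 + x.2 * y.1 := rfl
def uL : Submodule ℤ (ℚ × ℚ) where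
  carrier := {x | x.1 ∈ ZZ ∧ x.2 ∈ ZZ}
  add_mem' := fun h h' => ⟨add_mem h.1 h'.1, add_mem h.2 h'.2⟩
  zero_mem' := ⟨zero_mem _, zero_mem _⟩
  smul_mem' := fun c _ h => ⟨zsmul_ZZ c h.1, zsmul_ZZ c h.2⟩
theorem mem_uL {x : ℚ × ℚ} : x ∈ uL ↔ x.1 ∈ ZZ ∧ x.2 ∈ ZZ := Iff.rfl
theorem uL_eu : EU uF uL := by
  refine ⟨⟨fun x y => by simp; ring, ?_, ?_⟩, ?_⟩
  · refine ⟨{(1, 0), (0, 1)}, le_antisymm ?_ ?_⟩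
    · rw [Submodule.span_le]
      intro x hx
      simp at hx
      rcases hx with rfl | rfl
      exacts [⟨one_mem _, zero_mem _⟩, ⟨zero_mem _, one_mem _⟩]
    · rintro ⟨a, b⟩ ⟨h1, h2⟩
      obtain ⟨m, rfl⟩ := mem_ZZ.1 h1
      obtain ⟨n, rfl⟩ := mem_ZZ.1 h2
      have : ((m : ℚ), (n : ℚ)) = m • ((1 : ℚ), (0 : ℚ)) + n • ((0 : ℚ), (1 : ℚ)) := by simp
      rw [this]
      exact add_mem (Submodule.smul_mem _ _ (Submodule.subset_span (by simp))) (Submodule.smul_mem _ _ (Submodule.subset_span (by simp)))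
  · intro x
    constructor
    · intro hx y hy
      exact add_mem (mul_mem hx.1 hy.2) (mul_mem hx.2 hy.1)
    · intro hx
      have h1 := hx (0, 1) ⟨zero_mem _, one_mem _⟩
      have h2 := hx (1, 0) ⟨one_mem _, zero_mem _⟩
      simp only [uF_apply, mul_one, mul_zero, add_zero, zero_add] at h1 h2
      exact ⟨h1, h2⟩
  · rintro ⟨a, b⟩ ⟨h1, h2⟩
    obtain ⟨m, rfl⟩ := mem_ZZ.1 h1
    obtain ⟨n, rfl⟩ := mem_ZZ.1 h2
    exact ⟨m * n, by simp; ring⟩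
theorem EU.split {C : Frm Y} {B : Frm X} {M : Submodule ℤ Y} (h : EU C M) (u w : Y) (hu : u ∈ M) (hw : w ∈ M)
    (huu : C u u = 0) (huw : C u w = 1) (π : Y →ₗ[ℚ] X)
    (hiso : ∀ x y, C x u = 0 → C y u = 0 → B (π x) (π y) = C x y) (hsur : ∀ x, ∃ y, C y u = 0 ∧ π y = x)
    (hπu : π u = 0) (K : Submodule ℤ X) (hK : ∀ x, x ∈ K ↔ ∃ l ∈ M, C l u = 0 ∧ π l = x) :
    EU B K ∧ LatIso C M (prodF B uF) (K.prod uL) := by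
  let P : Submodule ℚ Y := LinearMap.ker (C.flip u)
  have hPm : ∀ x, x ∈ P ↔ C x u = 0 := fun x => by simp [P]
  have hperp : ∀ y, (∀ x, C x u = 0 → C y x = 0) → y = C y w • u := by
    intro y hy
    rw [← sub_eq_zero]
    apply h.nondeg
    intro z
    have h1 := hy (z - C z u • w) (by simp [h.symm w u, huw])
    have h2 := h.symm z u
    simp only [map_sub, map_smul, LinearMap.sub_apply, LinearMap.smul_apply, smul_eq_mul] at h1 ⊢
    rw [h2] at h1; linarith
  constructor
  · have hK' : K = (M ⊓ P.restrictScalars ℤ).map (π.restrictScalars ℤ) := by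
      ext x
      rw [hK, Submodule.mem_map]
      constructor
      · rintro ⟨l, h1, h2, h3⟩; exact ⟨l, ⟨h1, (hPm l).2 h2⟩, h3⟩
      · rintro ⟨l, ⟨h1, h2⟩, h3⟩; exact ⟨l, h1, (hPm l).1 h2, h3⟩
    rw [hK']
    apply h.reduce
    · intro x hx y hy; exact hiso x y ((hPm x).1 hx) ((hPm y).1 hy)
    · intro x
      obtain ⟨y, h1, h2⟩ := hsur x
      exact ⟨y, (hPm y).2 h1, h2⟩
    · intro y hy
      have := hperp y (fun x hx => hy x ((hPm x).2 hx))
      rw [this, hPm]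
      simp [huu, hπu]
  · obtain ⟨k, hk⟩ := h.even w hw
    set w' := w - (k : ℚ) • u with hw'
    have hw'M : w' ∈ M := by
      rw [hw', Int.cast_smul_eq_zsmul]; exact sub_mem hw (M.smul_mem _ hu)
    have hwu : C w u = 1 := by rw [h.symm, huw]
    have huw' : C u w' = 1 := by simp [hw', huu, huw]
    have hwu' : C w' u = 1 := by rw [h.symm, huw']
    have hww' : C w' w' = 0 := by simp [hw', huu, huw, hwu, hk]; ring
    let y0 : Y → Y := fun y => y - C y w' • u - C y u • w'
    have hy0 : ∀ y, C (y0 y) u = 0 := fun y => by simp [y0, huu, hwu']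
    have hy0w : ∀ y, C (y0 y) w' = 0 := fun y => by simp [y0, huw', hww']
    let Φ : Y →ₗ[ℚ] X × (ℚ × ℚ) := (π ∘ₗ (LinearMap.id - (C.flip u).smulRight w')).prod ((C.flip w').prod (C.flip u))
    have hΦ : ∀ y, Φ y = (π (y0 y), (C y w', C y u)) := by
      intro y
      simp [Φ, y0, hπu]
    have hΦi : ∀ x y, prodF B uF (Φ x) (Φ y) = C x y := by
      intro x y
      rw [hΦ, hΦ, prodF_apply, uF_apply]
      simp only
      rw [hiso _ _ (hy0 x) (hy0 y)]
      simp only [y0, map_sub, map_smul, LinearMap.sub_apply, LinearMap.smul_apply, smul_eq_mul, huu, huw', hwu', hww', h.symm u y, h.symm w' y]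
      ring
    have inj : Function.Injective Φ := by
      rw [← LinearMap.ker_eq_bot, LinearMap.ker_eq_bot']
      intro x hx
      apply h.nondeg
      intro y
      rw [← hΦi, hx]; simp
    have sur : Function.Surjective Φ := by
      rintro ⟨x, α, β⟩
      obtain ⟨p, hp, rfl⟩ := hsur x
      refine ⟨p - C p w' • u + α • u + β • w', ?_⟩
      rw [hΦ]
      ext
      · simp [y0, hp, huu, huw', hwu', hww', hπu]
      · simp [huw', hww']
      · simp [hp, huu, hwu']
    have bij : Function.Bijective Φ := ⟨inj, sur⟩
    refine ⟨LinearEquiv.ofBijective Φ bij, hΦi, fun y => ?_⟩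
    change y ∈ M ↔ Φ y ∈ K.prod uL
    rw [hΦ]
    constructor
    · intro hy
      obtain ⟨a, ha⟩ := mem_ZZ.1 (h.int hy hw'M)
      obtain ⟨b, hb⟩ := mem_ZZ.1 (h.int hy hu)
      refine ⟨(hK _).2 ⟨y0 y, ?_, hy0 y, rfl⟩, h.int hy hw'M, h.int hy hu⟩
      simp only [y0, ← ha, ← hb, Int.cast_smul_eq_zsmul]
      exact sub_mem (sub_mem hy (M.smul_mem _ hu)) (M.smul_mem _ hw'M)
    · rintro ⟨h1, h2, h3⟩
      obtain ⟨a, ha⟩ := mem_ZZ.1 h2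
      obtain ⟨b, hb⟩ := mem_ZZ.1 h3
      obtain ⟨m, hm, hmu, hmy⟩ := (hK _).1 h1
      simp only at ha hb hmy
      have h4 := hperp (y0 y - m) (fun x hx => by
        rw [← hiso _ _ (by simp [hy0, hmu]) hx, map_sub, hmy, sub_self]; simp)
      have h5 : C (y0 y - m) w' = C (y0 y - m) w := by
        conv_lhs => rw [h4]
        simp [huw']
      have h8 : C (y0 y - m) w' = 0 - C m w' := by
        rw [LinearMap.map_sub₂ C (y0 y) m w', hy0w]
      rw [← h5, h8] at h4
      obtain ⟨c, hc⟩ := mem_ZZ.1 (h.int hm hw'M)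
      have : y = m - c • u + a • u + b • w' := by
        rw [← hc] at h4
        simp only [← Int.cast_smul_eq_zsmul ℚ, ha, hb]
        have h6 : y0 y = m + (0 - (c : ℚ)) • u := by rw [← h4]; abel
        simp only [y0] at h6
        rw [sub_eq_iff_eq_add, sub_eq_iff_eq_add] at h6
        exact h6.trans (by module)
      rw [this]
      exact add_mem (add_mem (sub_mem hm (M.smul_mem _ hu)) (M.smul_mem _ hu)) (M.smul_mem _ hw'M)
end
section
variable {X Y : Type} [AddCommGroup X] [Module ℚ X] [AddCommGroup Y] [Module ℚ Y]
theorem SD.gen {C : Frm Y} {M : Submodule ℤ Y} (h : SD C M) {u : Y} (hu : u ∈ M) (hu0 : u ≠ 0) :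
    ∃ g : ℤ, g ≠ 0 ∧ (g : ℚ)⁻¹ • u ∈ M ∧ ∃ w ∈ M, C u w = g := by
  let I : Ideal ℤ :=
    { carrier := {n | ∃ w ∈ M, C u w = n}
      add_mem' := by
        rintro a b ⟨w, hw, h1⟩ ⟨w', hw', h2⟩
        exact ⟨w + w', add_mem hw hw', by rw [map_add, h1, h2]; push_cast; rfl⟩
      zero_mem' := ⟨0, zero_mem _, by simp⟩
      smul_mem' := by
        rintro c a ⟨w, hw, h1⟩
        exact ⟨c • w, M.smul_mem _ hw, by rw [map_zsmul, h1]; simp⟩ }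
  obtain ⟨g, hg⟩ := (IsPrincipalIdealRing.principal I).principal
  have hgI : g ∈ I := by rw [hg]; exact Submodule.mem_span_singleton_self g
  have hdiv : ∀ w ∈ M, ∃ k : ℤ, C u w = k * g := by
    intro w hw
    obtain ⟨n, hn⟩ := mem_ZZ.1 (h.int hu hw)
    have : n ∈ I := ⟨w, hw, hn.symm⟩
    rw [hg, Submodule.mem_span_singleton] at this
    obtain ⟨k, hk⟩ := this
    exact ⟨k, by rw [← hn, ← hk]; simp⟩
  have hg0 : g ≠ 0 := by
    rintro rfl
    apply hu0
    apply h.mem_of_zero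
    intro y hy
    obtain ⟨k, hk⟩ := hdiv y hy
    simpa using hk
  refine ⟨g, hg0, ?_, hgI⟩
  rw [h.mem_iff]
  intro y hy
  obtain ⟨k, hk⟩ := hdiv y hy
  have hg' : (g : ℚ) ≠ 0 := by exact_mod_cast hg0
  refine mem_ZZ.2 ⟨k, ?_⟩
  rw [map_smul, LinearMap.smul_apply, hk, smul_eq_mul]
  field_simp
theorem EU.splitII {C : Frm Y} {M : Submodule ℤ Y} (h : EU C M) (z : Y) (hz0 : z ≠ 0) (hz : C z z = 0) :
    ∃ (X' : Type) (_ : AddCommGroup X') (_ : Module ℚ X') (B' : Frm X') (K : Submodule ℤ X'),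
      EU B' K ∧ LatIso C M (prodF B' uF) (K.prod uL) := by
  obtain ⟨m, hm0, hm⟩ := h.scale z
  have hmz : m • z ≠ 0 := by
    rw [← Nat.cast_smul_eq_nsmul ℚ]
    exact smul_ne_zero (by exact_mod_cast hm0) hz0
  obtain ⟨g, hg0, hu, w, hw, hgw⟩ := h.gen hm hmz
  have hg' : (g : ℚ) ≠ 0 := by exact_mod_cast hg0
  set u := (g : ℚ)⁻¹ • m • z with hudef
  have huu : C u u = 0 := by simp [hudef, hz]
  have huw : C u w = 1 := by rw [hudef, map_smul, LinearMap.smul_apply, hgw]; simp [hg']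
  clear_value u
  obtain ⟨k, hk⟩ := h.even w hw
  set w' := w - (k : ℚ) • u with hw'
  have hw'M : w' ∈ M := by
    rw [hw', Int.cast_smul_eq_zsmul]; exact sub_mem hw (M.smul_mem _ hu)
  have hwu : C w u = 1 := by rw [h.symm, huw]
  have huw' : C u w' = 1 := by simp [hw', huu, huw]
  have hwu' : C w' u = 1 := by rw [h.symm, huw']
  have hww' : C w' w' = 0 := by simp [hw', huu, huw, hwu, hk]; ring
  clear_value w'
  let V : Submodule ℚ Y := LinearMap.ker (C.flip u) ⊓ LinearMap.ker (C.flip w')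
  have hV : ∀ x, x ∈ V ↔ C x u = 0 ∧ C x w' = 0 := fun x => by simp [V]
  let p : Y →ₗ[ℚ] Y := LinearMap.id - (C.flip w').smulRight u - (C.flip u).smulRight w'
  have hp : ∀ y, p y = y - C y w' • u - C y u • w' := fun y => rfl
  have hpV : ∀ y, p y ∈ V := fun y => by rw [hV, hp]; simp [huu, huw', hwu', hww']
  let π : Y →ₗ[ℚ] V := p.codRestrict V hpV
  have hπ : ∀ y, (π y : Y) = y - C y w' • u - C y u • w' := fun y => rfl
  let B' : Frm V := C.domRestrict₁₂ V V
  have hB' : ∀ x y : V, B' x y = C x y := fun x y => rfl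
  let P : Submodule ℚ Y := LinearMap.ker (C.flip u)
  have hPm : ∀ x, x ∈ P ↔ C x u = 0 := fun x => by simp [P]
  refine ⟨V, inferInstance, inferInstance, B', (M ⊓ P.restrictScalars ℤ).map (π.restrictScalars ℤ), ?_⟩
  apply h.split u w' hu hw'M huu huw' π
  · intro x y hx hy
    rw [hB', hπ, hπ]
    have := h.symm u y
    simp [hx, hy, huu, this]
  · intro x
    refine ⟨x, ((hV _).1 x.2).1, ?_⟩
    ext
    rw [hπ, ((hV _).1 x.2).1, ((hV _).1 x.2).2]; simp
  · ext; rw [hπ, huu, huw']; simp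
  · intro x
    rw [Submodule.mem_map]
    constructor
    · rintro ⟨l, ⟨h1, h2⟩, h3⟩; exact ⟨l, h1, (hPm l).1 h2, h3⟩
    · rintro ⟨l, h1, h2, h3⟩; exact ⟨l, ⟨h1, (hPm l).2 h2⟩, h3⟩
theorem chain_step {B : Frm X} {L : Submodule ℤ X} (h : EU B L) (y : X) (hy : ∃ n : ℤ, B y y = 2 * n) :
    EU B ((L ⊓ dual B (Submodule.span ℤ {y})) ⊔ Submodule.span ℤ {y}) ∧
    LatIso (prodF B uF) (L.prod uL) (prodF B uF)
      (((L ⊓ dual B (Submodule.span ℤ {y})) ⊔ Submodule.span ℤ {y}).prod uL) := by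
  classical
  obtain ⟨n, hn⟩ := hy
  have hex : ∃ m : ℕ, m ≠ 0 ∧ m • y ∈ L := h.scale y
  set m := Nat.find hex with hmdef
  obtain ⟨hm0, hmL⟩ : m ≠ 0 ∧ m • y ∈ L := Nat.find_spec hex
  have hmin : ∀ k : ℕ, k ≠ 0 → k • y ∈ L → m ≤ k := fun k h1 h2 => Nat.find_min' hex ⟨h1, h2⟩
  clear_value m
  have hm' : (m : ℚ) ≠ 0 := by exact_mod_cast hm0
  have hM := h.prod uL_eu
  set u : X × (ℚ × ℚ) := (m • y, ((m : ℚ), -(m * n : ℚ))) with hu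
  have huM : u ∈ L.prod uL := ⟨hmL, int_mem_ZZ m, by
    have := int_mem_ZZ (-(m * n)); push_cast at this; exact this⟩
  have hu0 : u ≠ 0 := by
    intro h0
    have := congrArg (fun x => x.2.1) h0
    simp [hu] at this
    exact hm0 this
  have huu : prodF B uF u u = 0 := by
    simp [hu, hn]; ring
  obtain ⟨g, hg0, hgu, w, hw, hgw⟩ := hM.gen huM hu0
  have hg' : (g : ℚ) ≠ 0 := by exact_mod_cast hg0
  obtain ⟨h1, h2, h3⟩ := hgu
  simp only [hu, Prod.smul_fst, Prod.smul_snd, smul_eq_mul] at h1 h2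
  obtain ⟨d, hd⟩ := mem_ZZ.1 h2
  have hmd : (m : ℤ) = g * d := by
    have : (m : ℚ) = g * d := by rw [hd]; field_simp
    exact_mod_cast this
  have hd0 : d ≠ 0 := by rintro rfl; simp at hmd; exact hm0 hmd
  have hdy : d.natAbs • y ∈ L := by
    have h4 : d • y ∈ L := by
      rw [← Nat.cast_smul_eq_nsmul ℚ, smul_smul, ← hd, Int.cast_smul_eq_zsmul] at h1
      exact h1
    rw [← natCast_zsmul]
    rcases Int.natAbs_eq d with h5 | h5
    · rw [← h5]; exact h4
    · have h6 : ((d.natAbs : ℕ) : ℤ) = -d := by omega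
      rw [h6, neg_smul]; exact neg_mem h4
  have h5 := hmin _ (by simpa using hd0) hdy
  have hgu1 : g.natAbs = 1 := by
    have h6 : m = g.natAbs * d.natAbs := by
      rw [← Int.natAbs_mul, ← hmd]; simp
    have h7 : 0 < d.natAbs := by omega
    have h8 : 0 < g.natAbs := by omega
    nlinarith
  have hgg : (g : ℚ) * g = 1 := by
    rcases Int.natAbs_eq_iff.1 hgu1 with h | h <;> rw [h] <;> norm_num
  let D := Submodule.span ℤ {y}
  have hmemdual : ∀ x, x ∈ dual B D ↔ B x y ∈ ZZ := by
    intro x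
    rw [mem_dual]
    constructor
    · intro hx; exact hx y (Submodule.mem_span_singleton_self y)
    · intro hx z hz
      obtain ⟨k, rfl⟩ := Submodule.mem_span_singleton.1 hz
      rw [map_zsmul]; exact zsmul_ZZ _ hx
  let π : X × (ℚ × ℚ) →ₗ[ℚ] X := LinearMap.fst ℚ _ _ - ((LinearMap.fst ℚ ℚ ℚ) ∘ₗ (LinearMap.snd ℚ X (ℚ × ℚ))).smulRight y
  have hπ : ∀ x α β, π (x, (α, β)) = x - α • y := fun x α β => rfl
  have hCu : ∀ x α β, prodF B uF (x, (α, β)) u = m * (B x y + β - n * α) := by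
    intro x α β
    simp [hu]; ring
  have hCu' : ∀ x α β, prodF B uF (x, (α, β)) u = 0 ↔ B x y + β - n * α = 0 := by
    intro x α β
    rw [hCu]; simp [hm']
  apply hM.split u (g • w) huM (Submodule.smul_mem _ _ hw) huu (by rw [map_zsmul, hgw]; simpa using hgg) π
  · rintro ⟨x, α, β⟩ ⟨x', α', β'⟩ h1 h2
    rw [hCu'] at h1 h2
    have hs := h.symm y x'
    rw [hπ, hπ]
    simp only [prodF_apply, uF_apply, map_sub, map_smul, LinearMap.sub_apply, LinearMap.smul_apply, smul_eq_mul, hn, hs]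
    linear_combination (-α') * h1 - α * h2
  · intro x
    exact ⟨(x, (0, -B x y)), by rw [hCu']; ring, by rw [hπ]; simp⟩
  · rw [hu, hπ, ← Nat.cast_smul_eq_nsmul ℚ]; simp
  · intro x
    constructor
    · intro hx
      obtain ⟨l, ⟨hl1, hl2⟩, e, he, rfl⟩ := Submodule.mem_sup.1 hx
      obtain ⟨k, rfl⟩ := Submodule.mem_span_singleton.1 he
      have hl3 := (hmemdual l).1 hl2
      refine ⟨(l, (-(k : ℚ), -B l y - n * k)), ⟨hl1, neg_mem (int_mem_ZZ k), ?_⟩, ?_, ?_⟩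
      · exact sub_mem (neg_mem hl3) (mul_mem (int_mem_ZZ n) (int_mem_ZZ k))
      · rw [hCu']; ring
      · rw [hπ, ← Int.cast_smul_eq_zsmul ℚ]; module
    · rintro ⟨⟨l, α, β⟩, ⟨hl, hα, hβ⟩, h1, rfl⟩
      rw [hCu'] at h1
      obtain ⟨a, ha⟩ := mem_ZZ.1 hα
      simp only at ha hβ hl
      rw [hπ]
      refine Submodule.mem_sup.2 ⟨l, ⟨hl, (hmemdual l).2 ?_⟩, -(a • y), ?_, ?_⟩
      · have : B l y = n * α - β := by linarith
        rw [this]; exact sub_mem (mul_mem (int_mem_ZZ n) hα) hβ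
      · exact neg_mem (Submodule.smul_mem _ _ (Submodule.mem_span_singleton_self y))
      · rw [← ha, Int.cast_smul_eq_zsmul, sub_eq_add_neg]
theorem chain {B : Frm X} {L1 L2 : Submodule ℤ X} (h1 : EU B L1) (h2 : EU B L2) :
    LatIso (prodF B uF) (L1.prod uL) (prodF B uF) (L2.prod uL) := by
  classical
  obtain ⟨s, hs⟩ := h2.fg
  have key : ∀ t : Finset X, (t : Set X) ⊆ L2 → ∃ L, EU B L ∧ (t : Set X) ⊆ L ∧
      LatIso (prodF B uF) (L1.prod uL) (prodF B uF) (L.prod uL) := by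
    intro t
    induction t using Finset.induction_on with
    | empty => intro _; exact ⟨L1, h1, by simp, LatIso.refl _ _⟩
    | insert y t hyt ih =>
      intro ht
      have ht' : (t : Set X) ⊆ L2 := fun x hx => ht (by simp only [coe_insert]; exact Or.inr hx)
      have hy : y ∈ L2 := ht (by simp)
      obtain ⟨L, hL, htL, hiso⟩ := ih ht'
      obtain ⟨h3, h4⟩ := chain_step hL y (h2.even y hy)
      refine ⟨_, h3, ?_, hiso.trans h4⟩
      intro x hx
      rw [coe_insert] at hx
      rcases hx with rfl | hx
      · exact Submodule.mem_sup_right (Submodule.mem_span_singleton_self _)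
      · refine Submodule.mem_sup_left ⟨htL hx, ?_⟩
        intro z hz
        obtain ⟨k, rfl⟩ := Submodule.mem_span_singleton.1 hz
        rw [map_zsmul]; exact zsmul_ZZ _ (h2.int (ht' hx) hy)
  obtain ⟨L, hL, hsL, hiso⟩ := key s (by rw [← hs]; exact Submodule.subset_span)
  have hle : L2 ≤ L := by rw [← hs]; exact Submodule.span_le.2 hsL
  have : L = L2 := by
    apply le_antisymm _ hle
    intro x hx
    rw [h2.mem_iff]
    intro y hy
    exact hL.int hx (hle hy)
  rw [← this]; exact hiso
theorem eu_unique {C : Frm X} {C' : Frm Y} {M : Submodule ℤ X} {M' : Submodule ℤ Y} (h : EU C M) (h' : EU C' M')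
    (hi : Isom C C') (z : X) (hz0 : z ≠ 0) (hz : C z z = 0) : LatIso C M C' M' := by
  obtain ⟨X1, _, _, B1, K1, hK1, hl1⟩ := h.splitII z hz0 hz
  obtain ⟨e, he⟩ := id hi
  obtain ⟨X2, _, _, B2, K2, hK2, hl2⟩ := h'.splitII (e z) (by simpa using hz0) (by rw [he, hz])
  haveI := hK1.finite
  haveI := hK2.finite
  have hB : Isom B1 B2 := by
    obtain ⟨r1, hr1⟩ := exists_hasCl B1 hK1.symm hK1.nondeg
    obtain ⟨r2, hr2⟩ := exists_hasCl B2 hK2.symm hK2.nondeg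
    obtain ⟨u, hu⟩ := exists_hasCl uF uL_eu.symm uL_eu.nondeg
    have h1 := HasCl.iso hl1.isom (hr1.prod hu)
    have h2 := HasCl.iso (hi.trans hl2.isom) (hr2.prod hu)
    have h3 := h1.unique h2
    have : r1 = r2 := add_right_cancel h3
    subst this
    exact hr1.isom hr2
  obtain ⟨L, hL⟩ := hB.lat K2
  have hLe : EU B1 L := hL.symm.eu hK2
  exact (hl1.trans (chain hK1 hLe)).trans ((hL.prod (LatIso.refl uF uL)).trans hl2.symm)
end
def HLM : Matrix MukaiIx MukaiIx ℤ :=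
  Matrix.of fun p q =>
    match p, q with
    | .inl (i, a), .inl (j, b) => if i = j ∧ a ≠ b then 1 else 0
    | .inr (i, a), .inr (j, b) => if i = j then -(E8I a b) else 0
    | _, _ => 0
theorem glm_inv : GLM * HLM = 1 := by decide +kernel
theorem glm_symm : GLM.transpose = GLM := by decide +kernel
theorem glm_even : ∀ i, Even (GLM i i) := by decide +kernel
theorem glm_eu : EU (gramQ GLM) (intL MukaiIx) :=
  gram_eu GLM HLM (fun i j => by conv_lhs => rw [← glm_symm]
                                 rfl) glm_inv glm_even
def lmMap : (MukaiIx → ℚ) →ₗ[ℚ] (Fin 4 → ℚ) × (Fin 4 → ℚ) × (Fin 8 → ℚ) × (Fin 8 → ℚ) where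
  toFun x := (fun i => x (.inl (i, 0)) + x (.inl (i, 1)), fun i => x (.inl (i, 0)) - x (.inl (i, 1)),
    fun a => x (.inr (0, a)), fun a => x (.inr (1, a)))
  map_add' x y := by ext <;> simp <;> ring
  map_smul' c x := by ext <;> simp <;> ring
theorem lm_isom : Isom (gramQ GLM) (prodF (diagF fun _ : Fin 4 => (1/2 : ℚ)) (prodF (diagF fun _ : Fin 4 => -(1/2 : ℚ))
    (prodF ((-1 : ℚ) • gramQ E8M) ((-1 : ℚ) • gramQ E8M)))) := by
  have bij : Function.Bijective lmMap := by
    constructor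
    · rw [← LinearMap.ker_eq_bot, LinearMap.ker_eq_bot']
      intro x hx
      have h1 := congrArg (fun z => z.1) hx
      have h2 := congrArg (fun z => z.2.1) hx
      have h3 := congrArg (fun z => z.2.2.1) hx
      have h4 := congrArg (fun z => z.2.2.2) hx
      simp only [lmMap, LinearMap.coe_mk, AddHom.coe_mk, Prod.fst_zero, Prod.snd_zero, funext_iff, Pi.zero_apply] at h1 h2 h3 h4
      ext i
      rcases i with ⟨i, a⟩ | ⟨i, a⟩
      · have := h1 i
        have := h2 i
        fin_cases a <;> simp <;> linarith
      · fin_cases i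
        · exact h3 a
        · exact h4 a
    · rintro ⟨p, q, r, s⟩
      refine ⟨Sum.elim (fun ia => if ia.2 = 0 then (p ia.1 + q ia.1) / 2 else (p ia.1 - q ia.1) / 2)
        (fun ia => if ia.1 = 0 then r ia.2 else s ia.2), ?_⟩
      simp only [lmMap, LinearMap.coe_mk, AddHom.coe_mk]
      ext <;> simp <;> ring
  refine ⟨LinearEquiv.ofBijective lmMap bij, fun x y => ?_⟩
  change prodF _ _ (lmMap x) (lmMap y) = _
  rw [gramQ_apply]
  simp only [lmMap, LinearMap.coe_mk, AddHom.coe_mk, prodF_apply, diagF_apply, LinearMap.smul_apply, gramQ_apply,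
    Fintype.sum_sum_type, Fintype.sum_prod_type, Fin.sum_univ_two, Fin.sum_univ_four, GLM, Matrix.of_apply]
  simp
  ring
theorem glm_cl : HasCl (gramQ GLM) (4 + 20 * eta) := by
  have h1 := HasCl.diag (fun _ : Fin 4 => (1/2 : ℚ)) (by norm_num)
  have h2 := HasCl.diag (fun _ : Fin 4 => -(1/2 : ℚ)) (by norm_num)
  have h3 := e8_cl.smul (c := -1) (by norm_num)
  have h := HasCl.iso lm_isom (h1.prod (h2.prod (h3.prod h3)))
  have e : (4 + 20 * eta : R) = ∑ i : Fin 4, br (1/2) + (∑ i : Fin 4, br (-(1/2)) + (br (-1) * 8 + br (-1) * 8)) := by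
    have h4 := four_br (x := 1/2) (by norm_num)
    simp only [sum_const, card_univ, Fintype.card_fin, nsmul_eq_mul, br_neg (1/2 : ℚ), Nat.cast_ofNat]
    change (4 + 20 * eta : R) = 4 * br (1/2) + (4 * (eta * br (1/2)) + (eta * 8 + eta * 8))
    linear_combination (-1 - eta) * h4
  rw [e]; exact h
section
variable {X Y : Type} [AddCommGroup X] [Module ℚ X] [AddCommGroup Y] [Module ℚ Y]
theorem intL_scale {n : ℕ} (x : Fin n → ℚ) : ∃ m : ℕ, m ≠ 0 ∧ m • x ∈ intL (Fin n) := by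
  refine ⟨∏ i, (x i).den, Finset.prod_ne_zero_iff.2 fun i _ => (x i).den_nz, ?_⟩
  intro i
  obtain ⟨c, hc⟩ := Finset.dvd_prod_of_mem (fun i => (x i).den) (mem_univ i)
  rw [hc, Pi.smul_apply, nsmul_eq_mul]
  have h := Rat.den_mul_eq_num (x i)
  refine mem_ZZ.2 ⟨c * (x i).num, ?_⟩
  push_cast
  rw [← h]; ring
theorem fg_scale {n : ℕ} {L : Submodule ℤ (Fin n → ℚ)} (hL : L.FG) :
    ∃ k : ℕ, k ≠ 0 ∧ ∀ x ∈ L, (k : ℤ) • x ∈ intL (Fin n) := by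
  classical
  obtain ⟨s, hs⟩ := hL
  choose m hm0 hm using fun x : Fin n → ℚ => intL_scale x
  refine ⟨∏ x ∈ s, m x, Finset.prod_ne_zero_iff.2 fun x _ => hm0 x, ?_⟩
  intro x hx
  rw [← hs] at hx
  induction hx using Submodule.span_induction with
  | mem x hx =>
    obtain ⟨c, hc⟩ := Finset.dvd_prod_of_mem m hx
    rw [hc, natCast_zsmul, mul_comm, mul_smul]
    exact nsmul_mem (hm x) c
  | zero => simp
  | add x y _ _ hx hy => rw [smul_add]; exact add_mem hx hy
  | smul a x _ hx => rw [smul_comm]; exact Submodule.smul_mem _ _ hx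
theorem neg_cl {C : Frm Y} {L : Submodule ℤ Y} (h : SD C L) (hneg : ∀ x, x ≠ 0 → C x x < 0) :
    HasCl C (eta * (finrank ℚ Y : ℕ)) := by
  have h1 : SD ((-1 : ℚ) • C) L := by
    refine ⟨fun x y => by simp [h.symm x y], h.fg, fun x => ?_⟩
    rw [h.mem_iff]
    constructor
    · intro hx y hy; simpa using hx y hy
    · intro hx y hy; simpa using hx y hy
  have h2 := posdef_cl h1 (fun x hx => by simpa using hneg x hx)
  have h3 := h2.smul (c := -1) (by norm_num)
  rw [smul_smul] at h3
  norm_num at h3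
  exact h3
theorem fourdim {a b : Fin 4 → ℚ} (hC : HasCl (prodF (diagF a) (diagF b)) 8) :
    ∃ F, EU (prodF (diagF a) (diagF b)) F ∧ ∀ x, (x, 0) ∈ F → x ∈ intL (Fin 4) := by
  obtain ⟨F, hF⟩ := exists_eu8 hC
  have hfg : (F.map (LinearMap.fst ℤ (Fin 4 → ℚ) (Fin 4 → ℚ))).FG := hF.fg.map _
  obtain ⟨k, hk0, hk⟩ := fg_scale hfg
  obtain ⟨F', hF', hsh⟩ := shrink hC hF (LinearMap.ker (LinearMap.snd ℚ (Fin 4 → ℚ) (Fin 4 → ℚ))) (by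
    have h := LinearMap.finrank_range_add_finrank_ker (LinearMap.snd ℚ (Fin 4 → ℚ) (Fin 4 → ℚ))
    rw [LinearMap.range_eq_top.2 LinearMap.snd_surjective, finrank_top] at h
    simp at h ⊢
    omega) k hk0
  refine ⟨F', hF', fun x hx => ?_⟩
  obtain ⟨f, hf, he⟩ := hsh _ hx (by simp)
  have h1 := hk f.1 ⟨f, hf, rfl⟩
  have h2 := congrArg Prod.fst he
  simp only [Prod.smul_fst] at h2
  rw [h2]; exact h1
theorem emb_core {C : Frm Y} {L : Submodule ℤ Y} (h : EU C L) (hneg : ∀ x, x ≠ 0 → C x x < 0) (hfr : finrank ℚ Y = 24)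
    (τ : Fin 4 → Y) (hτ : ∀ i, τ i ∈ L) (hτ0 : ∀ i, τ i ≠ 0) (horth : ∀ i j, i ≠ j → C (τ i) (τ j) = 0) (V : Submodule ℚ Y)
    (hV : ∀ x, x ∈ V ↔ ∀ i, C x (τ i) = 0) :
    ∃ φ : V →ₗ[ℚ] (MukaiIx → ℚ), (∀ x y, gramQ GLM (φ x) (φ y) = C x y) ∧ ∀ x, φ x ∈ intL MukaiIx ↔ (x : Y) ∈ L := by
  set a : Fin 4 → ℚ := fun i => - C (τ i) (τ i) with ha
  have ha0 : ∀ i, 0 < a i := fun i => by have := hneg _ (hτ0 i); simp only [ha]; linarith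
  have hC : ∀ i j, C (τ i) (τ j) = if i = j then - a i else 0 := by
    intro i j
    split_ifs with hij
    · subst hij; simp [ha]
    · exact horth i j hij
  clear_value a
  let b : Fin 4 → ℚ := ![a 1 * a 2 * a 3, a 0 * a 2 * a 3, a 0 * a 1 * a 3, a 0 * a 1 * a 2]
  have hb0 : ∀ i, 0 < b i := by
    intro i
    have h0 := ha0 0
    have h1 := ha0 1
    have h2 := ha0 2
    have h3 := ha0 3
    fin_cases i <;> simp [b] <;> positivity
  have hab : ∑ i, br (a i) + ∑ i, br (b i) = 8 := by
    rw [← eight (ha0 0) (ha0 1) (ha0 2) (ha0 3)]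
    simp [Fin.sum_univ_four, b]
  have hcl8 : HasCl (prodF (diagF a) (diagF b)) 8 := by
    rw [← hab]
    exact (HasCl.diag a fun i => (ha0 i).ne').prod (HasCl.diag b fun i => (hb0 i).ne')
  obtain ⟨F, hF, hFx⟩ := fourdim hcl8
  let pr : Y →ₗ[ℚ] Y := LinearMap.id + ∑ i, (C.flip (τ i)).smulRight ((a i)⁻¹ • τ i)
  have hpr : ∀ y, pr y = y + ∑ i, (C y (τ i) * (a i)⁻¹) • τ i := by
    intro y
    simp [pr, smul_smul]
  have hprV : ∀ y, pr y ∈ V := by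
    intro y
    rw [hV]
    intro j
    have := (ha0 j).ne'
    simp [hpr, hC]
    field_simp
    ring
  have hprid : ∀ y ∈ V, pr y = y := by
    intro y hy
    rw [hpr]
    simp [(hV y).1 hy]
  let q : Y →ₗ[ℚ] V := pr.codRestrict V hprV
  have hq : ∀ y, (q y : Y) = y + ∑ i, (C y (τ i) * (a i)⁻¹) • τ i := hpr
  let CV : Frm V := C.domRestrict₁₂ V V
  have hCV : ∀ x y : V, CV x y = C x y := fun x y => rfl
  have hqq : ∀ x y, CV (q x) (q y) = C x y + ∑ i, (a i)⁻¹ * C x (τ i) * C y (τ i) := by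
    intro x y
    rw [hCV]
    have h1 : C (q x) (q y) = C x (q y) := by
      rw [hq x]
      simp [fun i => h.symm (τ i) (q y), (hV _).1 (q y).2]
    rw [h1, hq]
    simp only [map_add, map_sum, map_smul, smul_eq_mul]
    congr 1
    exact sum_congr rfl fun i _ => by ring
  have hCVn : ∀ x, (∀ y, CV x y = 0) → x = 0 := by
    intro x hx
    by_contra h0
    have h1 := hneg x (by simpa using h0)
    have := hx x
    rw [hCV] at this
    linarith
  let B' : Frm (V × (Fin 4 → ℚ)) := prodF CV (diagF b)
  let P : Submodule ℚ (Y × ((Fin 4 → ℚ) × (Fin 4 → ℚ))) :=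
    { carrier := {z | ∀ i, C z.1 (τ i) + a i * z.2.1 i = 0}
      add_mem' := by
        intro x y hx hy i
        have h1 := hx i
        have h2 := hy i
        simp only [Prod.fst_add, Prod.snd_add, map_add, LinearMap.add_apply, Pi.add_apply]
        linarith
      zero_mem' := by intro i; simp
      smul_mem' := by
        intro c x hx i
        have h1 := hx i
        simp only [Prod.smul_fst, Prod.smul_snd, map_smul, LinearMap.smul_apply, Pi.smul_apply, smul_eq_mul]
        linear_combination c * h1 }
  have hPm : ∀ z, z ∈ P ↔ ∀ i, C z.1 (τ i) + a i * z.2.1 i = 0 := fun z => Iff.rfl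
  let π : Y × ((Fin 4 → ℚ) × (Fin 4 → ℚ)) →ₗ[ℚ] V × (Fin 4 → ℚ) :=
    q.prodMap (LinearMap.snd ℚ _ _)
  have hπ : ∀ y x z, π (y, (x, z)) = (q y, z) := fun _ _ _ => rfl
  have hN := (h.prod hF).reduce (B := B') P π ?_ ?_ ?_
  rotate_left
  · rintro ⟨y, x, z⟩ hy ⟨y', x', z'⟩ hy'
    rw [hPm] at hy hy'
    rw [hπ, hπ]
    simp only [B', prodF_apply, hqq]
    rw [add_assoc]
    congr 1
    congr 1
    rw [diagF_apply]
    apply sum_congr rfl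
    intro i _
    have h1 := hy i
    have h2 := hy' i
    have h3 := (ha0 i).ne'
    simp only at h1 h2
    rw [eq_neg_of_add_eq_zero_left h1, eq_neg_of_add_eq_zero_left h2]
    field_simp
  · rintro ⟨v, z⟩
    refine ⟨(v, (0, z)), ?_, ?_⟩
    · rw [hPm]; intro i; simp [(hV _).1 v.2]
    · rw [hπ]; congr 1; ext; exact hprid _ v.2
  · rintro ⟨y, x, z⟩ hy
    refine ⟨?_, ?_⟩
    · rw [hPm]
      intro i
      have := hy (τ i, (Pi.single i 1, 0)) (by
        rw [hPm]; intro j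
        simp only [hC]
        by_cases hij : i = j
        · subst hij; simp
        · simp [hij, Ne.symm hij])
      simpa [Pi.single_apply] using this
    · rw [hπ]
      have hz : z = 0 := by
        ext i
        have := hy (0, (0, Pi.single i 1)) (by rw [hPm]; intro j; simp)
        simpa [Pi.single_apply, (hb0 i).ne'] using this
      have hqy : q y = 0 := by
        apply hCVn
        intro v
        have h1 := hy (v, (0, 0)) (by rw [hPm]; intro j; simp [(hV _).1 v.2])
        have h2 : q v = v := by ext; exact hprid _ v.2
        rw [← h2, hqq]
        simp [(hV _).1 v.2]
        simpa using h1
      rw [hz, hqy]; rfl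
  haveI := h.finite
  obtain ⟨r, hr⟩ := exists_hasCl CV (fun x y => h.symm x y) hCVn
  have hY : Isom C (prodF CV (diagF fun i => - a i)) := by
    let Φ : Y →ₗ[ℚ] V × (Fin 4 → ℚ) := q.prod (LinearMap.pi fun i => (a i)⁻¹ • C.flip (τ i))
    have hΦ : ∀ y, Φ y = (q y, fun i => (a i)⁻¹ * C y (τ i)) := fun y => rfl
    have hΦi : ∀ x y, prodF CV (diagF fun i => - a i) (Φ x) (Φ y) = C x y := by
      intro x y
      rw [hΦ, hΦ, prodF_apply, diagF_apply]
      simp only [hqq]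
      rw [add_assoc, ← sum_add_distrib]
      rw [sum_eq_zero, add_zero]
      intro i _
      have h3 := (ha0 i).ne'
      field_simp
      ring
    have bij : Function.Bijective Φ := by
      constructor
      · rw [← LinearMap.ker_eq_bot, LinearMap.ker_eq_bot']
        intro x hx
        apply h.nondeg
        intro y
        rw [← hΦi, hx]; simp
      · rintro ⟨v, x⟩
        refine ⟨v - ∑ i, x i • τ i, ?_⟩
        rw [hΦ]
        have hc : ∀ i, C (v - ∑ i, x i • τ i) (τ i) = x i * a i := by
          intro i
          simp [(hV _).1 v.2, hC]
        have hx : ∀ i, x i * a i * (a i)⁻¹ = x i := fun i => by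
          have h3 := (ha0 i).ne'
          field_simp
        ext1
        · ext
          rw [hq]
          simp only [hc, hx]
          abel
        · ext i
          simp only [hc]
          have h3 := (ha0 i).ne'
          field_simp
    exact ⟨LinearEquiv.ofBijective Φ bij, hΦi⟩
  have hcl1 := HasCl.iso hY (hr.prod (HasCl.diag (fun i => - a i) fun i => neg_ne_zero.2 (ha0 i).ne'))
  have hcl2 := neg_cl h.toSD hneg
  rw [hfr] at hcl2
  have e1 := hcl1.unique hcl2
  have hclB : HasCl B' (4 + 20 * eta) := by
    have := hr.prod (HasCl.diag b fun i => (hb0 i).ne')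
    have e : r + ∑ i, br (b i) = 4 + 20 * eta := by
      have hy : ∀ i, (1 + eta) * br (a i) = 1 + eta := fun i => by
        have := hyp (ha0 i).ne'
        rw [br_neg] at this
        linear_combination this
      have e2 : (1 + eta) * ∑ i, br (a i) = 4 * (1 + eta) := by
        rw [mul_sum, sum_congr rfl fun i _ => hy i]
        simp
        ring
      have e3 : ∑ i, br (- a i) = eta * ∑ i, br (a i) := by
        rw [mul_sum]; exact sum_congr rfl fun i _ => br_neg _
      rw [e3] at e1
      push_cast at e1
      linear_combination e1 + hab - e2
    rw [e] at this
    exact this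
  obtain ⟨e, he, hel⟩ := eu_unique glm_eu hN (glm_cl.isom hclB) (Pi.single (.inl (0, 0)) 1) (by
      intro h0
      have := congrFun h0 (.inl (0, 0))
      simp at this) (by
      rw [gramQ_apply, Finset.sum_eq_single (.inl (0, 0)), Finset.sum_eq_single (.inl (0, 0))]
      · simp [GLM]
      · intro j _ hj; simp [hj]
      · simp
      · intro j _ hj; simp [hj]
      · simp)
  refine ⟨e.symm.toLinearMap ∘ₗ LinearMap.inl ℚ V (Fin 4 → ℚ), fun x y => ?_, fun x => ?_⟩
  · rw [← he]
    simp [B', hCV]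
  · rw [hel]
    simp only [LinearMap.comp_apply, LinearEquiv.coe_coe, LinearEquiv.apply_symm_apply, Submodule.mem_map, LinearMap.inl_apply]
    constructor
    · rintro ⟨⟨y, t, z⟩, ⟨⟨h1, h2⟩, h3⟩, h4⟩
      have h4' : (q y, z) = (x, 0) := h4
      rw [Prod.mk.injEq] at h4'
      obtain ⟨h5, rfl⟩ := h4'
      have h6 := hFx t h2
      have h7 : ∀ i, C y (τ i) * (a i)⁻¹ = - t i := by
        intro i
        have h8 := (hPm _).1 h3 i
        have h3 := (ha0 i).ne'
        simp only at h8
        rw [eq_neg_of_add_eq_zero_left h8]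
        field_simp
      have h8 := hq y
      simp only [h7] at h8
      rw [← h5, h8]
      refine add_mem h1 (sum_mem fun i _ => ?_)
      obtain ⟨n, hn⟩ := mem_ZZ.1 (h6 i)
      rw [neg_smul, ← hn, Int.cast_smul_eq_zsmul]
      exact neg_mem (L.smul_mem _ (hτ i))
    · intro hx
      refine ⟨(x, (0, 0)), ⟨⟨hx, zero_mem _⟩, ?_⟩, ?_⟩
      · change _ ∈ P
        rw [hPm]; intro i; simp [(hV _).1 x.2]
      · change (q x, (0 : Fin 4 → ℚ)) = _
        congr 1; ext; exact hprid _ x.2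
end
theorem bLM_cast (x y : LM) : gramQ GLM (fun i => (x i : ℚ)) (fun i => (y i : ℚ)) = (bLM x y : ℤ) := by
  rw [gramQ_apply]
  change _ = ((∑ i, x i * ∑ j, GLM i j * y j : ℤ) : ℚ)
  push_cast
  refine sum_congr rfl fun i _ => ?_
  rw [mul_sum]
  exact sum_congr rfl fun j _ => by ring
theorem core {Λ : Type*} [AddCommGroup Λ] [Module.Free ℤ Λ] [Module.Finite ℤ Λ]
    (bΛ : Λ →ₗ[ℤ] Λ →ₗ[ℤ] ℤ) (hsymm : ∀ x y : Λ, bΛ x y = bΛ y x) (heven : ∀ x : Λ, Even (bΛ x x))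
    (hneg : ∀ x : Λ, x ≠ 0 → bΛ x x < 0) (hrank : finrank ℤ Λ = 24) (hunimodular : Function.Bijective bΛ)
    (S : Submodule ℤ Λ) (hS : finrank ℤ S ≤ 20) (hsat : ∀ k : ℤ, k ≠ 0 → ∀ x, k • x ∈ S → x ∈ S) :
    ∃ ι : S →ₗ[ℤ] LM, (∀ x y, bLM (ι x) (ι y) = bΛ x y) ∧
      ∀ k : ℤ, k ≠ 0 → ∀ x, k • x ∈ LinearMap.range ι → x ∈ LinearMap.range ι := by
  let b : Basis (Fin 24) ℤ Λ := (finBasis ℤ Λ).reindex (finCongr hrank)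
  let Gm : Matrix (Fin 24) (Fin 24) ℤ := Matrix.of fun i j => bΛ (b i) (b j)
  let J : Λ →ₗ[ℤ] (Fin 24 → ℚ) :=
    { toFun := fun x i => (b.repr x i : ℚ)
      map_add' := fun x y => by ext i; simp
      map_smul' := fun c x => by ext i; simp }
  have hJ : ∀ x i, J x i = (b.repr x i : ℚ) := fun x i => rfl
  have hJL : ∀ x, J x ∈ intL (Fin 24) := fun x i => int_mem_ZZ _
  have hJs : ∀ z ∈ intL (Fin 24), ∃ x, J x = z := by
    intro z hz
    obtain ⟨c, rfl⟩ := mem_intL'.1 hz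
    refine ⟨∑ i, c i • b i, ?_⟩
    ext i
    rw [hJ, Basis.repr_sum_self]
  have hJi : ∀ x y, J x = J y → x = y := by
    intro x y hxy
    apply b.repr.injective
    ext i
    have := congrFun hxy i
    rw [hJ, hJ] at this
    exact_mod_cast this
  have hJb : ∀ x y, gramQ Gm (J x) (J y) = (bΛ x y : ℤ) := by
    intro x y
    rw [gramQ_apply]
    conv_rhs => rw [← b.sum_repr x, ← b.sum_repr y]
    simp only [map_sum, LinearMap.sum_apply, map_smul, LinearMap.smul_apply, smul_eq_mul, hJ, Gm, Matrix.of_apply]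
    push_cast
    simp only [mul_sum]
    rw [sum_comm]
    exact sum_congr rfl fun i _ => sum_congr rfl fun j _ => by ring
  choose d hd using fun j => hunimodular.2 (b.coord j)
  let H : Matrix (Fin 24) (Fin 24) ℤ := Matrix.of fun k j => b.repr (d j) k
  have hGH : Gm * H = 1 := by
    ext i j
    rw [Matrix.mul_apply]
    have h1 : bΛ (b i) (d j) = ∑ k, Gm i k * H k j := by
      conv_lhs => rw [← b.sum_repr (d j)]
      simp only [map_sum, map_smul, smul_eq_mul, Gm, H, Matrix.of_apply]
      exact sum_congr rfl fun k _ => by ring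
    rw [← h1, hsymm, hd, Basis.coord_apply, Basis.repr_self, Finsupp.single_apply, Matrix.one_apply]
  have hEU : EU (gramQ Gm) (intL (Fin 24)) := gram_eu Gm H (fun i j => hsymm _ _) hGH (fun i => heven _)
  have hnegQ : ∀ x, x ≠ 0 → gramQ Gm x x < 0 := by
    intro x hx
    obtain ⟨m, hm0, hm⟩ := intL_scale x
    obtain ⟨l, hl⟩ := hJs _ hm
    have hm' : (m : ℚ) ≠ 0 := by exact_mod_cast hm0
    have hl0 : l ≠ 0 := by
      rintro rfl
      rw [map_zero, ← Nat.cast_smul_eq_nsmul ℚ] at hl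
      exact smul_ne_zero hm' hx hl.symm
    have h1 := hneg l hl0
    have h2 := hJb l l
    rw [hl, map_nsmul, map_nsmul, LinearMap.smul_apply] at h2
    have h3 : ((bΛ l l : ℤ) : ℚ) < 0 := by exact_mod_cast h1
    rw [← h2] at h3
    simp only [nsmul_eq_mul] at h3
    have h4 : (0 : ℚ) < m := by positivity
    by_contra h5
    push Not at h5
    have : 0 ≤ (m : ℚ) * (m * gramQ Gm x x) := by positivity
    linarith
  haveI : Module.Free ℤ S := inferInstance
  let bs := finBasis ℤ S
  let f : (Fin 24 → ℚ) →ₗ[ℚ] (Fin (finrank ℤ S) → ℚ) := LinearMap.pi fun i => (gramQ Gm).flip (J (bs i))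
  let U : Submodule ℚ (Fin 24 → ℚ) := LinearMap.ker f
  have hUS : ∀ x ∈ U, ∀ s ∈ S, gramQ Gm x (J s) = 0 := by
    intro x hx s hs
    have h1 : ∀ i, gramQ Gm x (J (bs i)) = 0 := fun i => congrFun (LinearMap.mem_ker.1 hx) i
    have h2 : s = ∑ i, bs.repr ⟨s, hs⟩ i • (bs i : Λ) := by
      have := congrArg (Subtype.val) (bs.sum_repr ⟨s, hs⟩)
      simp only [AddSubmonoidClass.coe_finset_sum, Submodule.coe_smul] at this
      exact this.symm
    rw [h2, map_sum, map_sum]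
    apply sum_eq_zero
    intro i _
    rw [map_smul, map_zsmul, h1, smul_zero]
  have hUr : 4 ≤ finrank ℚ U := by
    have h1 := LinearMap.finrank_range_add_finrank_ker f
    have h2 := Submodule.finrank_le (LinearMap.range f)
    rw [Module.finrank_fin_fun] at h1 h2
    change _ + finrank ℚ U = _ at h1
    omega
  obtain ⟨o, ho1, ho2⟩ := exists_orth_basis ((gramQ Gm).domRestrict₁₂ U U) (fun x y => hEU.symm x y) (fun x hx => by
    by_contra h0
    have h1 := hnegQ x (by simpa using h0)
    have h2 : gramQ Gm x x = 0 := hx x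
    linarith)
  choose m hm0 hm using fun i => intL_scale (o (Fin.castLE hUr i) : Fin 24 → ℚ)
  let τ : Fin 4 → (Fin 24 → ℚ) := fun i => m i • (o (Fin.castLE hUr i) : Fin 24 → ℚ)
  let V : Submodule ℚ (Fin 24 → ℚ) := ⨅ i, LinearMap.ker ((gramQ Gm).flip (τ i))
  have hV : ∀ x, x ∈ V ↔ ∀ i, gramQ Gm x (τ i) = 0 := fun x => by simp [V, Submodule.mem_iInf]
  obtain ⟨φ, hφ, hφL⟩ := emb_core hEU hnegQ (by simp) τ hm (fun i => by
      simp only [τ]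
      rw [← Nat.cast_smul_eq_nsmul ℚ]
      exact smul_ne_zero (by exact_mod_cast hm0 i) (by simpa using o.ne_zero _)) (fun i j hij => by
      simp only [τ, map_nsmul, LinearMap.smul_apply]
      have : gramQ Gm (o (Fin.castLE hUr i)) (o (Fin.castLE hUr j)) = 0 := ho1 _ _ (by simpa using hij)
      rw [this]; simp) V hV
  have hSV : ∀ s : S, J s ∈ V := by
    intro s
    rw [hV]
    intro i
    simp only [τ, map_nsmul]
    rw [hEU.symm, hUS _ (o _).2 s s.2, smul_zero]
  have hint : ∀ s : S, ∃ a : LM, φ ⟨J s, hSV s⟩ = fun i => (a i : ℚ) := fun s =>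
    mem_intL'.1 ((hφL _).2 (hJL s))
  choose ι hι using hint
  have hinj : ∀ a c : LM, (fun i => (a i : ℚ)) = (fun i => (c i : ℚ)) → a = c := by
    intro a c h
    ext i
    have := congrFun h i
    exact_mod_cast this
  let ι' : S →ₗ[ℤ] LM :=
    { toFun := ι
      map_add' := fun x y => by
        apply hinj
        rw [← hι]
        have : (⟨J ↑(x + y), hSV (x + y)⟩ : V) = ⟨J x, hSV x⟩ + ⟨J y, hSV y⟩ := by ext; simp
        rw [this, map_add, hι, hι]
        ext i; simp
      map_smul' := fun c x => by
        apply hinj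
        rw [← hι]
        have : (⟨J ↑(c • x), hSV (c • x)⟩ : V) = c • ⟨J x, hSV x⟩ := by ext; simp
        rw [this, map_zsmul, hι]
        ext i; simp }
  refine ⟨ι', fun x y => ?_, ?_⟩
  · have h1 := bLM_cast (ι x) (ι y)
    rw [← hι, ← hι, hφ] at h1
    have h2 := hJb x y
    rw [h1] at h2
    exact_mod_cast h2
  · rintro k hk x ⟨s, hs⟩
    have hk' : (k : ℚ) ≠ 0 := by exact_mod_cast hk
    have h1 : φ ((k : ℚ)⁻¹ • ⟨J s, hSV s⟩) = fun i => (x i : ℚ) := by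
      rw [map_smul, hι]
      ext i
      have := congrFun hs i
      change ι s i = k * x i at this
      simp [this, hk']
    have h2 := (hφL ((k : ℚ)⁻¹ • ⟨J s, hSV s⟩)).1 (by rw [h1]; exact mem_intL'.2 ⟨x, rfl⟩)
    obtain ⟨y, hy⟩ := hJs _ h2
    simp only [Submodule.coe_smul] at hy
    have h3 : k • y = s := by
      apply hJi
      rw [map_smul, hy, ← Int.cast_smul_eq_zsmul ℚ, smul_smul, mul_inv_cancel₀ hk', one_smul]
    have hyS : y ∈ S := hsat k hk y (by rw [h3]; exact s.2)
    refine ⟨⟨y, hyS⟩, ?_⟩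
    apply hinj
    rw [← h1]
    change (fun i => ((ι ⟨y, hyS⟩ i : ℤ) : ℚ)) = _
    rw [← hι]
    congr 1
    ext1
    exact hy
theorem bLM_apply (x y : LM) : bLM x y = dotProduct x (GLM.mulVec y) := rfl
theorem bLM_symm (x y : LM) : bLM x y = bLM y x := by
  have h1 := bLM_cast x y
  rw [glm_eu.symm, bLM_cast] at h1
  exact_mod_cast h1.symm
theorem bLM_even (x : LM) : ∃ n : ℤ, bLM x x = 2 * n := by
  obtain ⟨n, hn⟩ := glm_eu.even (fun i => (x i : ℚ)) (fun i => int_mem_ZZ _)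
  rw [bLM_cast] at hn
  exact ⟨n, by exact_mod_cast hn⟩
theorem bLM_repr (f : LM →ₗ[ℤ] ℤ) : ∃ n, ∀ m, bLM n m = f m := by
  have hHG : HLM * GLM = 1 := mul_eq_one_comm.1 glm_inv
  let f0 : LM := fun i => f (Pi.single i 1)
  refine ⟨Matrix.vecMul f0 HLM, fun m => ?_⟩
  rw [bLM_apply, Matrix.dotProduct_mulVec, Matrix.vecMul_vecMul, hHG, Matrix.vecMul_one]
  conv_rhs => rw [← LinearMap.sum_single_apply (fun _ : MukaiIx => ℤ) m]
  rw [map_sum]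
  refine sum_congr rfl fun i _ => ?_
  have : (Pi.single i (m i) : LM) = m i • Pi.single i 1 := by
    ext j; by_cases h : j = i
    · subst h; simp
    · simp [h]
  change f0 i * m i = f (Pi.single i (m i))
  rw [this, map_smul, smul_eq_mul, mul_comm]
theorem bLM_nondeg (x : LM) (h : ∀ y, bLM x y = 0) : x = 0 := by
  ext i
  obtain ⟨n, hn⟩ := bLM_repr (LinearMap.proj i)
  have := hn x
  rw [bLM_symm, h] at this
  exact this.symm
theorem proj_lem {W : Type*} [AddCommGroup W] [Module.Free ℤ W] [Module.Finite ℤ W] (c : W →ₗ[ℤ] W →ₗ[ℤ] ℤ)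
    (hneg : ∀ w, w ≠ 0 → c w w < 0) (f : W →ₗ[ℤ] ℤ) : ∃ k : ℤ, k ≠ 0 ∧ ∃ w, ∀ w', c w w' = k * f w' := by
  by_contra hcon
  push Not at hcon
  let Φ : W × ℤ →ₗ[ℤ] (W →ₗ[ℤ] ℤ) := c.coprod (LinearMap.toSpanSingleton ℤ _ (-f))
  have hΦ : ∀ w k, Φ (w, k) = c w - k • f := by
    intro w k; simp [Φ, sub_eq_add_neg]
  have hinj : Function.Injective Φ := by
    rw [← LinearMap.ker_eq_bot, LinearMap.ker_eq_bot']
    rintro ⟨w, k⟩ h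
    rw [hΦ, sub_eq_zero] at h
    by_cases hk : k = 0
    · subst hk
      have hw : w = 0 := by
        by_contra hw
        have := hneg w hw
        rw [h] at this
        simp at this
      rw [hw]; rfl
    · obtain ⟨w', hw'⟩ := hcon k hk w
      rw [h] at hw'
      simp at hw'
  have h1 := LinearMap.finrank_le_finrank_of_injective hinj
  rw [finrank_prod, finrank_self] at h1
  have h2 : finrank ℤ (W →ₗ[ℤ] ℤ) = finrank ℤ W := by
    rw [finrank_linearMap, finrank_self, mul_one]
  omega
theorem exists_one {W : Type*} [AddCommGroup W] (c : W →ₗ[ℤ] W →ₗ[ℤ] ℤ)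
    (hp : ∀ p : ℕ, p.Prime → ¬ ∀ x y, (p : ℤ) ∣ c x y) : ∃ x y, c x y = 1 := by
  classical
  have hex : ∃ d : ℕ, d ≠ 0 ∧ ∃ x y, c x y = d := by
    by_contra hcon
    push Not at hcon
    apply hp 2 Nat.prime_two
    intro x y
    by_cases h0 : c x y = 0
    · rw [h0]; simp
    · rcases Int.natAbs_eq (c x y) with h | h
      · exact absurd h (hcon _ (by simpa using h0) x y)
      · exact absurd (by rw [map_neg]; omega) (hcon (c x y).natAbs (by simpa using h0) x (-y))
  obtain ⟨hd0, x, y, hxy⟩ := Nat.find_spec hex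
  have hmin : ∀ k : ℕ, k ≠ 0 → ∀ x y, c x y = k → Nat.find hex ≤ k := fun k h1 x y h2 =>
    Nat.find_min' hex ⟨h1, x, y, h2⟩
  set d := Nat.find hex
  clear_value d
  have hdpos : (0 : ℤ) < d := by omega
  have key : ∀ e : ℤ, (∃ x y, c x y = e) → 0 ≤ e → e < d → e = 0 := by
    rintro e ⟨x, y, h⟩ h1 h2
    by_contra h0
    have := hmin e.toNat (by omega) x y (by rw [h]; omega)
    omega
  have left : ∀ x y, c x y = d → ∀ y', (d : ℤ) ∣ c x y' := by
    intro x y h y'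
    apply Int.dvd_of_emod_eq_zero
    apply key _ ⟨x, y' - (c x y' / d) • y, ?_⟩ (Int.emod_nonneg _ (by omega)) (Int.emod_lt_of_pos _ hdpos)
    rw [map_sub, map_smul, h, Int.emod_def, smul_eq_mul, mul_comm]
  have right : ∀ x y, c x y = d → ∀ x', (d : ℤ) ∣ c x' y := by
    intro x y h x'
    apply Int.dvd_of_emod_eq_zero
    apply key _ ⟨x' - (c x' y / d) • x, y, ?_⟩ (Int.emod_nonneg _ (by omega)) (Int.emod_lt_of_pos _ hdpos)
    rw [LinearMap.map_sub₂, map_smul, LinearMap.smul_apply, h, Int.emod_def, smul_eq_mul, mul_comm]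
  have all : ∀ x' y', (d : ℤ) ∣ c x' y' := by
    intro x' y'
    obtain ⟨q, hq⟩ := right x y hxy x'
    have h1 : c (x + (x' - q • x)) y = d := by
      simp [hxy, hq]; ring
    have h2 := left _ _ h1 y'
    have h3 := left _ _ hxy y'
    have h4 : c x' y' = c (x + (x' - q • x)) y' + (q - 1) * c x y' := by
      simp; ring
    rw [h4]
    exact dvd_add h2 (Dvd.dvd.mul_left h3 _)
  have hd1 : d = 1 := by
    by_contra h1
    obtain ⟨p, hpp, hpd⟩ := Nat.exists_prime_and_dvd h1
    exact hp p hpp fun x y => (Int.natCast_dvd_natCast.2 hpd).trans (all x y)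
  exact ⟨x, y, by rw [hxy, hd1]; rfl⟩
theorem gen_mod {D : Type*} [AddCommGroup D] [Module.Free ℤ D] [Module.Finite ℤ D] (p : ℕ) (hp : p.Prime) (k : ℕ)
    (f : Fin k → D) (h : ∀ x : D, ∃ a : Fin k → ℤ, ∃ y : D, x = ∑ i, a i • f i + (p : ℤ) • y) : finrank ℤ D ≤ k := by
  haveI : Fact p.Prime := ⟨hp⟩
  let b := finBasis ℤ D
  let ρ : D →+ (Fin (finrank ℤ D) → ZMod p) :=
    { toFun := fun x i => (b.repr x i : ZMod p)
      map_zero' := by ext; simp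
      map_add' := fun x y => by ext; simp }
  have hρ : ∀ x i, ρ x i = (b.repr x i : ZMod p) := fun _ _ => rfl
  have hsur : ∀ w, ∃ x, ρ x = w := by
    intro w
    refine ⟨∑ i, ((w i).val : ℤ) • b i, ?_⟩
    ext i
    rw [hρ, Basis.repr_sum_self]
    simp
  have htop : Submodule.span (ZMod p) (Set.range fun i => ρ (f i)) = ⊤ := by
    rw [eq_top_iff]
    intro w _
    obtain ⟨x, rfl⟩ := hsur w
    obtain ⟨a, y, rfl⟩ := h x
    have : ρ ((p : ℤ) • y) = 0 := by ext i; rw [hρ]; simp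
    rw [map_add, map_sum, this, add_zero]
    refine sum_mem fun i _ => ?_
    rw [map_zsmul]
    exact Submodule.smul_of_tower_mem _ (a i) (Submodule.subset_span (Set.mem_range_self i))
  have h1 := finrank_range_le_card (R := ZMod p) (fun i => ρ (f i))
  rw [Set.finrank, htop, finrank_top] at h1
  simpa using h1
section
variable {Λ : Type*} [AddCommGroup Λ] [Module.Free ℤ Λ] [Module.Finite ℤ Λ]
theorem mem_orth {M : Type*} [AddCommGroup M] {b : M →ₗ[ℤ] M →ₗ[ℤ] ℤ} {T : Submodule ℤ M} {x : M} :
    x ∈ orthSub b T ↔ ∀ y ∈ T, b x y = 0 := Iff.rfl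
theorem orth_sat {M : Type*} [AddCommGroup M] (b : M →ₗ[ℤ] M →ₗ[ℤ] ℤ) (T : Submodule ℤ M) :
    ∀ k : ℤ, k ≠ 0 → ∀ x, k • x ∈ orthSub b T → x ∈ orthSub b T := by
  intro k hk x hx y hy
  have := hx y hy
  rw [map_smul, LinearMap.smul_apply, smul_eq_mul] at this
  rcases mul_eq_zero.1 this with h | h
  · exact absurd h hk
  · exact h
theorem ext_repr {bΛ : Λ →ₗ[ℤ] Λ →ₗ[ℤ] ℤ} (hu : Function.Bijective bΛ) (K : Submodule ℤ Λ)
    (hsat : ∀ k : ℤ, k ≠ 0 → ∀ x, k • x ∈ K → x ∈ K) (f : K →ₗ[ℤ] ℤ) : ∃ l, ∀ x : K, bΛ l x = f x := by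
  obtain ⟨g, hg⟩ := extend_fun K hsat f
  obtain ⟨l, hl⟩ := hu.2 g
  exact ⟨l, fun x => by rw [hl, hg]⟩
theorem orth_orth {bΛ : Λ →ₗ[ℤ] Λ →ₗ[ℤ] ℤ} (hsymm : ∀ x y : Λ, bΛ x y = bΛ y x)
    (hneg : ∀ x : Λ, x ≠ 0 → bΛ x x < 0) (T : Submodule ℤ Λ)
    (hsat : ∀ k : ℤ, k ≠ 0 → ∀ x, k • x ∈ T → x ∈ T) {x : Λ} (hx : ∀ s ∈ orthSub bΛ T, bΛ x s = 0) : x ∈ T := by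
  haveI : Module.Free ℤ T := inferInstance
  obtain ⟨k, hk, t, ht⟩ := proj_lem (bΛ.domRestrict₁₂ T T) (fun w hw => hneg w (by simpa using hw))
    ((bΛ x).domRestrict T)
  have h1 : k • x - t ∈ orthSub bΛ T := by
    intro y hy
    have := ht ⟨y, hy⟩
    change bΛ t y = k * bΛ x y at this
    rw [map_sub, map_smul, LinearMap.sub_apply, LinearMap.smul_apply, this]; simp
  have h2 : k • x - t = 0 := by
    by_contra h0
    have h3 := hneg _ h0
    have h4 := hx _ h1
    have h5 : bΛ t (k • x - t) = 0 := by rw [hsymm]; exact h1 t t.2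
    rw [LinearMap.map_sub₂, map_smul, LinearMap.smul_apply, h4, h5] at h3
    simp at h3
  apply hsat k hk
  rw [sub_eq_zero] at h2
  rw [h2]; exact t.2
theorem not_dvd {bΛ : Λ →ₗ[ℤ] Λ →ₗ[ℤ] ℤ} (hsymm : ∀ x y : Λ, bΛ x y = bΛ y x)
    (hneg : ∀ x : Λ, x ≠ 0 → bΛ x x < 0) (hrank : finrank ℤ Λ = 24) (hu : Function.Bijective bΛ)
    (T : Submodule ℤ Λ) (hsat : ∀ k : ℤ, k ≠ 0 → ∀ x, k • x ∈ T → x ∈ T)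
    (hTlen : genLength ((↥T →ₗ[ℤ] ℤ) ⧸ LinearMap.range (bΛ.domRestrict₁₂ T T)) < finrank ℤ T)
    (ι : orthSub bΛ T →ₗ[ℤ] LM) (hι : ∀ x y, bLM (ι x) (ι y) = bΛ x y) (hinj : Function.Injective ι)
    (hιsat : ∀ k : ℤ, k ≠ 0 → ∀ x, k • x ∈ LinearMap.range ι → x ∈ LinearMap.range ι)
    (T' : Submodule ℤ LM) (hT' : ∀ x, x ∈ T' ↔ ∀ s, bLM x (ι s) = 0) (p : ℕ) (hp : p.Prime)
    (hdvd : ∀ x y : T', (p : ℤ) ∣ bLM x y) : False := by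
  haveI : Module.Free ℤ T := inferInstance
  haveI : Module.Free ℤ T' := inferInstance
  haveI : Module.Free ℤ (orthSub bΛ T) := inferInstance
  have hmem := Nat.sInf_mem (s := {k | ∃ f : Fin k → ((↥T →ₗ[ℤ] ℤ) ⧸ LinearMap.range (bΛ.domRestrict₁₂ T T)),
    Submodule.span ℤ (Set.range f) = ⊤}) (by
      obtain ⟨n, f, hf⟩ := Module.Finite.exists_fin (R := ℤ) (M := ((↥T →ₗ[ℤ] ℤ) ⧸ LinearMap.range (bΛ.domRestrict₁₂ T T)))
      exact ⟨n, f, hf⟩)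
  change ∃ f : Fin (genLength ((↥T →ₗ[ℤ] ℤ) ⧸ LinearMap.range (bΛ.domRestrict₁₂ T T))) → _, _ at hmem
  obtain ⟨k, hTlen, f, hf⟩ : ∃ k, k < finrank ℤ T ∧ ∃ f : Fin k → ((↥T →ₗ[ℤ] ℤ) ⧸ LinearMap.range (bΛ.domRestrict₁₂ T T)),
    Submodule.span ℤ (Set.range f) = ⊤ := ⟨_, hTlen, hmem⟩
  choose g hg using fun i => Submodule.mkQ_surjective _ (f i)
  choose l hl using fun i => ext_repr hu T hsat (g i)
  have hdecomp : ∀ x : Λ, ∃ a : Fin k → ℤ, ∃ t : T, ∃ s : orthSub bΛ T, x = ∑ i, a i • l i + t + s := by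
    intro x
    have h1 : (LinearMap.range (bΛ.domRestrict₁₂ T T)).mkQ ((bΛ x).domRestrict T) ∈ Submodule.span ℤ (Set.range f) := by
      rw [hf]; trivial
    obtain ⟨a, ha⟩ := (Submodule.mem_span_range_iff_exists_fun ℤ).1 h1
    have h2 : (LinearMap.range (bΛ.domRestrict₁₂ T T)).mkQ ((bΛ x).domRestrict T - ∑ i, a i • g i) = 0 := by
      rw [map_sub, map_sum, ← ha, sub_eq_zero]
      exact sum_congr rfl fun i _ => by rw [map_smul, hg]
    rw [Submodule.mkQ_apply, Submodule.Quotient.mk_eq_zero] at h2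
    obtain ⟨t, ht⟩ := h2
    refine ⟨a, t, ⟨x - ∑ i, a i • l i - t, ?_⟩, by simp⟩
    intro y hy
    have h3 := LinearMap.congr_fun ht ⟨y, hy⟩
    change bΛ t y = _ at h3
    simp only [LinearMap.sub_apply, LinearMap.domRestrict_apply, LinearMap.sum_apply, LinearMap.smul_apply] at h3
    simp only [map_sub, map_sum, map_smul, LinearMap.sub_apply, LinearMap.sum_apply, LinearMap.smul_apply, h3]
    have h4 : ∀ i, bΛ (l i) y = g i ⟨y, hy⟩ := fun i => hl i ⟨y, hy⟩
    simp only [h4]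
    ring
  let e : orthSub bΛ T ≃ₗ[ℤ] LinearMap.range ι := LinearEquiv.ofInjective ι hinj
  have he : ∀ s, (e s : LM) = ι s := fun s => rfl
  have hn : ∀ i, ∃ n : LM, ∀ s, bLM n (ι s) = bΛ (l i) s := by
    intro i
    obtain ⟨h, hh⟩ := extend_fun (LinearMap.range ι) hιsat (((bΛ (l i)).domRestrict _) ∘ₗ e.symm.toLinearMap)
    obtain ⟨n, hn⟩ := bLM_repr h
    refine ⟨n, fun s => ?_⟩
    rw [hn, ← he, hh]
    simp
  choose n hn using hn
  have hdecomp' : ∀ x : LM, ∃ a : Fin k → ℤ, ∃ t : T', ∃ s, x = ∑ i, a i • n i + t + ι s := by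
    intro x
    obtain ⟨y, hy⟩ := ext_repr hu (orthSub bΛ T) (orth_sat bΛ T) ((bLM x) ∘ₗ ι)
    obtain ⟨a, t, s, rfl⟩ := hdecomp y
    refine ⟨a, ⟨x - ∑ i, a i • n i - ι s, ?_⟩, s, (show ∀ A B C : LM, A = B + (A - B - C) + C by intros; abel) _ _ _⟩
    rw [hT']
    intro s'
    have h1 := hy s'
    have h2 : bΛ t s' = 0 := by rw [hsymm]; exact s'.2 t t.2
    simp only [map_add, map_sum, map_smul, LinearMap.add_apply, LinearMap.sum_apply, LinearMap.smul_apply, h2, LinearMap.comp_apply] at h1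
    simp only [map_sub, map_sum, map_smul, LinearMap.sub_apply, LinearMap.sum_apply, LinearMap.smul_apply, hn, hι, ← h1]
    ring
  have hT'sat : ∀ k : ℤ, k ≠ 0 → ∀ x, k • x ∈ T' → x ∈ T' := by
    intro k hk x hx
    rw [hT'] at hx ⊢
    intro s
    have := hx s
    rw [map_smul, LinearMap.smul_apply, smul_eq_mul] at this
    exact (mul_eq_zero.1 this).resolve_left hk
  have h1 := gen_mod (D := T' →ₗ[ℤ] ℤ) p hp k (fun i => (bLM (n i)).domRestrict T') (by
    intro φ
    obtain ⟨h, hh⟩ := extend_fun T' hT'sat φ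
    obtain ⟨x, hx⟩ := bLM_repr h
    obtain ⟨a, t, s, rfl⟩ := hdecomp' x
    choose c hc using hdvd t
    have hp0 : (p : ℤ) ≠ 0 := by exact_mod_cast hp.ne_zero
    refine ⟨a, { toFun := c, map_add' := ?_, map_smul' := ?_ }, ?_⟩
    · intro x y
      apply mul_left_cancel₀ hp0
      rw [mul_add, ← hc, ← hc, ← hc]; simp
    · intro m x
      apply mul_left_cancel₀ hp0
      rw [← hc, smul_eq_mul, RingHom.id_apply, mul_left_comm, ← hc]; simp [-zsmul_eq_mul]
    · ext y
      rw [← hh, ← hx]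
      have h2 : bLM (ι s) y = 0 := by rw [bLM_symm]; exact (hT' _).1 y.2 s
      simp [h2, hc, -zsmul_eq_mul])
  have h2 : finrank ℤ (T' →ₗ[ℤ] ℤ) = finrank ℤ T' := by
    rw [finrank_linearMap, finrank_self, mul_one]
  have h3 : finrank ℤ T + finrank ℤ (orthSub bΛ T) ≤ 24 := by
    rw [← hrank, ← finrank_prod]
    apply LinearMap.finrank_le_finrank_of_injective (f := T.subtype.coprod (orthSub bΛ T).subtype)
    rw [← LinearMap.ker_eq_bot, LinearMap.ker_eq_bot']
    rintro ⟨t, s⟩ h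
    simp only [LinearMap.coprod_apply, Submodule.subtype_apply] at h
    have hts : (t : Λ) = - s := eq_neg_of_add_eq_zero_left h
    have h4 : bΛ s t = 0 := s.2 t t.2
    have hs0 : (s : Λ) = 0 := by
      by_contra hs
      have := hneg _ hs
      rw [hts] at h4
      simp at h4
      omega
    rw [hs0] at hts
    ext
    · simpa using hts
    · exact hs0
  have h4 : 24 ≤ finrank ℤ T' + finrank ℤ (orthSub bΛ T) := by
    let q : LM →ₗ[ℤ] (orthSub bΛ T →ₗ[ℤ] ℤ) := (LinearMap.lcomp ℤ ℤ ι) ∘ₗ bLM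
    have hq : LinearMap.ker q = T' := by
      ext x
      rw [LinearMap.mem_ker, hT', LinearMap.ext_iff]
      rfl
    have h5 := Submodule.finrank_quotient_add_finrank (LinearMap.ker q)
    rw [LinearEquiv.finrank_eq q.quotKerEquivRange] at h5
    have h6 := Submodule.finrank_le (LinearMap.range q)
    have h7 : finrank ℤ (orthSub bΛ T →ₗ[ℤ] ℤ) = finrank ℤ (orthSub bΛ T) := by
      rw [finrank_linearMap, finrank_self, mul_one]
    have h8 : finrank ℤ LM = 24 := by simp [LM]
    rw [hq] at h5
    omega
  omega
theorem g_ext {bΛ : Λ →ₗ[ℤ] Λ →ₗ[ℤ] ℤ} (hsymm : ∀ x y : Λ, bΛ x y = bΛ y x)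
    (hneg : ∀ x : Λ, x ≠ 0 → bΛ x x < 0) (hu : Function.Bijective bΛ)
    (T : Submodule ℤ Λ) (hsat : ∀ k : ℤ, k ≠ 0 → ∀ x, k • x ∈ T → x ∈ T)
    (ι : orthSub bΛ T →ₗ[ℤ] LM) (hι : ∀ x y, bLM (ι x) (ι y) = bΛ x y)
    (g : Λ ≃ₗ[ℤ] Λ) (hg : ∀ x y, bΛ (g x) (g y) = bΛ x y) (hgT : ∀ t ∈ T, g t = t) :
    ∃ gbar : LM ≃ₗ[ℤ] LM, (∀ x y : LM, bLM (gbar x) (gbar y) = bLM x y) ∧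
      (∀ s : orthSub bΛ T, ∃ s' : orthSub bΛ T, g (s : Λ) = (s' : Λ) ∧ gbar (ι s) = ι s') ∧
      (∀ x : LM, (∀ s, bLM x (ι s) = 0) → gbar x = x) := by
  let r : Λ →ₗ[ℤ] (orthSub bΛ T →ₗ[ℤ] ℤ) := (LinearMap.lcomp ℤ ℤ (orthSub bΛ T).subtype) ∘ₗ bΛ
  have hr : Function.Surjective r := by
    intro f
    obtain ⟨l, hl⟩ := ext_repr hu (orthSub bΛ T) (orth_sat bΛ T) f
    exact ⟨l, LinearMap.ext hl⟩
  obtain ⟨c, hc⟩ := Module.projective_lifting_property r ((LinearMap.lcomp ℤ ℤ ι) ∘ₗ bLM) hr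
  have hc : ∀ (n : LM) (s : orthSub bΛ T), bΛ (c n) s = bLM n (ι s) := fun n s =>
    LinearMap.congr_fun (LinearMap.congr_fun hc n) s
  have hST : ∀ x, (∀ s : orthSub bΛ T, bΛ x s = 0) → x ∈ T := fun x hx =>
    orth_orth hsymm hneg T hsat (fun s hs => hx ⟨s, hs⟩)
  have main : ∀ g : Λ ≃ₗ[ℤ] Λ, (∀ x y, bΛ (g x) (g y) = bΛ x y) → (∀ t ∈ T, g t = t) →
      ∃ γ : LM →ₗ[ℤ] LM, ∃ δ : Λ →ₗ[ℤ] orthSub bΛ T, (∀ x, (δ x : Λ) = g x - x) ∧ (∀ n, γ n = n + ι (δ (c n))) ∧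
        ∀ t ∈ T, δ t = 0 := by
    intro g hg hgT
    let δ : Λ →ₗ[ℤ] orthSub bΛ T := (g.toLinearMap - LinearMap.id).codRestrict _ (by
      intro x y hy
      have h1 := hg x y
      rw [hgT y hy] at h1
      simp [h1])
    refine ⟨LinearMap.id + ι ∘ₗ δ ∘ₗ c, δ, fun x => rfl, fun n => rfl, fun t ht => ?_⟩
    ext
    change g t - t = 0
    rw [hgT t ht, sub_self]
  have comp : ∀ g h : Λ ≃ₗ[ℤ] Λ, (∀ x, h (g x) = x) → ∀ (γ γ' : LM →ₗ[ℤ] LM) (δ δ' : Λ →ₗ[ℤ] orthSub bΛ T),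
      (∀ x, (δ x : Λ) = g x - x) → (∀ n, γ n = n + ι (δ (c n))) → (∀ x, (δ' x : Λ) = h x - x) →
      (∀ n, γ' n = n + ι (δ' (c n))) → (∀ t ∈ T, δ' t = 0) → ∀ n, γ' (γ n) = n := by
    intro g h hgh γ γ' δ δ' hδ hγ hδ' hγ' h0 n
    have h1 : c (γ n) - g (c n) ∈ T := by
      apply hST
      intro s
      have h2 : g (c n) = c n + δ (c n) := by rw [hδ]; abel
      rw [h2, hγ]
      simp [hc, hι]
    have h2 := h0 _ h1
    rw [map_sub, sub_eq_zero] at h2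
    rw [hγ', h2, hγ, add_assoc, ← map_add]
    have h3 : δ (c n) + δ' (g (c n)) = 0 := by
      ext
      simp [hδ, hδ', hgh]
    rw [h3, map_zero, add_zero]
  have hg' : ∀ x y, bΛ (g.symm x) (g.symm y) = bΛ x y := fun x y => by
    rw [← hg]; simp
  have hgT' : ∀ t ∈ T, g.symm t = t := fun t ht => by
    rw [LinearEquiv.symm_apply_eq, hgT t ht]
  obtain ⟨γ, δ, h1, h2, h3⟩ := main g hg hgT
  obtain ⟨γ', δ', h1', h2', h3'⟩ := main g.symm hg' hgT'
  have hl := comp g g.symm (by simp) γ γ' δ δ' h1 h2 h1' h2' h3'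
  have hr' := comp g.symm g (by simp) γ' γ δ' δ h1' h2' h1 h2 h3
  refine ⟨LinearEquiv.ofLinear γ γ' (LinearMap.ext hr') (LinearMap.ext hl), ?_, ?_, ?_⟩
  · intro x y
    change bLM (γ x) (γ y) = _
    rw [h2, h2]
    have e1 : bLM (ι (δ (c x))) y = bΛ (δ (c x)) (c y) := by rw [bLM_symm, ← hc, hsymm]
    have e2 := hg (c x) (c y)
    have e3 : ∀ z, g z = z + δ z := fun z => by rw [h1]; abel
    rw [e3, e3] at e2
    simp only [map_add, LinearMap.add_apply] at e2 ⊢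
    rw [e1, hι, ← hc]
    linarith
  · intro s
    have h4 : c (ι s) - s ∈ T := by
      apply hST
      intro s'
      simp [hc, hι]
    have h5 := h3 _ h4
    rw [map_sub, sub_eq_zero] at h5
    refine ⟨s + δ s, ?_, ?_⟩
    · rw [Submodule.coe_add, h1]; abel
    · change γ (ι s) = _
      rw [h2, h5, map_add]
  · intro x hx
    change γ x = x
    have h4 : c x ∈ T := hST _ (fun s => by rw [hc, hx])
    rw [h2, h3 _ h4, map_zero, add_zero]
end
theorem pos_vec {S : Type*} [AddCommGroup S] [Module.Free ℤ S] [Module.Finite ℤ S] (c : S →ₗ[ℤ] S →ₗ[ℤ] ℤ)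
    (hneg : ∀ w, w ≠ 0 → c w w < 0) (ι : S →ₗ[ℤ] LM) (hι : ∀ x y, bLM (ι x) (ι y) = c x y)
    (y : LM) (hy : ∀ s, bLM y (ι s) = 0) :
    ∃ z : LM, (∀ s, bLM z (ι s) = 0) ∧ bLM z y = 0 ∧ 0 < bLM z z := by
  obtain ⟨w, hw0, hw⟩ : ∃ w : LM, bLM w y = 0 ∧ 0 < bLM w w := by
    let p : Fin 4 → LM := fun i => Pi.single (Sum.inl (i, 0)) 1 + Pi.single (Sum.inl (i, 1)) 1
    have h00 : bLM (p 0) (p 0) = 2 := by decide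
    have h01 : bLM (p 0) (p 1) = 0 := by decide
    have h11 : bLM (p 1) (p 1) = 2 := by decide
    have h10 : bLM (p 1) (p 0) = 0 := by decide
    by_cases h : bLM (p 0) y = 0
    · exact ⟨p 0, h, by rw [h00]; norm_num⟩
    · refine ⟨bLM (p 1) y • p 0 - bLM (p 0) y • p 1, ?_, ?_⟩
      · simp only [map_sub, map_smul, LinearMap.sub_apply, LinearMap.smul_apply, smul_eq_mul]; ring
      · simp only [map_sub, map_smul, LinearMap.sub_apply, LinearMap.smul_apply, smul_eq_mul, h00, h01, h10, h11]
        have := sq_pos_of_ne_zero h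
        nlinarith [sq_nonneg (bLM (p 1) y)]
  obtain ⟨k, hk, s, hs⟩ := proj_lem c hneg ((bLM w) ∘ₗ ι)
  have hs' : ∀ s', c s s' = k * bLM w (ι s') := hs
  refine ⟨k • w - ι s, ?_, ?_, ?_⟩
  · intro s'
    simp only [map_sub, map_smul, LinearMap.sub_apply, LinearMap.smul_apply, smul_eq_mul, hι, hs', sub_self]
  · rw [map_sub, map_smul, LinearMap.sub_apply, LinearMap.smul_apply, hw0, bLM_symm (ι s), hy]; simp
  · simp only [map_sub, map_smul, LinearMap.sub_apply, LinearMap.smul_apply, smul_eq_mul, hι, bLM_symm (ι s) w]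
    have h1 := hs' s
    have h2 : c s s ≤ 0 := by
      by_cases h : s = 0
      · rw [h]; simp
      · exact (hneg s h).le
    have h3 := mul_pos (sq_pos_of_ne_zero hk) hw
    nlinarith
theorem choose_v (x y z : LM) (hxy : bLM x y = 1) (hzy : bLM z y = 0) (hz : 0 < bLM z z) :
    ∃ M : ℤ, 0 < bLM (x + M • z) (x + M • z) ∧ bLM (x + M • z) y = 1 := by
  refine ⟨|bLM x x| + 2 * |bLM x z| + 1, ?_, ?_⟩
  · simp only [map_add, map_smul, LinearMap.add_apply, LinearMap.smul_apply, smul_eq_mul, bLM_symm z x]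
    generalize bLM x x = a
    generalize bLM x z = b
    generalize bLM z z = c at *
    have h1 := abs_nonneg a
    have h2 := abs_nonneg b
    have h3 := neg_abs_le a
    have h4 := neg_abs_le b
    generalize hM : |a| + 2 * |b| + 1 = M
    have hM1 : 1 ≤ M := by omega
    have h5 : M * M ≤ M * (M * c) := by
      apply mul_le_mul_of_nonneg_left _ (by omega)
      nlinarith
    have h6 : 0 ≤ M * (b + |b|) := mul_nonneg (by omega) (by omega)
    have h7 : M * M = M * |a| + 2 * (M * |b|) + M := by nlinarith
    have h8 : |a| ≤ M * |a| := by nlinarith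
    nlinarith
  · simp [hxy, hzy, -zsmul_eq_mul]
theorem div_one (R : Submodule ℤ LM) (hR : ∀ k : ℤ, k ≠ 0 → ∀ x, k • x ∈ R → x ∈ R)
    (t : LM) (ht : t ∈ R) (ht0 : t ≠ 0) (hprim : ∀ (k : ℤ) (w : LM), w ∈ R → t = k • w → IsUnit k) :
    ∃ x, bLM t x = 1 := by
  obtain ⟨g, hg⟩ := (IsPrincipalIdealRing.principal (LinearMap.range (bLM t))).principal
  have hd : ∀ x, ∃ c : ℤ, c * g = bLM t x := by
    intro x
    have : bLM t x ∈ Submodule.span ℤ {g} := by rw [← hg]; exact ⟨x, rfl⟩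
    obtain ⟨c, hc⟩ := Submodule.mem_span_singleton.1 this
    exact ⟨c, hc⟩
  choose c hc using hd
  have hg0 : g ≠ 0 := by
    rintro rfl
    exact ht0 (bLM_nondeg t fun y => by rw [← hc]; simp)
  obtain ⟨n, hn⟩ := bLM_repr { toFun := c, map_add' := by
                                  intro x y
                                  apply mul_right_cancel₀ hg0
                                  rw [add_mul, hc, hc, hc, map_add]
                               map_smul' := by
                                  intro m x
                                  apply mul_right_cancel₀ hg0
                                  rw [hc, map_smul, ← hc]
                                  simp [mul_assoc] }
  have htn : t = g • n := by
    rw [← sub_eq_zero]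
    apply bLM_nondeg
    intro y
    rw [map_sub, map_smul, LinearMap.sub_apply, LinearMap.smul_apply, hn]
    change _ - g * c y = 0
    rw [← hc]; ring
  have hu := hprim g n (hR g hg0 n (htn ▸ ht)) htn
  obtain ⟨x0, hx0⟩ : g ∈ LinearMap.range (bLM t) := by rw [hg]; exact Submodule.mem_span_singleton_self g
  refine ⟨g • x0, ?_⟩
  rw [map_smul, hx0]
  exact Int.isUnit_mul_self hu
theorem no_wall (R : Submodule ℤ LM) (hR : ∀ k : ℤ, k ≠ 0 → ∀ x, k • x ∈ R → x ∈ R)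
    (hneg : ∀ t ∈ R, t ≠ 0 → bLM t t < 0) (hroot : ∀ t ∈ R, bLM t t ≠ -2)
    (v y : LM) (hvR : ∀ t ∈ R, bLM v t = 0) (hyR : ∀ t ∈ R, bLM y t = 0) (hvy : bLM v y = 1) (hv : 0 < bLM v v)
    (t : LM) (ht : t ∈ R) : ¬ IsWallDivisor v t := by
  rintro ⟨-, ht0, hprim, T, r, -, htT, -, -, hT, hcase⟩
  rw [hT] at htT
  obtain ⟨α, β, hαβ⟩ := Submodule.mem_span_pair.1 htT
  have h1 : α + β * bLM r y = 0 := by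
    have h := hyR t ht
    rw [bLM_symm, ← hαβ] at h
    simpa [hvy, -zsmul_eq_mul] using h
  have hα : α = -(β * bLM r y) := by linarith
  have htr : t = β • (r - bLM r y • v) := by
    rw [← hαβ, hα]; module
  have hβ : β ≠ 0 := by
    rintro rfl
    apply ht0; rw [htr, zero_smul]
  have hr' : r - bLM r y • v ∈ R := hR β hβ _ (htr ▸ ht)
  generalize bLM r y = a at *
  generalize hr0 : r - a • v = r' at *
  have hr : r = r' + a • v := by rw [← hr0]; abel
  have hvr' := hvR _ hr'
  have hr'0 : r' ≠ 0 := by rintro rfl; apply ht0; rw [htr, smul_zero]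
  have hn := hneg _ hr' hr'0
  have hrt := hroot _ hr'
  have e1 : bLM v r = a * bLM v v := by rw [hr]; simp [hvr', -zsmul_eq_mul]
  have e2 : bLM r r = bLM r' r' + a ^ 2 * bLM v v := by
    rw [hr]; simp [hvr', bLM_symm r' v, -zsmul_eq_mul]; ring
  rw [e1, e2] at hcase
  generalize bLM v v = q at *
  generalize bLM r' r' = m at *
  have ha : a = 0 := by
    by_contra ha
    have hsq : 1 ≤ a ^ 2 := by
      have := sq_pos_of_ne_zero ha
      omega
    rcases hcase with ⟨_, h2, h3⟩ | ⟨_, _, h4⟩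
    · have : 1 ≤ a := by
        by_contra hlt
        have : a ≤ -1 := by omega
        nlinarith
      nlinarith
    · have : q ^ 2 ≤ a ^ 2 * q ^ 2 := by nlinarith [sq_nonneg q]
      nlinarith [sq_nonneg q, sq_pos_of_pos hv]
  subst ha
  rcases hcase with ⟨h2, _⟩ | ⟨h3, _⟩
  · apply hrt; linarith
  · nlinarith
end WL

/-- a finite group `G` of isometries of the Leech lattice `Λ` with
`rk S_G(Λ) ≤ 20` and `rk T_G(Λ) > l(A_{T_G(Λ)})` is realised on `v^⊥ ⊆ L_M` for some
primitive `v` of square `2n-2`, with `S_G(Λ)` primitively embedded in `v^⊥`, all whose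
elements have divisibility one, containing no numerical wall divisor, and `G` acting as
the identity on the orthogonal complement of `S_G(Λ)` in `v^⊥`. -/
theorem stmt4
    (Λ : Type*) [AddCommGroup Λ] [Module.Free ℤ Λ] [Module.Finite ℤ Λ]
    (bΛ : Λ →ₗ[ℤ] Λ →ₗ[ℤ] ℤ)
    (hsymm : ∀ x y : Λ, bΛ x y = bΛ y x)
    (heven : ∀ x : Λ, Even (bΛ x x))
    (hneg : ∀ x : Λ, x ≠ 0 → bΛ x x < 0)
    (hrank : finrank ℤ Λ = 24)
    (hunimodular : Function.Bijective bΛ)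
    (hnoroot : ∀ x : Λ, bΛ x x ≠ -2)
    (G : Subgroup (Λ ≃ₗ[ℤ] Λ)) [Finite G]
    (hGiso : ∀ g ∈ G, ∀ x y : Λ, bΛ (g x) (g y) = bΛ x y)
    (hSrank : finrank ℤ (orthSub bΛ (invSub G)) ≤ 20)
    (hTlen :
      genLength ((↥(invSub G) →ₗ[ℤ] ℤ) ⧸
          LinearMap.range (bΛ.domRestrict₁₂ (invSub G) (invSub G)))
        < finrank ℤ (invSub G)) :
    ∃ n : ℕ, 2 ≤ n ∧ ∃ v : LM,
      (∀ (k : ℤ) (w : LM), v = k • w → IsUnit k) ∧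
      bLM v v = 2 * (n : ℤ) - 2 ∧
      ∃ ι : ↥(orthSub bΛ (invSub G)) →ₗ[ℤ] LM,
        Function.Injective ι ∧
        (∀ x y : ↥(orthSub bΛ (invSub G)), bLM (ι x) (ι y) = bΛ (x : Λ) (y : Λ)) ∧
        (∀ s, bLM v (ι s) = 0) ∧
        (∀ x : LM, bLM v x = 0 → ∀ k : ℤ, k ≠ 0 →
          k • x ∈ LinearMap.range ι → x ∈ LinearMap.range ι) ∧
        (∀ t ∈ LinearMap.range ι, t ≠ 0 →
          (∀ (k : ℤ) (w : LM), w ∈ LinearMap.range ι → t = k • w → IsUnit k) →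
          ∃ x : LM, bLM v x = 0 ∧ bLM t x = 1) ∧
        (∀ t ∈ LinearMap.range ι, ¬ IsWallDivisor v t) ∧
        (∀ g ∈ G, ∃ gbar : LM ≃ₗ[ℤ] LM,
          (∀ x y : LM, bLM (gbar x) (gbar y) = bLM x y) ∧ gbar v = v ∧
          (∀ s : ↥(orthSub bΛ (invSub G)), ∃ s' : ↥(orthSub bΛ (invSub G)),
            g (s : Λ) = (s' : Λ) ∧ gbar (ι s) = ι s') ∧
          (∀ x : LM, bLM v x = 0 → (∀ s, bLM x (ι s) = 0) → gbar x = x)) := by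
  have hTsat : ∀ k : ℤ, k ≠ 0 → ∀ x, k • x ∈ invSub G → x ∈ invSub G := by
    intro k hk x hx g hg
    have h := hx g hg
    rw [_root_.map_smul] at h
    exact smul_right_injective Λ hk h
  obtain ⟨ι, hι, hιsat⟩ := WL.core bΛ hsymm heven hneg hrank hunimodular (orthSub bΛ (invSub G)) hSrank
    (WL.orth_sat bΛ (invSub G))
  have hinj : Function.Injective ι := by
    rw [injective_iff_map_eq_zero]
    intro s hs
    by_contra h0
    have h1 := hneg s (by simpa using h0)
    rw [← hι, hs] at h1
    simp at h1
  have hT' : ∀ x, x ∈ orthSub bLM (LinearMap.range ι) ↔ ∀ s, bLM x (ι s) = 0 := by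
    intro x
    constructor
    · exact fun h s => h _ ⟨s, rfl⟩
    · rintro h _ ⟨s, rfl⟩
      exact h s
  obtain ⟨x, y, hxy⟩ := WL.exists_one (bLM.domRestrict₁₂ (orthSub bLM (LinearMap.range ι)) (orthSub bLM (LinearMap.range ι)))
    (fun p hp hdvd => WL.not_dvd hsymm hneg hrank hunimodular (invSub G) hTsat hTlen ι hι hinj hιsat _ hT' p hp hdvd)
  obtain ⟨x, hx⟩ := x
  obtain ⟨y, hy⟩ := y
  rw [hT'] at hx hy
  change bLM x y = 1 at hxy
  obtain ⟨z, hz, hzy, hzz⟩ := WL.pos_vec (bΛ.domRestrict₁₂ (orthSub bΛ (invSub G)) (orthSub bΛ (invSub G)))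
    (fun w hw => hneg w (by simpa using hw)) ι hι y hy
  obtain ⟨M, hvpos, hvy⟩ := WL.choose_v x y z hxy hzy hzz
  have hvι : ∀ s, bLM (x + M • z) (ι s) = 0 := by
    intro s
    rw [map_add, _root_.map_smul, LinearMap.add_apply, LinearMap.smul_apply, hx, hz]; simp
  generalize x + M • z = v at hvpos hvy hvι
  obtain ⟨m, hm⟩ := WL.bLM_even v
  refine ⟨m.toNat + 1, by omega, v, ?_, ?_, ι, hinj, hι, hvι, ?_, ?_, ?_, ?_⟩
  · intro k w hw
    rw [hw, _root_.map_smul, LinearMap.smul_apply, smul_eq_mul] at hvy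
    exact IsUnit.of_mul_eq_one _ hvy
  · push_cast
    rw [Int.toNat_of_nonneg (by omega), hm]; ring
  · intro x _ k hk hx
    exact hιsat k hk x hx
  · intro t ht ht0 hprim
    obtain ⟨x0, hx0⟩ := WL.div_one (LinearMap.range ι) hιsat t ht ht0 hprim
    refine ⟨x0 - bLM v x0 • y, ?_, ?_⟩
    · rw [map_sub, _root_.map_smul, hvy]; simp
    · obtain ⟨s, rfl⟩ := ht
      rw [map_sub, _root_.map_smul, WL.bLM_symm _ y, hy, hx0]; simp
  · intro t ht
    refine WL.no_wall (LinearMap.range ι) hιsat ?_ ?_ v y ?_ ?_ hvy hvpos t ht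
    · rintro _ ⟨s, rfl⟩ h0
      rw [hι]
      apply hneg
      intro h
      apply h0
      have : s = 0 := by ext; exact h
      rw [this, map_zero]
    · rintro _ ⟨s, rfl⟩
      rw [hι]
      exact hnoroot _
    · rintro _ ⟨s, rfl⟩
      exact hvι s
    · rintro _ ⟨s, rfl⟩
      exact hy s
  · intro g hg
    obtain ⟨gbar, h1, h2, h3⟩ := WL.g_ext hsymm hneg hunimodular (invSub G) hTsat ι hι g (hGiso g hg)
      (fun t ht => ht g hg)
    exact ⟨gbar, h1, h3 v hvι, h2, fun x _ hx => h3 x hx⟩
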